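/- Let $k$ and $\ell$ be multiplicatively independent integers, each at least $2$, let $d \ge 2$, and let $\Gamma = (Q, \Sigma_k^d, \delta, q_0, F)$ and $\Gamma' = (Q', \Sigma_\ell^d, \delta', q_0', F')$ be deterministic finite automata accepting sparse regular languages $\mathcal{L} \subseteq (\Sigma_k^d)^*$ and $\mathcal{L}' \subseteq (\Sigma_\ell^d)^*$ respectively. Let $X \subseteq \mathbb{N}^d$ be the set of $d$-tuples of natural numbers whose base-$k$ expansions lie in $\mathcal{L}$, and let $Y \subseteq \mathbb{N}^d$ be the set of $d$-tuples whose base-$\ell$ expansions lie in $\mathcal{L}'$. Then $|X \cap Y| \le k^{d|Q|} \cdot \ell^{d|Q'|} \cdot (8(|Q| + |Q'| - 1))^{10d(|Q| + |Q'|)^5}$. -/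

import Mathlib

/-- Two natural numbers `k, ℓ ≥ 2` are multiplicatively independent if
`k^a = ℓ^b` with integers `a, b` implies `a = b = 0`. -/
def MultIndep (k l : ℕ) : Prop :=
  ∀ a b : ℤ, (k : ℚ) ^ a = (l : ℚ) ^ b → a = 0 ∧ b = 0

/-- The `d`-tuple of natural numbers represented by a word over the alphabet
`Fin d → Fin k` (each letter is a column of base-`k` digits, most significant
digit first). -/
def decodeTuple (k d : ℕ) (w : List (Fin d → Fin k)) : Fin d → ℕ :=
  fun i => w.foldl (fun a c => k * a + (c i : ℕ)) 0

/-- A word over `Fin d → Fin k` is a canonical base-`k` representation of a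
`d`-tuple if its first letter (if any) is not the all-zeros column, i.e.
at least one coordinate word has no leading zero. -/
def CanonicalWord {k d : ℕ} (w : List (Fin d → Fin k)) : Prop :=
  ∀ c ∈ w.head?, ∃ i, (c i : ℕ) ≠ 0

/-- The language of base-`k` expansions (as equal-length padded digit words,
with minimal padding) of the elements of a set `S ⊆ ℕ^d`. -/
def ReprLang (k d : ℕ) (S : Set (Fin d → ℕ)) : Language (Fin d → Fin k) :=
  { w | CanonicalWord w ∧ decodeTuple k d w ∈ S }

/-- A language over a finite alphabet is sparse if its counting function
`f(n) = #{w ∈ L : |w| ≤ n}` is `O(n^e)` for some natural number `e`. -/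
def IsSparseLang {α : Type*} (L : Language α) : Prop :=
  ∃ e C N : ℕ, ∀ n ≥ N, {w ∈ L | w.length ≤ n}.ncard ≤ C * n ^ e

/-- A set `S ⊆ ℕ^d` is a sparse `k`-automatic set if the language of base-`k`
expansions of its elements is regular and sparse. -/
def IsSparseAutomatic (k d : ℕ) (S : Set (Fin d → ℕ)) : Prop :=
  (ReprLang k d S).IsRegular ∧ IsSparseLang (ReprLang k d S)

theorem iteratedDeriv_succ_of_eq_add_sub_mul {f g : ℂ → ℂ} {a : ℂ} (hg : Differentiable ℂ g)
    (h : ∀ z, f z = f a + (z - a) * g z) (j : ℕ) (z : ℂ) :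
    iteratedDeriv (j + 1) f z =
      (z - a) * iteratedDeriv (j + 1) g z + (j + 1) * iteratedDeriv j g z := by
  have hd : ∀ j, Differentiable ℂ (iteratedDeriv j g) := fun j =>
    (hg.contDiff (n := (j + 1 : ℕ))).differentiable_iteratedDeriv j (by exact_mod_cast j.lt_succ_self)
  induction j generalizing z with
  | zero =>
    have : f = fun z => f a + (z - a) * g z := funext h
    rw [zero_add, iteratedDeriv_one, iteratedDeriv_one, iteratedDeriv_zero]
    have h1 : HasDerivAt (fun z => f a + (z - a) * g z) (1 * g z + (z - a) * deriv g z) z :=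
      (((hasDerivAt_id z).sub_const a).mul (hg z).hasDerivAt).const_add _
    rw [this, h1.deriv]; push_cast; ring
  | succ j ih =>
    rw [iteratedDeriv_succ, funext ih]
    have h1 : HasDerivAt (fun z => (z - a) * iteratedDeriv (j + 1) g z
        + ((j : ℂ) + 1) * iteratedDeriv j g z)
        ((1 * iteratedDeriv (j + 1) g z + (z - a) * deriv (iteratedDeriv (j + 1) g) z)
          + (j + 1) * deriv (iteratedDeriv j g) z) z :=
      (((hasDerivAt_id z).sub_const a).mul (hd _ z).hasDerivAt).add
        ((hd _ z).hasDerivAt.const_mul _)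
    rw [h1.deriv, ← iteratedDeriv_succ, ← iteratedDeriv_succ]; push_cast; ring

theorem norm_le_of_small_jets (N : Finset ℕ) (T : ℕ) (X R : ℝ) (hX : 1 ≤ X) (hR : 2 * X ≤ R)
    (hN : ∀ s ∈ N, (s : ℝ) ≤ X) (x : ℝ) (hx0 : 0 ≤ x) (hxX : x ≤ X) :
    ∀ (n : ℕ) (f : ℂ → ℂ) (τ : ℕ → ℕ) (K δ : ℝ), Differentiable ℂ f → 0 ≤ δ →
      (∀ s ∈ N, τ s ≤ T) → (∑ s ∈ N, τ s = n) →
      (∀ s ∈ N, ∀ j < τ s, ‖iteratedDeriv j f s‖ ≤ δ * j.factorial) →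
      (∀ z : ℂ, ‖z‖ = R → ‖f z‖ ≤ K) →
      ‖f x‖ ≤ K * (X / (R - X)) ^ n + δ * (X * (T + 1) + 2) ^ n := by
  intro n
  have hRX : X ≤ R - X := by linarith
  have hRX0 : 0 < R - X := by linarith
  have hTpos : (0 : ℝ) ≤ T := T.cast_nonneg
  induction n with
  | zero =>
    intro f τ K δ hf hδ _ _ _ hK
    have : ‖f x‖ ≤ K := by
      apply Complex.norm_le_of_forall_mem_frontier_norm_le (U := Metric.ball 0 R)
        Metric.isBounded_ball hf.diffContOnCl
      · intro z hz
        rw [frontier_ball _ (by linarith)] at hz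
        exact hK z (by simpa using hz)
      · apply subset_closure
        simp only [Metric.mem_ball, dist_zero_right, Complex.norm_real, Real.norm_eq_abs,
          abs_of_nonneg hx0]
        linarith
    simp only [pow_zero, mul_one]; linarith
  | succ n ih =>
    intro f τ K δ hf hδ hτ hn hj hK
    obtain ⟨a, haN, hτa⟩ : ∃ a ∈ N, τ a ≠ 0 := by
      by_contra! h
      rw [Finset.sum_eq_zero h] at hn
      omega
    have haX := hN a haN
    have ha0 : (0 : ℝ) ≤ a := a.cast_nonneg
    set g := dslope f (a : ℂ) with hgdef
    have hg : Differentiable ℂ g := by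
      rw [← differentiableOn_univ] at hf ⊢
      exact (Complex.differentiableOn_dslope Filter.univ_mem).2 hf
    have hfg : ∀ z, f z = f a + (z - a) * g z := by
      intro z
      have := sub_smul_dslope f (a : ℂ) z
      rw [smul_eq_mul] at this
      rw [hgdef, this]; ring
    have hjet := iteratedDeriv_succ_of_eq_add_sub_mul hg hfg
    have hfa : ‖f a‖ ≤ δ := by
      simpa using hj a haN 0 (Nat.pos_of_ne_zero hτa)
    have hstep := ih g (Function.update τ a (τ a - 1)) ((K + δ) / (R - X)) ((T + 1) * δ) hg
      (by positivity) ?_ ?_ ?_ ?_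
    · have hρ0 : 0 ≤ X / (R - X) := by positivity
      have hρ1 : X / (R - X) ≤ 1 := by rw [div_le_one hRX0]; exact hRX
      have hxa : ‖(x : ℂ) - a‖ ≤ X := by
        rw [← Complex.ofReal_natCast, ← Complex.ofReal_sub, Complex.norm_real, Real.norm_eq_abs,
          abs_le]
        constructor <;> linarith
      have h1 : ‖f x‖ ≤ δ + X * ((K + δ) / (R - X) * (X / (R - X)) ^ n
          + (T + 1) * δ * (X * (T + 1) + 2) ^ n) := by
        rw [hfg x]
        refine (norm_add_le _ _).trans (add_le_add hfa ?_)
        rw [norm_mul]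
        exact mul_le_mul hxa hstep (norm_nonneg _) (by linarith)
      refine h1.trans ?_
      set ρ := X / (R - X) with hρ
      set H := X * (T + 1) + 2 with hH
      have hH1 : 1 ≤ H ^ n := one_le_pow₀ (by rw [hH]; nlinarith)
      have hρn : ρ ^ (n + 1) ≤ 1 := pow_le_one₀ hρ0 hρ1
      have e1 : X * ((K + δ) / (R - X) * ρ ^ n) = (K + δ) * ρ ^ (n + 1) := by
        rw [pow_succ, hρ]; ring
      have e2 : δ * H ^ (n + 1) = X * ((T + 1) * δ * H ^ n) + 2 * δ * H ^ n := by
        rw [pow_succ]; nth_rewrite 2 [hH]; ring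
      rw [mul_add, e1, e2]
      nlinarith
    · intro s hs
      by_cases hsa : s = a
      · subst hsa; simp; have := hτ s hs; omega
      · simp [hsa, hτ s hs]
    · have := Finset.sum_update_of_mem haN τ (τ a - 1)
      rw [this]
      have h2 := Finset.add_sum_erase N τ haN
      rw [Finset.sdiff_singleton_eq_erase]
      omega
    · intro s hs j hjs
      by_cases hsa : s = a
      · subst hsa
        simp only [Function.update_self] at hjs
        have h1 := hjet j s
        rw [sub_self, zero_mul, zero_add] at h1
        have h2 := hj s hs (j + 1) (by omega)
        rw [h1, norm_mul, Nat.factorial_succ] at h2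
        have h3 : ‖(j : ℂ) + 1‖ = j + 1 := by
          rw [← Nat.cast_add_one, Complex.norm_natCast]; push_cast; ring
        rw [h3] at h2
        push_cast at h2
        have hj1 : (0 : ℝ) < j + 1 := by positivity
        have h4 : ‖iteratedDeriv j g s‖ ≤ δ * j.factorial := by
          by_contra! h
          nlinarith [mul_lt_mul_of_pos_left h hj1]
        refine h4.trans ?_
        have : (0 : ℝ) ≤ δ * j.factorial := by positivity
        nlinarith
      · simp only [Function.update_of_ne hsa] at hjs
        have hsa1 : 1 ≤ ‖(s : ℂ) - a‖ := by
          have : ((s : ℂ) - a) = (((s : ℤ) - a : ℤ) : ℂ) := by push_cast; ring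
          rw [this, Complex.norm_intCast]
          have h5 : (s : ℤ) - a ≠ 0 := by omega
          exact_mod_cast Int.one_le_abs h5
        have key : ∀ i ≤ j, ‖iteratedDeriv i g s‖ ≤ (i + 2) * δ * i.factorial := by
          intro i
          induction i with
          | zero =>
            intro _
            have h1 := hfg s
            have h2 : ((s : ℂ) - a) * g s = f s - f a := by rw [h1]; ring
            have h3 := hj s hs 0 (by omega)
            simp only [iteratedDeriv_zero, Nat.factorial_zero, Nat.cast_one, mul_one] at h3
            have h4 : ‖(s : ℂ) - a‖ * ‖g s‖ ≤ 2 * δ := by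
              rw [← norm_mul, h2]
              exact (norm_sub_le _ _).trans (by linarith)
            simp only [iteratedDeriv_zero, Nat.factorial_zero, Nat.cast_one, mul_one,
              Nat.cast_zero, zero_add]
            nlinarith [norm_nonneg (g s)]
          | succ i ihi =>
            intro hi
            have h1 := ihi (by omega)
            have h2 := hjet i s
            have h3 := hj s hs (i + 1) (by omega)
            have h4 : ((s : ℂ) - a) * iteratedDeriv (i + 1) g s
                = iteratedDeriv (i + 1) f s - (i + 1) * iteratedDeriv i g s := by rw [h2]; ring
            have h5 : ‖(i : ℂ) + 1‖ = i + 1 := by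
              rw [← Nat.cast_add_one, Complex.norm_natCast]; push_cast; ring
            have h6 : ‖(s : ℂ) - a‖ * ‖iteratedDeriv (i + 1) g s‖
                ≤ δ * (i + 1).factorial + (i + 1) * ((i + 2) * δ * i.factorial) := by
              rw [← norm_mul, h4]
              refine (norm_sub_le _ _).trans (add_le_add h3 ?_)
              rw [norm_mul, h5]
              gcongr
            have h7 : ‖iteratedDeriv (i + 1) g s‖
                ≤ ‖(s : ℂ) - a‖ * ‖iteratedDeriv (i + 1) g s‖ :=
              le_mul_of_one_le_left (norm_nonneg _) hsa1
            refine (h7.trans h6).trans (le_of_eq ?_)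
            rw [Nat.factorial_succ]; push_cast; ring
        refine (key j le_rfl).trans ?_
        have : (j : ℝ) + 1 ≤ T := by exact_mod_cast (Nat.succ_le_of_lt hjs).trans (hτ s hs)
        have h6 : (j : ℝ) + 2 ≤ T + 1 := by linarith
        exact mul_le_mul_of_nonneg_right (mul_le_mul_of_nonneg_right h6 hδ) (Nat.cast_nonneg _)
    · intro z hz
      have h1 : R - X ≤ ‖z - a‖ := by
        have := norm_sub_norm_le z (a : ℂ)
        rw [hz, Complex.norm_natCast] at this
        linarith
      have h2 : (z - a) * g z = f z - f a := by rw [hfg z]; ring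
      rw [le_div_iff₀ hRX0]
      have h3 : ‖g z‖ * (R - X) ≤ ‖(z - a) * g z‖ := by
        rw [norm_mul, mul_comm]
        gcongr
      refine h3.trans ?_
      rw [h2]
      exact (norm_sub_le _ _).trans (add_le_add (hK z hz) hfa)

theorem trace_eq_zero_of_pow_eq {F : Type*} [Field F] [Algebra ℚ F] [FiniteDimensional ℚ F]
    {q : ℕ} (hq : q.Prime) {x : F} {a : ℚ} (hx : x ^ q = algebraMap ℚ F a)
    (ha : ∀ b : ℚ, b ^ q ≠ a) : Algebra.trace ℚ F x = 0 := by
  have hirr := X_pow_sub_C_irreducible_of_prime hq ha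
  have hmin : Polynomial.X ^ q - Polynomial.C a = minpoly ℚ x := by
    apply minpoly.eq_of_irreducible_of_monic hirr
    · simp [hx]
    · exact Polynomial.monic_X_pow_sub_C a hq.ne_zero
  rw [trace_eq_finrank_mul_minpoly_nextCoeff, ← hmin]
  have hdeg : (Polynomial.X ^ q - Polynomial.C a : Polynomial ℚ).natDegree = q :=
    Polynomial.natDegree_X_pow_sub_C
  have h2 := hq.two_le
  rw [Polynomial.nextCoeff_of_natDegree_pos (by rw [hdeg]; exact hq.pos), hdeg,
    Polynomial.coeff_sub, Polynomial.coeff_X_pow, Polynomial.coeff_C]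
  rw [if_neg (by omega), if_neg (by omega)]
  simp

theorem linearIndependent_of_ratio_pow_rational {ι : Type*} [Fintype ι] (v : ι → ℝ)
    (hv : ∀ i, v i ≠ 0) {q : ℕ} (hq : q.Prime)
    (h : ∀ i j, i ≠ j → ∃ a : ℚ, (v i / v j) ^ q = a ∧ ∀ b : ℚ, b ^ q ≠ a) :
    LinearIndependent ℚ v := by
  classical
  rw [Fintype.linearIndependent_iff]
  intro c hc o
  let S : Set ℝ := Set.range fun i => v i / v o
  have hS : S.Finite := Set.finite_range _
  have hintegral : ∀ x ∈ S, IsIntegral ℚ x := by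
    rintro _ ⟨i, rfl⟩
    by_cases hio : i = o
    · subst hio
      simp only [div_self (hv i)]
      exact isIntegral_one
    · obtain ⟨a, ha, -⟩ := h i o hio
      apply IsIntegral.of_pow hq.pos
      dsimp only
      rw [ha]
      exact isIntegral_algebraMap
  have : Finite S := hS
  let F := IntermediateField.adjoin ℚ S
  have : FiniteDimensional ℚ F := IntermediateField.finiteDimensional_adjoin hintegral
  let x : ι → F := fun i => ⟨v i / v o, IntermediateField.subset_adjoin ℚ S ⟨i, rfl⟩⟩
  have hsum : ∑ i, c i • x i = 0 := by
    apply Subtype.ext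
    have : ((∑ i, c i • x i : F) : ℝ) = ∑ i, c i • (v i / v o) := by
      push_cast
      rfl
    rw [this]
    have h2 : ∑ i, c i • (v i / v o) = (∑ i, c i • v i) / v o := by
      rw [Finset.sum_div]
      refine Finset.sum_congr rfl fun i _ => ?_
      rw [Rat.smul_def, Rat.smul_def, mul_div_assoc]
    rw [h2, hc, zero_div]; rfl
  have htr := congrArg (Algebra.trace ℚ F) hsum
  rw [map_sum, map_zero, Finset.sum_eq_single o] at htr
  · have hxo : x o = algebraMap ℚ F 1 := by
      apply Subtype.ext
      simp [x, hv o]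
    rw [map_smul, hxo, Algebra.trace_algebraMap, smul_eq_mul] at htr
    have hpos : Module.finrank ℚ F ≠ 0 := Module.finrank_pos.ne'
    simpa [hpos] using htr
  · intro i _ hio
    obtain ⟨a, ha, hab⟩ := h i o hio
    rw [map_smul, trace_eq_zero_of_pow_eq hq (a := a) _ hab, smul_zero]
    apply Subtype.ext
    simpa [x] using ha
  · simp

theorem one_le_abs_sum_mul_of_linearIndependent {ι : Type*} [Fintype ι] [DecidableEq ι]
    (v : ι → ℝ) (hv : LinearIndependent ℚ v) (e : ι → ι → ι) (m : ι → ι → ℤ) (C : ℝ)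
    (he : ∀ i, Function.Injective (e i)) (hm : ∀ i j, v i * v j = m i j * v (e i j))
    (hmC : ∀ i j, |(m i j : ℝ)| ≤ C) (hvC : ∀ i, |v i| ≤ C) (o : ι) (ho : v o = 1)
    (r : ι → ℤ) (R : ℝ) (hR : 1 ≤ R) (hrR : ∀ i, |(r i : ℝ)| ≤ R) (hr : r ≠ 0) :
    1 ≤ |∑ i, r i * v i| *
      ((Fintype.card ι).factorial * (R * C) ^ Fintype.card ι) := by
  have hC0 : 0 ≤ C := (abs_nonneg _).trans (hvC o)
  set ξ := ∑ i, r i * v i with hξ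
  let A : Matrix ι ι ℤ := Matrix.of fun i k => ∑ j, if e i j = k then r j * m i j else 0
  have hAv : (A.map (Int.cast : ℤ → ℝ)).mulVec v = ξ • v := by
    funext i
    simp only [Matrix.mulVec, dotProduct, Matrix.map_apply, Matrix.of_apply, A, Pi.smul_apply, smul_eq_mul, hξ,
      Finset.sum_mul]
    push_cast
    simp only [Finset.sum_mul]
    rw [Finset.sum_comm]
    refine Finset.sum_congr rfl fun j _ => ?_
    rw [Finset.sum_eq_single (e i j)]
    · simp only [if_true]; rw [mul_assoc, ← hm]; ring
    · intro k _ hk; rw [if_neg (Ne.symm hk)]; simp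
    · simp
  have hlin : ∀ c : ι → ℤ, ∑ i, (c i : ℝ) * v i = 0 → c = 0 := by
    intro c hc
    have := Fintype.linearIndependent_iff.1 hv (fun i => (c i : ℚ)) (by
      rw [← hc]
      refine Finset.sum_congr rfl fun i _ => ?_
      rw [Rat.smul_def]; simp)
    funext i
    exact_mod_cast this i
  have hξ0 : ξ ≠ 0 := fun h => hr (hlin r h)
  have hdet : A.det ≠ 0 := by
    intro h
    obtain ⟨u, hu0, hu⟩ := Matrix.exists_vecMul_eq_zero_iff.2 h
    have h1 : Matrix.vecMul (fun i => (u i : ℝ)) (A.map (Int.cast : ℤ → ℝ)) = 0 := by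
      funext k
      have := congrFun hu k
      simp only [Matrix.vecMul, dotProduct, Pi.zero_apply, Matrix.map_apply] at this ⊢
      exact_mod_cast this
    have h2 : dotProduct (fun i => (u i : ℝ)) (ξ • v) = 0 := by
      rw [← hAv, Matrix.dotProduct_mulVec, h1, zero_dotProduct]
    rw [dotProduct_smul, smul_eq_mul, mul_eq_zero] at h2
    rcases h2 with h2 | h2
    · exact hξ0 h2
    · exact hu0 (hlin u h2)
  have hcr : ((A.det : ℤ) : ℝ) = ξ * ((A.map (Int.cast : ℤ → ℝ)).updateCol o v).det := by
    have h1 : (A.map (Int.cast : ℤ → ℝ)).adjugate.mulVec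
        ((A.map (Int.cast : ℤ → ℝ)).mulVec v) = (A.map (Int.cast : ℤ → ℝ)).det • v := by
      rw [Matrix.mulVec_mulVec, Matrix.adjugate_mul, Matrix.smul_mulVec, Matrix.one_mulVec]
    rw [hAv, Matrix.mulVec_smul, ← Matrix.cramer_eq_adjugate_mulVec] at h1
    have h2 := congrFun h1 o
    simp only [Pi.smul_apply, smul_eq_mul, ho, mul_one, Matrix.cramer_apply] at h2
    rw [h2, Int.cast_det]
  have hRC : C ≤ R * C := le_mul_of_one_le_left hC0 hR
  have hAb : ∀ i k, |((A i k : ℤ) : ℝ)| ≤ R * C := by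
    intro i k
    by_cases hk : ∃ j, e i j = k
    · obtain ⟨j, rfl⟩ := hk
      have : A i (e i j) = r j * m i j := by
        simp only [A, Matrix.of_apply]
        rw [Finset.sum_eq_single j]
        · simp
        · intro j' _ hj'
          rw [if_neg fun h => hj' (he i h)]
        · simp
      rw [this]
      push_cast
      rw [abs_mul]
      exact mul_le_mul (hrR j) (hmC i j) (abs_nonneg _) (by linarith)
    · have : A i k = 0 := by
        simp only [A, Matrix.of_apply]
        refine Finset.sum_eq_zero fun j _ => ?_
        rw [if_neg fun h => hk ⟨j, h⟩]
      rw [this]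
      simp
      positivity
  have hdb : |((A.map (Int.cast : ℤ → ℝ)).updateCol o v).det|
      ≤ (Fintype.card ι).factorial * (R * C) ^ Fintype.card ι := by
    have := Matrix.det_le (A := (A.map (Int.cast : ℤ → ℝ)).updateCol o v)
      (abv := AbsoluteValue.abs) (x := R * C) (by
        intro i j
        rw [Matrix.updateCol_apply]
        split_ifs with h
        · exact (hvC i).trans hRC
        · exact hAb i j)
    simpa [nsmul_eq_mul] using this
  have h1 : (1 : ℝ) ≤ |((A.det : ℤ) : ℝ)| := by exact_mod_cast Int.one_le_abs hdet
  rw [hcr, abs_mul] at h1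
  exact h1.trans (mul_le_mul_of_nonneg_left hdb (abs_nonneg _))

theorem padicValRat_prod_pow {p : ℕ} [Fact p.Prime] (β ε : Fin 3 → ℕ) (hβ : ∀ i, β i ≠ 0) :
    padicValRat p ((∏ i, β i ^ ε i : ℕ) : ℚ) = ∑ i, (ε i : ℤ) * padicValNat p (β i) := by
  rw [padicValRat.of_nat]
  simp only [Fin.prod_univ_three, Fin.sum_univ_three]
  have h := fun i => pow_ne_zero (ε i) (hβ i)
  rw [padicValNat.mul (mul_ne_zero (h 0) (h 1)) (h 2), padicValNat.mul (h 0) (h 1),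
    padicValNat.pow _ _, padicValNat.pow _ _, padicValNat.pow _ _]
  push_cast; ring

theorem kummer_lower_bound {q : ℕ} [Fact q.Prime] (β p : Fin 3 → ℕ) (hβ : ∀ i, β i ≠ 0)
    (hp : ∀ j, (p j).Prime)
    (hdet : (Matrix.of fun j i => (padicValNat (p j) (β i) : ZMod q)).det ≠ 0)
    (B : ℝ) (hB : ∀ i, (β i : ℝ) ≤ B)
    (r : (Fin 3 → Fin q) → ℤ) (R : ℝ) (hR : 1 ≤ R) (hrR : ∀ i, |(r i : ℝ)| ≤ R) (hr : r ≠ 0) :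
    1 ≤ |∑ ε : Fin 3 → Fin q, r ε * Real.exp (∑ i, (ε i : ℝ) * (Real.log (β i) / q))| *
      ((q ^ 3).factorial * (R * B ^ 3) ^ q ^ 3) := by
  have hqp : q.Prime := Fact.out
  have : NeZero q := ⟨hqp.ne_zero⟩
  have hq0 : (q : ℝ) ≠ 0 := by exact_mod_cast hqp.ne_zero
  have hq0' : (0 : ℝ) < q := by exact_mod_cast hqp.pos
  have hβ1 : ∀ i, (1 : ℝ) ≤ β i := fun i => by exact_mod_cast Nat.one_le_iff_ne_zero.2 (hβ i)
  have hB1 : 1 ≤ B := (hβ1 0).trans (hB 0)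
  have hexp : ∀ i, Real.exp (Real.log (β i)) = β i := fun i =>
    Real.exp_log (by linarith [hβ1 i])
  let v : (Fin 3 → Fin q) → ℝ := fun ε => Real.exp (∑ i, (ε i : ℝ) * (Real.log (β i) / q))
  have hvq : ∀ ε, v ε ^ q = ((∏ i, β i ^ (ε i : ℕ) : ℕ) : ℝ) := by
    intro ε
    simp only [v]
    rw [← Real.exp_nat_mul, Finset.mul_sum, Real.exp_sum]
    push_cast
    refine Finset.prod_congr rfl fun i _ => ?_
    rw [← hexp i, ← Real.exp_nat_mul, hexp i]
    congr 1
    field_simp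
  have hlin : LinearIndependent ℚ v := by
    apply linearIndependent_of_ratio_pow_rational v (fun i => (Real.exp_pos _).ne') hqp
    intro ε ε' hne
    refine ⟨((∏ i, β i ^ (ε i : ℕ) : ℕ) : ℚ) / ((∏ i, β i ^ (ε' i : ℕ) : ℕ) : ℚ), ?_, ?_⟩
    · rw [div_pow, hvq, hvq]; push_cast; rfl
    · intro b hb
      apply hne
      have hpr : ∀ ε : Fin 3 → Fin q, ((∏ i, β i ^ (ε i : ℕ) : ℕ) : ℚ) ≠ 0 := by
        intro ε
        rw [Nat.cast_ne_zero]
        exact Finset.prod_ne_zero_iff.2 fun i _ => pow_ne_zero _ (hβ i)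
      have hb0 : b ≠ 0 := by
        rintro rfl
        rw [zero_pow hqp.ne_zero] at hb
        exact div_ne_zero (hpr ε) (hpr ε') hb.symm
      have hkey : (Matrix.of fun j i => (padicValNat (p j) (β i) : ZMod q)).mulVec
          (fun i => ((ε i : ℕ) : ZMod q) - ((ε' i : ℕ) : ZMod q)) = 0 := by
        funext j
        have : Fact (p j).Prime := ⟨hp j⟩
        have h1 := congrArg (padicValRat (p j)) hb
        rw [padicValRat.pow, padicValRat.div (hpr ε) (hpr ε'),
          padicValRat_prod_pow _ _ hβ, padicValRat_prod_pow _ _ hβ] at h1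
        have h2 := congrArg (Int.cast : ℤ → ZMod q) h1
        push_cast at h2
        rw [CharP.cast_eq_zero, zero_mul, ← Finset.sum_sub_distrib] at h2
        simp only [Matrix.mulVec, dotProduct, Matrix.of_apply, Pi.zero_apply]
        rw [h2]
        exact Finset.sum_congr rfl fun i _ => by rw [padicValRat.of_nat, Int.cast_natCast]; ring
      have h3 := Matrix.eq_zero_of_mulVec_eq_zero hdet hkey
      funext i
      have h4 := congrFun h3 i
      simp only [Pi.zero_apply, sub_eq_zero] at h4
      have h5 := (ZMod.natCast_eq_natCast_iff' _ _ _).1 h4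
      rw [Nat.mod_eq_of_lt (ε i).2, Nat.mod_eq_of_lt (ε' i).2] at h5
      exact Fin.ext h5
  have hpow1 : ∀ i (n : ℕ), n ≤ 1 → |(β i : ℝ) ^ n| ≤ B := by
    intro i n hn
    rw [abs_of_nonneg (by positivity)]
    interval_cases n
    · simpa using hB1
    · simpa using hB i
  have hmain := one_le_abs_sum_mul_of_linearIndependent v hlin (fun δ ε => δ + ε)
    (fun δ ε => ((∏ i, β i ^ (((δ i : ℕ) + ε i) / q) : ℕ) : ℤ)) (B ^ 3)
    (fun i => add_right_injective i) ?_ ?_ ?_ 0 ?_ r R hR hrR hr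
  · simpa [v] using hmain
  · intro δ ε
    simp only [v]
    rw [← Real.exp_add, ← Finset.sum_add_distrib, Real.exp_sum, Real.exp_sum]
    push_cast
    rw [← Finset.prod_mul_distrib]
    refine Finset.prod_congr rfl fun i _ => ?_
    nth_rewrite 3 [← hexp i]
    rw [← Real.exp_nat_mul, ← Real.exp_add]
    congr 1
    have h1 : ((δ + ε) i : ℕ) = ((δ i : ℕ) + ε i) % q := by simp [Fin.val_add]
    have h2 := Nat.div_add_mod ((δ i : ℕ) + ε i) q
    rw [h1]
    have h3 : ((δ i : ℕ) : ℝ) + ((ε i : ℕ) : ℝ) = q * ((((δ i : ℕ) + ε i) / q : ℕ) : ℝ)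
        + ((((δ i : ℕ) + ε i) % q : ℕ) : ℝ) := by exact_mod_cast h2.symm
    rw [← add_mul, h3]
    field_simp
  · intro δ ε
    push_cast
    rw [Finset.abs_prod, Fin.prod_univ_three, pow_succ, pow_two]
    have h1 : ∀ i, ((δ i : ℕ) + ε i) / q ≤ 1 := by
      intro i
      have := (δ i).2
      have := (ε i).2
      rw [← Nat.lt_succ_iff, Nat.div_lt_iff_lt_mul hqp.pos]
      omega
    gcongr
    · exact hpow1 _ _ (h1 0)
    · exact hpow1 _ _ (h1 1)
    · exact hpow1 _ _ (h1 2)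
  · intro ε
    simp only [v]
    rw [Real.exp_sum, Finset.abs_prod, Fin.prod_univ_three, pow_succ, pow_two]
    have h1 : ∀ i, |Real.exp ((ε i : ℝ) * (Real.log (β i) / q))| ≤ B := by
      intro i
      rw [abs_of_pos (Real.exp_pos _)]
      refine le_trans ?_ (hB i)
      rw [← Real.le_log_iff_exp_le (by linarith [hβ1 i])]
      have h2 : ((ε i : ℕ) : ℝ) ≤ q := by exact_mod_cast (ε i).2.le
      have h3 := Real.log_nonneg (hβ1 i)
      rw [mul_div_assoc', div_le_iff₀ hq0', mul_comm]
      gcongr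
    gcongr
    · exact h1 0
    · exact h1 1
    · exact h1 2
  · simp [v]

theorem iteratedDeriv_sum_exp {ι : Type*} (I : Finset ι) (a w : ι → ℂ) (i : ℕ) (z : ℂ) :
    iteratedDeriv i (fun z => ∑ m ∈ I, a m * Complex.exp (w m * z)) z =
      ∑ m ∈ I, a m * w m ^ i * Complex.exp (w m * z) := by
  induction i generalizing z with
  | zero => simp
  | succ i ih =>
    rw [iteratedDeriv_succ, funext ih]
    have h : HasDerivAt (fun z => ∑ m ∈ I, a m * w m ^ i * Complex.exp (w m * z))
        (∑ m ∈ I, a m * w m ^ i * (Complex.exp (w m * z) * (w m * 1))) z :=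
      HasDerivAt.fun_sum fun m _ => (((hasDerivAt_id z).const_mul (w m)).cexp).const_mul _
    rw [h.deriv]
    exact Finset.sum_congr rfl fun m _ => by ring

theorem abs_sum_exp_le_of_vanishing {ι : Type*} (I : Finset ι) (a w ω : ι → ℝ) (W C η : ℝ)
    (S T : ℕ) (N : Finset ℕ) (hw : ∀ m ∈ I, |w m| ≤ W) (hω : ∀ m ∈ I, |w m - ω m| ≤ η)
    (hη : η ≤ 1) (hW : 1 ≤ W) (hC : ∑ m ∈ I, |a m| ≤ C) (hS : 2 ≤ S) (hN : ∀ s ∈ N, s ≤ S)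
    (hη0 : 0 ≤ η)
    (hvan : ∀ s ∈ N, ∀ i < T, ∑ m ∈ I, a m * ω m ^ i * Real.exp (w m * s) = 0)
    (x : ℝ) (hx0 : 0 ≤ x) (hx : x ≤ S) :
    |∑ m ∈ I, a m * Real.exp (w m * x)| ≤
      C * Real.exp (5 * S * W) * (1 / 4) ^ (N.card * T) +
        C * η * Real.exp (2 * S * W) * (S * (T + 1) + 2) ^ (N.card * T) := by
  have hS2 : (2 : ℝ) ≤ S := by exact_mod_cast hS
  have hC0 : 0 ≤ C := (Finset.sum_nonneg fun m _ => abs_nonneg _).trans hC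
  set f : ℂ → ℂ := fun z => ∑ m ∈ I, (a m : ℂ) * Complex.exp ((w m : ℂ) * z) with hf
  have hfd : Differentiable ℂ f := by
    rw [hf]; fun_prop
  have hreal : ∀ x : ℝ, f x = ((∑ m ∈ I, a m * Real.exp (w m * x) : ℝ) : ℂ) := by
    intro x; simp only [hf]; push_cast; rfl
  have hmain := norm_le_of_small_jets N T S (5 * S) (by linarith) (by linarith)
    (fun s hs => by exact_mod_cast hN s hs) x hx0 hx (N.card * T) f (fun _ => T)
    (C * Real.exp (5 * S * W)) (C * η * Real.exp (2 * S * W)) hfd (by positivity)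
    (fun _ _ => le_rfl) (by simp) ?_ ?_
  · rw [hreal, Complex.norm_real, Real.norm_eq_abs] at hmain
    have : (S : ℝ) / (5 * S - S) = 1 / 4 := by
      have : (S : ℝ) ≠ 0 := by positivity
      rw [div_eq_div_iff] <;> [ring; (intro h; apply this; linarith); norm_num]
    rwa [this] at hmain
  · intro s hs i hi
    have h1 : iteratedDeriv i f s =
        ((∑ m ∈ I, a m * (w m ^ i - ω m ^ i) * Real.exp (w m * s) : ℝ) : ℂ) := by
      have h2 : ∑ m ∈ I, a m * (w m ^ i - ω m ^ i) * Real.exp (w m * s)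
          = ∑ m ∈ I, a m * w m ^ i * Real.exp (w m * s) := by
        rw [← sub_zero (∑ m ∈ I, a m * w m ^ i * Real.exp (w m * s)), ← hvan s hs i hi,
          ← Finset.sum_sub_distrib]
        exact Finset.sum_congr rfl fun m _ => by ring
      rw [h2, hf, iteratedDeriv_sum_exp]
      push_cast; rfl
    rw [h1, Complex.norm_real, Real.norm_eq_abs]
    have hterm : ∀ m ∈ I, |a m * (w m ^ i - ω m ^ i) * Real.exp (w m * s)| ≤
        |a m| * (η * Real.exp (2 * S * W) * i.factorial) := by
      intro m hm
      rw [abs_mul, abs_mul, mul_assoc]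
      refine mul_le_mul_of_nonneg_left ?_ (abs_nonneg _)
      have he : |Real.exp (w m * s)| ≤ Real.exp (S * W) := by
        rw [abs_of_pos (Real.exp_pos _), Real.exp_le_exp]
        have hsS : (s : ℝ) ≤ S := by exact_mod_cast hN s hs
        calc w m * s ≤ W * s := by
              gcongr; exact (le_abs_self _).trans (hw m hm)
          _ ≤ W * S := by gcongr
          _ = S * W := mul_comm _ _
      have hp : |w m ^ i - ω m ^ i| ≤ η * Real.exp (2 * W) * i.factorial := by
        rcases i with _ | i
        · simp; positivity
        · have hwm := hw m hm
          have hωm := hω m hm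
          have hωW : |ω m| ≤ 2 * W := by
            have := abs_sub_abs_le_abs_sub (ω m) (w m)
            rw [abs_sub_comm] at this
            linarith
          have h3 := abs_pow_sub_pow_le (w m) (ω m) (i + 1)
          have h4 : max |w m| |ω m| ≤ 2 * W := max_le (by linarith) hωW
          refine h3.trans ?_
          rw [Nat.add_sub_cancel]
          have h5 : (2 * W) ^ i ≤ Real.exp (2 * W) * i.factorial := by
            have := Real.pow_div_factorial_le_exp (2 * W) (by linarith) i
            rwa [div_le_iff₀ (by positivity)] at this
          have h6 : max |w m| |ω m| ^ i ≤ Real.exp (2 * W) * i.factorial :=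
            (pow_le_pow_left₀ (le_max_of_le_left (abs_nonneg _)) h4 i).trans h5
          rw [Nat.factorial_succ]
          push_cast
          calc |w m - ω m| * ((i : ℝ) + 1) * max |w m| |ω m| ^ i
              ≤ η * ((i : ℝ) + 1) * (Real.exp (2 * W) * i.factorial) := by gcongr
            _ = _ := by ring
      have hee : Real.exp (2 * W) * Real.exp (S * W) ≤ Real.exp (2 * S * W) := by
        rw [← Real.exp_add, Real.exp_le_exp]; nlinarith
      calc |w m ^ i - ω m ^ i| * |Real.exp (w m * s)|
          ≤ (η * Real.exp (2 * W) * i.factorial) * Real.exp (S * W) := by gcongr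
        _ = η * i.factorial * (Real.exp (2 * W) * Real.exp (S * W)) := by ring
        _ ≤ η * i.factorial * Real.exp (2 * S * W) := by gcongr
        _ = _ := by ring
    calc _ ≤ ∑ m ∈ I, |a m * (w m ^ i - ω m ^ i) * Real.exp (w m * s)| :=
          Finset.abs_sum_le_sum_abs _ _
      _ ≤ ∑ m ∈ I, |a m| * (η * Real.exp (2 * S * W) * i.factorial) := Finset.sum_le_sum hterm
      _ = (∑ m ∈ I, |a m|) * (η * Real.exp (2 * S * W) * i.factorial) := by
          rw [Finset.sum_mul]
      _ ≤ C * (η * Real.exp (2 * S * W) * i.factorial) := by gcongr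
      _ = _ := by ring
  · intro z hz
    calc ‖f z‖ ≤ ∑ m ∈ I, ‖(a m : ℂ) * Complex.exp ((w m : ℂ) * z)‖ := norm_sum_le _ _
      _ ≤ ∑ m ∈ I, |a m| * Real.exp (5 * S * W) := by
          refine Finset.sum_le_sum fun m hm => ?_
          rw [norm_mul, Complex.norm_real, Real.norm_eq_abs, Complex.norm_exp]
          refine mul_le_mul_of_nonneg_left (Real.exp_le_exp.2 ?_) (abs_nonneg _)
          refine (Complex.re_le_norm _).trans ?_
          rw [norm_mul, hz, Complex.norm_real, Real.norm_eq_abs, mul_comm]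
          have := hw m hm
          gcongr
      _ = (∑ m ∈ I, |a m|) * Real.exp (5 * S * W) := by rw [Finset.sum_mul]
      _ ≤ _ := by gcongr

/-- The data of a linear form in the logarithms of two natural numbers and of one positive
rational number `A / B`, with integer coefficients. -/
structure LogForm where
  (k₁ k₂ A B : ℕ)
  (b₁ b₂ b₃ : ℤ)

namespace LogForm

/-- The value of the linear form. -/
noncomputable def val (F : LogForm) : ℝ :=
  F.b₁ * Real.log F.k₁ + F.b₂ * Real.log F.k₂ + F.b₃ * (Real.log F.A - Real.log F.B)

/-- The logarithm of the monomial with exponent vector `m`. -/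
noncomputable def freq (F : LogForm) (m : ℕ × ℕ × ℕ) : ℝ :=
  m.1 * Real.log F.k₁ + m.2.1 * Real.log F.k₂ + m.2.2 * (Real.log F.A - Real.log F.B)

/-- The coefficient of `log k₁` in `b₃ • freq m` modulo `val`. -/
def c₁ (F : LogForm) (m : ℕ × ℕ × ℕ) : ℤ := F.b₃ * m.1 - F.b₁ * m.2.2

/-- The coefficient of `log k₂` in `b₃ • freq m` modulo `val`. -/
def c₂ (F : LogForm) (m : ℕ × ℕ × ℕ) : ℤ := F.b₃ * m.2.1 - F.b₂ * m.2.2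

/-- Size constraints on the data of a linear form. -/
structure Bounded (F : LogForm) (g h : ℕ) : Prop where
  g_pos : 0 < g
  h_pos : 0 < h
  k₁_pos : 0 < F.k₁
  k₂_pos : 0 < F.k₂
  A_pos : 0 < F.A
  B_pos : 0 < F.B
  k₁_le : F.k₁ ≤ 2 ^ g
  k₂_le : F.k₂ ≤ 2 ^ g
  A_le : F.A ≤ 2 ^ h
  B_le : F.B ≤ 2 ^ h
  b₃_ne : F.b₃ ≠ 0

/-- Exponent vectors in a box. -/
def box (L L' : ℕ) : Finset (ℕ × ℕ × ℕ) :=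
  Finset.range L ×ˢ Finset.range L ×ˢ Finset.range L'

theorem mem_box {L L' : ℕ} {m : ℕ × ℕ × ℕ} :
    m ∈ box L L' ↔ m.1 < L ∧ m.2.1 < L ∧ m.2.2 < L' := by
  simp [box]

theorem card_box (L L' : ℕ) : (box L L').card = L * (L * L') := by
  simp [box]

/-- The exponential sum attached to `p` with monomial weights, at the point `x`. -/
noncomputable def expSum (F : LogForm) (p : ℕ × ℕ × ℕ → ℤ) (L L' t₁ t₂ : ℕ) (x : ℝ) : ℝ :=
  ∑ m ∈ box L L', (p m : ℝ) * (F.c₁ m : ℝ) ^ t₁ * (F.c₂ m : ℝ) ^ t₂ * Real.exp (F.freq m * x)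

/-- The weighted exponential sums vanish at all integers below `S` prime to `q`. -/
def Vanishes (F : LogForm) (q : ℕ) (p : ℕ × ℕ × ℕ → ℤ) (L L' S T : ℕ) : Prop :=
  ∀ s < S, ¬ q ∣ s → ∀ t₁ < T, ∀ t₂ < T, F.expSum p L L' t₁ t₂ s = 0

theorem log_le_of_le_two_pow {k g : ℕ} (hk : 0 < k) (h : k ≤ 2 ^ g) : Real.log k ≤ g := by
  have h1 : (k : ℝ) ≤ 2 ^ g := by exact_mod_cast h
  have h2 := Real.log_le_log (by exact_mod_cast hk) h1
  rw [Real.log_pow] at h2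
  have h3 : Real.log 2 ≤ 1 := by linarith [Real.log_two_lt_d9]
  nlinarith [(Nat.cast_nonneg g : (0 : ℝ) ≤ g)]

variable {F : LogForm} {g h : ℕ}

theorem Bounded.abs_freq_le (hF : F.Bounded g h) {L L' : ℕ} (hL : h * L' = L)
    {m : ℕ × ℕ × ℕ} (hm : m ∈ box L L') : |F.freq m| ≤ 3 * g * L := by
  rw [mem_box] at hm
  obtain ⟨h1, h2, h3⟩ := hm
  have e1 := log_le_of_le_two_pow hF.k₁_pos hF.k₁_le
  have e2 := log_le_of_le_two_pow hF.k₂_pos hF.k₂_le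
  have e3 := log_le_of_le_two_pow hF.A_pos hF.A_le
  have e4 := log_le_of_le_two_pow hF.B_pos hF.B_le
  have f1 := Real.log_natCast_nonneg F.k₁
  have f2 := Real.log_natCast_nonneg F.k₂
  have f3 := Real.log_natCast_nonneg F.A
  have f4 := Real.log_natCast_nonneg F.B
  have hg : (1 : ℝ) ≤ g := by exact_mod_cast hF.g_pos
  have i1 : (m.1 : ℝ) ≤ L := by exact_mod_cast h1.le
  have i2 : (m.2.1 : ℝ) ≤ L := by exact_mod_cast h2.le
  have i3 : (m.2.2 : ℝ) ≤ L' := by exact_mod_cast h3.le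
  have hL' : (h : ℝ) * L' = L := by exact_mod_cast hL
  have hL0 : (0 : ℝ) ≤ L := Nat.cast_nonneg _
  unfold freq
  refine (abs_add_three _ _ _).trans ?_
  rw [abs_mul, abs_mul, abs_mul, Nat.abs_cast, Nat.abs_cast, Nat.abs_cast,
    abs_of_nonneg f1, abs_of_nonneg f2]
  have a1 : (m.1 : ℝ) * Real.log F.k₁ ≤ L * g := by gcongr
  have a2 : (m.2.1 : ℝ) * Real.log F.k₂ ≤ L * g := by gcongr
  have a3 : (m.2.2 : ℝ) * |Real.log F.A - Real.log F.B| ≤ L' * h := by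
    gcongr
    rw [abs_le]; constructor <;> linarith
  nlinarith

theorem freq_sub_eq (hb : F.b₃ ≠ 0) (m : ℕ × ℕ × ℕ) :
    F.freq m - (F.c₁ m * Real.log F.k₁ + F.c₂ m * Real.log F.k₂) / F.b₃
      = m.2.2 * F.val / F.b₃ := by
  have : (F.b₃ : ℝ) ≠ 0 := by exact_mod_cast hb
  unfold freq c₁ c₂ val
  push_cast
  field_simp
  ring

theorem abs_freq_sub_le (hb : F.b₃ ≠ 0) {L L' : ℕ} {m : ℕ × ℕ × ℕ} (hm : m ∈ box L L') :
    |F.freq m - (F.c₁ m * Real.log F.k₁ + F.c₂ m * Real.log F.k₂) / F.b₃| ≤ L' * |F.val| := by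
  rw [freq_sub_eq hb, abs_div, abs_mul, Nat.abs_cast]
  have h1 : (1 : ℝ) ≤ |(F.b₃ : ℝ)| := by exact_mod_cast Int.one_le_abs hb
  have h2 : (m.2.2 : ℝ) ≤ L' := by exact_mod_cast (mem_box.1 hm).2.2.le
  refine (div_le_self (by positivity) h1).trans ?_
  gcongr

theorem exp_five_mul_le (x : ℕ) : Real.exp (5 * x) ≤ 2 ^ (8 * x) := by
  have h1 : Real.exp 5 ≤ 2 ^ 8 := by
    have : Real.exp 5 = Real.exp 1 ^ 5 := by rw [← Real.exp_nat_mul]; norm_num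
    rw [this]
    calc Real.exp 1 ^ 5 ≤ 2.8 ^ 5 := by
          gcongr; linarith [Real.exp_one_lt_d9]
      _ ≤ _ := by norm_num
  rw [mul_comm, Real.exp_nat_mul, pow_mul]
  gcongr

theorem Vanishes.abs_expSum_le (hF : F.Bounded g h) {q : ℕ} {p : ℕ × ℕ × ℕ → ℤ}
    {L L' S T T' ν π b V : ℕ} (hv : F.Vanishes q p L L' S T) (hT : 2 * T' ≤ T)
    (hL : h * L' = L) (hL' : 0 < L') (hS : 2 ≤ S) (hν : (box L L').card ≤ 2 ^ ν)
    (hp : ∀ m ∈ box L L', |p m| ≤ 2 ^ π)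
    (hc₁ : ∀ m ∈ box L L', |F.c₁ m| ≤ 2 ^ b) (hc₂ : ∀ m ∈ box L L', |F.c₂ m| ≤ 2 ^ b)
    (hV : ν + π + 2 * b * T' + 24 * g * (S * L) ≤ V) (hval : L' * |F.val| ≤ 1)
    {t₁ t₂ : ℕ} (ht₁ : t₁ < T') (ht₂ : t₂ < T') {x : ℝ} (hx0 : 0 ≤ x) (hx : x ≤ S) :
    |F.expSum p L L' t₁ t₂ x| ≤
      2 ^ V * (1 / 4) ^ (((Finset.range S).filter (¬ q ∣ ·)).card * T') +
      2 ^ V * (L' * |F.val|) *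
        (S * (T' + 1) + 2) ^ (((Finset.range S).filter (¬ q ∣ ·)).card * T') := by
  have hL1 : 0 < L := by rw [← hL]; exact Nat.mul_pos hF.h_pos hL'
  have hcoef : ∀ m ∈ box L L', |(p m : ℝ) * (F.c₁ m : ℝ) ^ t₁ * (F.c₂ m : ℝ) ^ t₂| ≤
      2 ^ (π + 2 * b * T') := by
    intro m hm
    have e0 : |(p m : ℝ)| ≤ 2 ^ π := by exact_mod_cast hp m hm
    have e1 : |(F.c₁ m : ℝ)| ≤ 2 ^ b := by exact_mod_cast hc₁ m hm
    have e2 : |(F.c₂ m : ℝ)| ≤ 2 ^ b := by exact_mod_cast hc₂ m hm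
    have f1 : |(F.c₁ m : ℝ)| ^ t₁ ≤ 2 ^ (b * T') :=
      calc |(F.c₁ m : ℝ)| ^ t₁ ≤ (2 ^ b) ^ t₁ := by gcongr
        _ = 2 ^ (b * t₁) := by rw [pow_mul]
        _ ≤ _ := pow_le_pow_right₀ (by norm_num) (Nat.mul_le_mul_left _ ht₁.le)
    have f2 : |(F.c₂ m : ℝ)| ^ t₂ ≤ 2 ^ (b * T') :=
      calc |(F.c₂ m : ℝ)| ^ t₂ ≤ (2 ^ b) ^ t₂ := by gcongr
        _ = 2 ^ (b * t₂) := by rw [pow_mul]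
        _ ≤ _ := pow_le_pow_right₀ (by norm_num) (Nat.mul_le_mul_left _ ht₂.le)
    rw [abs_mul, abs_mul, abs_pow, abs_pow]
    calc |(p m : ℝ)| * |(F.c₁ m : ℝ)| ^ t₁ * |(F.c₂ m : ℝ)| ^ t₂
        ≤ 2 ^ π * 2 ^ (b * T') * 2 ^ (b * T') := by gcongr
      _ = _ := by rw [← pow_add, ← pow_add]; congr 1; ring
  have hsum : ∑ m ∈ box L L', |(p m : ℝ) * (F.c₁ m : ℝ) ^ t₁ * (F.c₂ m : ℝ) ^ t₂| ≤
      2 ^ (ν + π + 2 * b * T') := by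
    refine (Finset.sum_le_card_nsmul _ _ _ hcoef).trans ?_
    rw [nsmul_eq_mul, add_assoc, pow_add _ ν]
    have : ((box L L').card : ℝ) ≤ 2 ^ ν := by exact_mod_cast hν
    gcongr
  have hg1 : (1 : ℝ) ≤ g := by exact_mod_cast hF.g_pos
  have hL1' : (1 : ℝ) ≤ L := by exact_mod_cast hL1
  have hmain := abs_sum_exp_le_of_vanishing (box L L')
    (fun m => (p m : ℝ) * (F.c₁ m : ℝ) ^ t₁ * (F.c₂ m : ℝ) ^ t₂) F.freq
    (fun m => (F.c₁ m * Real.log F.k₁ + F.c₂ m * Real.log F.k₂) / F.b₃)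
    (3 * g * L) (2 ^ (ν + π + 2 * b * T')) (L' * |F.val|) S T'
    ((Finset.range S).filter (¬ q ∣ ·)) (fun m hm => hF.abs_freq_le hL hm)
    (fun m hm => abs_freq_sub_le hF.b₃_ne hm) hval (by nlinarith) hsum hS
    (fun s hs => (Finset.mem_range.1 (Finset.mem_filter.1 hs).1).le) (by positivity) ?_ x hx0 hx
  · refine hmain.trans ?_
    have h5 : Real.exp (5 * S * (3 * g * L)) ≤ 2 ^ (24 * g * (S * L)) := by
      have := exp_five_mul_le (3 * g * (S * L))
      push_cast at this
      calc Real.exp (5 * S * (3 * g * L)) = Real.exp (5 * (3 * g * (S * L))) := by ring_nf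
        _ ≤ 2 ^ (8 * (3 * g * (S * L))) := this
        _ = _ := by ring_nf
    have h2 : Real.exp (2 * S * (3 * g * L)) ≤ Real.exp (5 * S * (3 * g * L)) := by
      rw [Real.exp_le_exp]
      have : (0 : ℝ) ≤ S * (3 * g * L) := by positivity
      nlinarith
    have hVV : (2 : ℝ) ^ (ν + π + 2 * b * T') * 2 ^ (24 * g * (S * L)) ≤ 2 ^ V := by
      rw [← pow_add]
      exact pow_le_pow_right₀ (by norm_num) hV
    have hk : (2 : ℝ) ^ (ν + π + 2 * b * T') * Real.exp (5 * S * (3 * g * L)) ≤ 2 ^ V :=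
      (mul_le_mul_of_nonneg_left h5 (by positivity)).trans hVV
    have hδ : (2 : ℝ) ^ (ν + π + 2 * b * T') * (L' * |F.val|) * Real.exp (2 * S * (3 * g * L))
        ≤ 2 ^ V * (L' * |F.val|) := by
      calc _ = (2 : ℝ) ^ (ν + π + 2 * b * T') * Real.exp (2 * S * (3 * g * L))
            * (L' * |F.val|) := by ring
        _ ≤ 2 ^ (ν + π + 2 * b * T') * Real.exp (5 * S * (3 * g * L)) * (L' * |F.val|) := by
            gcongr
        _ ≤ _ := by gcongr
    exact add_le_add (mul_le_mul_of_nonneg_right hk (by positivity))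
      (mul_le_mul_of_nonneg_right hδ (by positivity))
  · intro s hs i hi
    have hs' := Finset.mem_filter.1 hs
    have hz : ∀ k < i + 1, F.expSum p L L' (t₁ + k) (t₂ + (i - k)) s = 0 := fun k hk =>
      hv s (Finset.mem_range.1 hs'.1) hs'.2 _ (by omega) _ (by omega)
    have hexpand : ∑ m ∈ box L L', (p m : ℝ) * (F.c₁ m : ℝ) ^ t₁ * (F.c₂ m : ℝ) ^ t₂ *
        ((F.c₁ m * Real.log F.k₁ + F.c₂ m * Real.log F.k₂) / F.b₃) ^ i *
          Real.exp (F.freq m * s) =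
        ∑ k ∈ Finset.range (i + 1), ((Real.log F.k₁ ^ k * Real.log F.k₂ ^ (i - k) *
          (i.choose k)) / (F.b₃ : ℝ) ^ i) * F.expSum p L L' (t₁ + k) (t₂ + (i - k)) s := by
      simp only [expSum, Finset.mul_sum]
      rw [Finset.sum_comm]
      refine Finset.sum_congr rfl fun m _ => ?_
      rw [div_pow, add_pow, Finset.sum_div, Finset.mul_sum, Finset.sum_mul]
      refine Finset.sum_congr rfl fun k _ => ?_
      rw [mul_pow, mul_pow, pow_add, pow_add]
      ring
    rw [hexpand]
    exact Finset.sum_eq_zero fun k hk => by rw [hz k (Finset.mem_range.1 hk), mul_zero]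

end LogForm

namespace LogForm

/-- The exponent vector with residue `e` and quotient `n` modulo `q`. -/
def shift (q : ℕ) (e : Fin 3 → Fin q) (n : ℕ × ℕ × ℕ) : ℕ × ℕ × ℕ :=
  (e 0 + q * n.1, e 1 + q * n.2.1, e 2 + q * n.2.2)

theorem shift_mem_box {q K K' : ℕ} (e : Fin 3 → Fin q) {n : ℕ × ℕ × ℕ} (hn : n ∈ box K K') :
    shift q e n ∈ box (q * K) (q * K') := by
  rw [mem_box] at hn ⊢
  have aux : ∀ (a : Fin q) (x y : ℕ), x < y → (a : ℕ) + q * x < q * y := fun a x y hxy =>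
    calc (a : ℕ) + q * x < q + q * x := Nat.add_lt_add_right a.2 _
      _ = q * (x + 1) := by ring
      _ ≤ q * y := Nat.mul_le_mul_left _ hxy
  exact ⟨aux _ _ _ hn.1, aux _ _ _ hn.2.1, aux _ _ _ hn.2.2⟩

/-- The residue of an exponent vector modulo `q`. -/
def residue (q : ℕ) (hq : 0 < q) (m : ℕ × ℕ × ℕ) : Fin 3 → Fin q :=
  ![⟨m.1 % q, Nat.mod_lt _ hq⟩, ⟨m.2.1 % q, Nat.mod_lt _ hq⟩, ⟨m.2.2 % q, Nat.mod_lt _ hq⟩]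

theorem shift_residue {q : ℕ} (hq : 0 < q) (m : ℕ × ℕ × ℕ) :
    shift q (residue q hq m) (m.1 / q, m.2.1 / q, m.2.2 / q) = m := by
  simp [shift, residue, Nat.mod_add_div]

theorem div_mem_box {q K K' : ℕ} (hq : 0 < q) {m : ℕ × ℕ × ℕ} (hm : m ∈ box (q * K) (q * K')) :
    (m.1 / q, m.2.1 / q, m.2.2 / q) ∈ box K K' := by
  rw [mem_box] at hm ⊢
  simp only [Nat.div_lt_iff_lt_mul hq, mul_comm _ q]
  exact hm

theorem sum_box_mul {q : ℕ} (hq : 0 < q) (K K' : ℕ) (φ : ℕ × ℕ × ℕ → ℝ) :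
    ∑ m ∈ box (q * K) (q * K'), φ m =
      ∑ e : Fin 3 → Fin q, ∑ n ∈ box K K', φ (shift q e n) := by
  rw [← Finset.sum_product']
  symm
  refine Finset.sum_nbij' (fun x => shift q x.1 x.2)
    (fun m => (residue q hq m, (m.1 / q, m.2.1 / q, m.2.2 / q))) ?_ ?_ ?_ ?_ ?_
  · intro x hx
    exact shift_mem_box _ (Finset.mem_product.1 hx).2
  · intro m hm
    exact Finset.mem_product.2 ⟨Finset.mem_univ _, div_mem_box hq hm⟩
  · rintro ⟨e, n⟩ _
    have aux : ∀ (a : Fin q) (x : ℕ), ((a : ℕ) + q * x) / q = x := fun a x => by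
      rw [Nat.add_mul_div_left _ _ hq, Nat.div_eq_of_lt a.2, zero_add]
    refine Prod.ext ?_ ?_
    · funext i
      apply Fin.ext
      fin_cases i <;> simp [shift, residue, Nat.mod_eq_of_lt]
    · simp [shift, aux]
  · intro m _
    exact shift_residue hq m
  · intro x _; rfl

/-- The coefficients of `B ^ (s L') • expSum (s / q)` on the products of `q`-th roots. -/
def kummerCoeff (F : LogForm) (q : ℕ) (p : ℕ × ℕ × ℕ → ℤ) (K K' t₁ t₂ s : ℕ)
    (e : Fin 3 → Fin q) : ℤ :=
  ∑ n ∈ box K K', p (shift q e n) * F.c₁ (shift q e n) ^ t₁ * F.c₂ (shift q e n) ^ t₂ *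
    (F.k₁ ^ (s * n.1) * F.k₂ ^ (s * n.2.1) * F.A ^ (s * n.2.2) *
      F.B ^ (s * (q * K' - e 2 - n.2.2)) : ℕ)

/-- The integers whose `q`-th roots appear in the descent. -/
def kummerBase (F : LogForm) (q s : ℕ) : Fin 3 → ℕ :=
  ![F.k₁ ^ s, F.k₂ ^ s, (F.A * F.B ^ (q - 1)) ^ s]

variable {F : LogForm} {g h : ℕ}

theorem Bounded.exp_shift_eq (hF : F.Bounded g h) {q K K' : ℕ} (hq : 0 < q) (s : ℕ)
    (e : Fin 3 → Fin q) {n : ℕ × ℕ × ℕ} (hn : n ∈ box K K') :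
    (F.B : ℝ) ^ (s * (q * K')) * Real.exp (F.freq (shift q e n) * (s / q)) =
      ((F.k₁ ^ (s * n.1) * F.k₂ ^ (s * n.2.1) * F.A ^ (s * n.2.2) *
        F.B ^ (s * (q * K' - e 2 - n.2.2)) : ℕ) : ℝ) *
        Real.exp (∑ i, (e i : ℝ) * (Real.log (F.kummerBase q s i) / q)) := by
  have hpow : ∀ {k : ℕ}, 0 < k → ∀ j : ℕ, (k : ℝ) ^ j = Real.exp (j * Real.log k) := by
    intro k hk j
    rw [Real.exp_nat_mul, Real.exp_log (by exact_mod_cast hk)]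
  have hA : (F.A : ℝ) ≠ 0 := by exact_mod_cast hF.A_pos.ne'
  have hB : (F.B : ℝ) ≠ 0 := by exact_mod_cast hF.B_pos.ne'
  have hq0 : (q : ℝ) ≠ 0 := by exact_mod_cast hq.ne'
  have hle : (e 2 : ℕ) + n.2.2 ≤ q * K' := by
    have := (mem_box.1 (shift_mem_box e hn)).2.2
    simp only [shift] at this
    nlinarith [Nat.le_mul_of_pos_left n.2.2 hq]
  have hc1 : ((s * (q * K' - e 2 - n.2.2) : ℕ) : ℝ) = s * (q * K' - (e 2 : ℕ) - n.2.2) := by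
    rw [Nat.sub_sub]
    push_cast [Nat.cast_sub hle]
    ring
  have hc2 : ((q - 1 : ℕ) : ℝ) = q - 1 := by push_cast [Nat.cast_sub hq]; ring
  push_cast
  rw [hpow hF.B_pos, hpow hF.B_pos, hpow hF.A_pos, hpow hF.k₁_pos, hpow hF.k₂_pos,
    ← Real.exp_add, ← Real.exp_add, ← Real.exp_add, ← Real.exp_add, ← Real.exp_add, hc1]
  congr 1
  simp only [Fin.sum_univ_three, kummerBase, Matrix.cons_val_zero, Matrix.cons_val_one,
    Matrix.cons_val, freq, shift]
  push_cast
  rw [Real.log_pow, Real.log_pow, Real.log_pow, Real.log_mul hA (pow_ne_zero _ hB),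
    Real.log_pow, hc2]
  field_simp
  ring

theorem Bounded.expSum_div_eq (hF : F.Bounded g h) {q : ℕ} (hq : 0 < q)
    (p : ℕ × ℕ × ℕ → ℤ) (K K' t₁ t₂ s : ℕ) :
    (F.B : ℝ) ^ (s * (q * K')) * F.expSum p (q * K) (q * K') t₁ t₂ (s / q) =
      ∑ e : Fin 3 → Fin q, (F.kummerCoeff q p K K' t₁ t₂ s e : ℝ) *
        Real.exp (∑ i, (e i : ℝ) * (Real.log (F.kummerBase q s i) / q)) := by
  rw [expSum, Finset.mul_sum, sum_box_mul hq]
  refine Finset.sum_congr rfl fun e _ => ?_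
  rw [kummerCoeff, Int.cast_sum, Finset.sum_mul]
  refine Finset.sum_congr rfl fun n hn => ?_
  have := hF.exp_shift_eq hq s e hn
  rw [Int.cast_mul, Int.cast_natCast, mul_assoc _ _ (Real.exp (∑ i, _)), ← this]
  push_cast
  ring

theorem Bounded.abs_kummerCoeff_le (hF : F.Bounded g h) {q : ℕ} (hq : 2 ≤ q)
    {p : ℕ × ℕ × ℕ → ℤ} {K K' S T' ν π b : ℕ} (hK : h * K' = K)
    (hν : (box (q * K) (q * K')).card ≤ 2 ^ ν)
    (hp : ∀ m ∈ box (q * K) (q * K'), |p m| ≤ 2 ^ π)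
    (hc₁ : ∀ m ∈ box (q * K) (q * K'), |F.c₁ m| ≤ 2 ^ b)
    (hc₂ : ∀ m ∈ box (q * K) (q * K'), |F.c₂ m| ≤ 2 ^ b)
    {t₁ t₂ s : ℕ} (ht₁ : t₁ < T') (ht₂ : t₂ < T') (hs : s < q * S) (e : Fin 3 → Fin q) :
    |F.kummerCoeff q p K K' t₁ t₂ s e| ≤
      2 ^ (ν + π + 2 * b * T' + 2 * g * q * (S * (q * K))) := by
  have hterm : ∀ n ∈ box K K', |p (shift q e n) * F.c₁ (shift q e n) ^ t₁ *
      F.c₂ (shift q e n) ^ t₂ * (F.k₁ ^ (s * n.1) * F.k₂ ^ (s * n.2.1) * F.A ^ (s * n.2.2) *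
      F.B ^ (s * (q * K' - e 2 - n.2.2)) : ℕ)| ≤
      2 ^ (π + 2 * b * T' + 2 * g * q * (S * (q * K))) := by
    intro n hn
    have hm := shift_mem_box e hn
    have hn' := mem_box.1 hn
    have hle : (e 2 : ℕ) + n.2.2 ≤ q * K' := by
      have := (mem_box.1 hm).2.2
      simp only [shift] at this
      nlinarith [Nat.le_mul_of_pos_left n.2.2 (show 0 < q by omega)]
    have f1 : |F.c₁ (shift q e n)| ^ t₁ ≤ 2 ^ (b * T') :=
      calc _ ≤ (2 ^ b) ^ t₁ := pow_le_pow_left₀ (abs_nonneg _) (hc₁ _ hm) _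
        _ = 2 ^ (b * t₁) := by rw [pow_mul]
        _ ≤ _ := pow_le_pow_right₀ (by norm_num) (Nat.mul_le_mul_left _ ht₁.le)
    have f2 : |F.c₂ (shift q e n)| ^ t₂ ≤ 2 ^ (b * T') :=
      calc _ ≤ (2 ^ b) ^ t₂ := pow_le_pow_left₀ (abs_nonneg _) (hc₂ _ hm) _
        _ = 2 ^ (b * t₂) := by rw [pow_mul]
        _ ≤ _ := pow_le_pow_right₀ (by norm_num) (Nat.mul_le_mul_left _ ht₂.le)
    have f3 : F.k₁ ^ (s * n.1) * F.k₂ ^ (s * n.2.1) * F.A ^ (s * n.2.2) *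
        F.B ^ (s * (q * K' - e 2 - n.2.2)) ≤ 2 ^ (2 * g * q * (S * (q * K))) := by
      have aux : ∀ {k a : ℕ} (_ : k ≤ 2 ^ a) (x : ℕ), k ^ x ≤ 2 ^ (a * x) := by
        intro k a hk x
        calc k ^ x ≤ (2 ^ a) ^ x := Nat.pow_le_pow_left hk x
          _ = _ := by rw [pow_mul]
      calc _ ≤ 2 ^ (g * (s * n.1)) * 2 ^ (g * (s * n.2.1)) * 2 ^ (h * (s * n.2.2)) *
            2 ^ (h * (s * (q * K' - e 2 - n.2.2))) := by
            exact Nat.mul_le_mul (Nat.mul_le_mul (Nat.mul_le_mul (aux hF.k₁_le _)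
              (aux hF.k₂_le _)) (aux hF.A_le _)) (aux hF.B_le _)
        _ = 2 ^ (g * (s * n.1) + g * (s * n.2.1) + h * (s * n.2.2) +
            h * (s * (q * K' - e 2 - n.2.2))) := by rw [pow_add, pow_add, pow_add]
        _ ≤ _ := by
            apply Nat.pow_le_pow_right (by norm_num)
            have h1 : s * n.1 ≤ S * (q * K) := by
              calc s * n.1 ≤ (q * S) * K := Nat.mul_le_mul hs.le hn'.1.le
                _ = _ := by ring
            have h2 : s * n.2.1 ≤ S * (q * K) := by
              calc s * n.2.1 ≤ (q * S) * K := Nat.mul_le_mul hs.le hn'.2.1.le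
                _ = _ := by ring
            have h3 : h * (s * n.2.2) + h * (s * (q * K' - e 2 - n.2.2)) ≤ q * (S * (q * K)) := by
              calc h * (s * n.2.2) + h * (s * (q * K' - e 2 - n.2.2))
                  = h * s * (n.2.2 + (q * K' - e 2 - n.2.2)) := by ring
                _ ≤ h * (q * S) * (q * K') := by
                    apply Nat.mul_le_mul (Nat.mul_le_mul_left _ hs.le)
                    omega
                _ = q * (S * (q * (h * K'))) := by ring
                _ = _ := by rw [hK]
            have h4 : g * (s * n.1) ≤ g * (S * (q * K)) := Nat.mul_le_mul_left _ h1
            have h5 : g * (s * n.2.1) ≤ g * (S * (q * K)) := Nat.mul_le_mul_left _ h2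
            have h6 : 2 * g + q ≤ 2 * g * q := by
              have := hF.g_pos
              nlinarith [Nat.mul_le_mul (show 1 ≤ g from this) (show 2 ≤ q from hq)]
            have h7 := Nat.mul_le_mul_right (S * (q * K)) h6
            nlinarith
    have f3' : |(((F.k₁ ^ (s * n.1) * F.k₂ ^ (s * n.2.1) * F.A ^ (s * n.2.2) *
        F.B ^ (s * (q * K' - e 2 - n.2.2)) : ℕ) : ℤ))| ≤ 2 ^ (2 * g * q * (S * (q * K))) := by
      rw [Nat.abs_cast]; exact_mod_cast f3
    rw [abs_mul, abs_mul, abs_mul, abs_pow, abs_pow]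
    calc _ ≤ (2 : ℤ) ^ π * 2 ^ (b * T') * 2 ^ (b * T') * 2 ^ (2 * g * q * (S * (q * K))) := by
          gcongr
          exact hp _ hm
      _ = _ := by rw [← pow_add, ← pow_add, ← pow_add]; congr 1; ring
  rw [kummerCoeff]
  refine (Finset.abs_sum_le_sum_abs _ _).trans ((Finset.sum_le_card_nsmul _ _ _ hterm).trans ?_)
  have hcard : (box K K').card ≤ 2 ^ ν := by
    refine le_trans ?_ hν
    rw [card_box, card_box]
    have h1 : K ≤ q * K := Nat.le_mul_of_pos_left _ (by omega)
    have h2 : K' ≤ q * K' := Nat.le_mul_of_pos_left _ (by omega)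
    gcongr
  rw [nsmul_eq_mul, show ν + π + 2 * b * T' + 2 * g * q * (S * (q * K)) =
    ν + (π + 2 * b * T' + 2 * g * q * (S * (q * K))) by ring, pow_add _ ν]
  have : ((box K K').card : ℤ) ≤ 2 ^ ν := by exact_mod_cast hcard
  gcongr

end LogForm

namespace LogForm

/-- The matrix of valuations of `k₁`, `k₂` and `A / B` at three primes. -/
def valMatrix (F : LogForm) (P : Fin 3 → ℕ) : Matrix (Fin 3) (Fin 3) ℤ :=
  Matrix.of fun j => ![(padicValNat (P j) F.k₁ : ℤ), padicValNat (P j) F.k₂,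
    (padicValNat (P j) F.A : ℤ) - padicValNat (P j) F.B]

variable {F : LogForm} {g h : ℕ}

theorem Bounded.det_kummerBase_ne_zero (hF : F.Bounded g h) {q : ℕ} [Fact q.Prime] {P : Fin 3 → ℕ}
    (hP : ∀ j, (P j).Prime) (hdet : ((F.valMatrix P).det : ZMod q) ≠ 0) {s : ℕ} (hs : ¬ q ∣ s) :
    (Matrix.of fun j i => (padicValNat (P j) (F.kummerBase q s i) : ZMod q)).det ≠ 0 := by
  have hs0 : (s : ZMod q) ≠ 0 := by rwa [Ne, ZMod.natCast_eq_zero_iff]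
  have hq1 : ((q - 1 : ℕ) : ZMod q) = -1 := by
    rw [Nat.cast_sub (Fact.out : q.Prime).one_le]; simp
  have heq : (Matrix.of fun j i => (padicValNat (P j) (F.kummerBase q s i) : ZMod q)) =
      (s : ZMod q) • (F.valMatrix P).map (Int.cast : ℤ → ZMod q) := by
    ext j i
    have : Fact (P j).Prime := ⟨hP j⟩
    have hA := hF.A_pos.ne'
    have hB := hF.B_pos.ne'
    have h3 : padicValNat (P j) ((F.A * F.B ^ (q - 1)) ^ s) =
        s * (padicValNat (P j) F.A + (q - 1) * padicValNat (P j) F.B) := by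
      rw [padicValNat.pow, padicValNat.mul hA (pow_ne_zero _ hB), padicValNat.pow]
    fin_cases i
    · simp [kummerBase, valMatrix, padicValNat.pow]
    · simp [kummerBase, valMatrix, padicValNat.pow]
    · simp only [Matrix.map_apply, Matrix.smul_apply]
      simp [kummerBase, valMatrix, h3, hq1, sub_eq_add_neg]
  have hc : ((F.valMatrix P).map (Int.cast : ℤ → ZMod q)).det =
      ((F.valMatrix P).det : ZMod q) := by
    rw [Int.cast_det]
  rw [heq, Matrix.det_smul, hc]
  exact mul_ne_zero (pow_ne_zero _ hs0) hdet

theorem factorial_cube_le (q : ℕ) : (q ^ 3).factorial ≤ 2 ^ (3 * q ^ 4) := by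
  calc (q ^ 3).factorial ≤ (q ^ 3) ^ q ^ 3 := Nat.factorial_le_pow _
    _ ≤ ((2 ^ q) ^ 3) ^ q ^ 3 := by
        gcongr; exact Nat.lt_two_pow_self.le
    _ = _ := by rw [← pow_mul, ← pow_mul]; congr 1; ring

theorem Bounded.kummerCoeff_eq_zero (hF : F.Bounded g h) {q : ℕ} [Fact q.Prime] {P : Fin 3 → ℕ}
    (hP : ∀ j, (P j).Prime) (hdet : ((F.valMatrix P).det : ZMod q) ≠ 0)
    {p : ℕ × ℕ × ℕ → ℤ} {K K' S T' ν π b : ℕ} (hK : h * K' = K) (hK' : 0 < K')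
    (hν : (box (q * K) (q * K')).card ≤ 2 ^ ν)
    (hp : ∀ m ∈ box (q * K) (q * K'), |p m| ≤ 2 ^ π)
    (hc₁ : ∀ m ∈ box (q * K) (q * K'), |F.c₁ m| ≤ 2 ^ b)
    (hc₂ : ∀ m ∈ box (q * K) (q * K'), |F.c₂ m| ≤ 2 ^ b)
    {t₁ t₂ s : ℕ} (ht₁ : t₁ < T') (ht₂ : t₂ < T') (hs : s < q * S) (hqs : ¬ q ∣ s)
    (hsmall : |F.expSum p (q * K) (q * K') t₁ t₂ (s / q)| *
      2 ^ (q ^ 3 * (ν + π + 2 * b * T' + 5 * g * q * (S * (q * K))) + 3 * q ^ 4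
        + q * (S * (q * K))) < 1) :
    F.kummerCoeff q p K K' t₁ t₂ s = 0 := by
  by_contra hne
  have hq : q.Prime := Fact.out
  have hg := hF.g_pos
  have hpow : ∀ {k a : ℕ} (_ : k ≤ 2 ^ a) (x : ℕ), k ^ x ≤ 2 ^ (a * x) := by
    intro k a hk x
    calc k ^ x ≤ (2 ^ a) ^ x := Nat.pow_le_pow_left hk x
      _ = _ := by rw [pow_mul]
  have hSK : h * (q * S) ≤ S * (q * K) := by
    rw [← hK]
    calc h * (q * S) ≤ h * (q * S) * K' := Nat.le_mul_of_pos_right _ hK'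
      _ = _ := by ring
  have hSK' : q * S ≤ S * (q * K) :=
    (Nat.le_mul_of_pos_left _ hF.h_pos).trans hSK
  have hB : ∀ i, (F.kummerBase q s i : ℝ) ≤ 2 ^ (g * q * (S * (q * K))) := by
    have h1 : ∀ {k : ℕ}, k ≤ 2 ^ g → k ^ s ≤ 2 ^ (g * q * (S * (q * K))) := by
      intro k hk
      refine (hpow hk s).trans (Nat.pow_le_pow_right (by norm_num) ?_)
      calc g * s ≤ g * (S * (q * K)) := Nat.mul_le_mul_left _ (hs.le.trans hSK')
        _ ≤ g * (S * (q * K)) * q := Nat.le_mul_of_pos_right _ hq.pos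
        _ = _ := by ring
    have h2 : (F.A * F.B ^ (q - 1)) ^ s ≤ 2 ^ (g * q * (S * (q * K))) := by
      have : F.A * F.B ^ (q - 1) ≤ 2 ^ (h * q) := by
        calc F.A * F.B ^ (q - 1) ≤ 2 ^ h * 2 ^ (h * (q - 1)) :=
              Nat.mul_le_mul hF.A_le (hpow hF.B_le _)
          _ = 2 ^ (h * (q - 1 + 1)) := by rw [← pow_add]; congr 1; ring
          _ = _ := by rw [Nat.sub_add_cancel hq.one_le]
      refine (hpow this s).trans (Nat.pow_le_pow_right (by norm_num) ?_)
      calc h * q * s ≤ h * q * (q * S) := Nat.mul_le_mul_left _ hs.le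
        _ = q * (h * (q * S)) := by ring
        _ ≤ q * (S * (q * K)) := Nat.mul_le_mul_left _ hSK
        _ ≤ g * (q * (S * (q * K))) := Nat.le_mul_of_pos_left _ hg
        _ = _ := by ring
    intro i
    fin_cases i
    · exact_mod_cast h1 hF.k₁_le
    · exact_mod_cast h1 hF.k₂_le
    · exact_mod_cast h2
  have hβ : ∀ i, F.kummerBase q s i ≠ 0 := by
    intro i
    fin_cases i
    · exact pow_ne_zero _ hF.k₁_pos.ne'
    · exact pow_ne_zero _ hF.k₂_pos.ne'
    · exact pow_ne_zero _ (mul_ne_zero hF.A_pos.ne' (pow_ne_zero _ hF.B_pos.ne'))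
  have hlow := kummer_lower_bound (F.kummerBase q s) P hβ hP (hF.det_kummerBase_ne_zero hP hdet hqs)
    (2 ^ (g * q * (S * (q * K)))) hB (F.kummerCoeff q p K K' t₁ t₂ s)
    (2 ^ (ν + π + 2 * b * T' + 2 * g * q * (S * (q * K)))) (one_le_pow₀ (by norm_num))
    (fun e => by exact_mod_cast hF.abs_kummerCoeff_le hq.two_le hK hν hp hc₁ hc₂ ht₁ ht₂ hs e) hne
  rw [← hF.expSum_div_eq hq.pos, abs_mul, abs_of_nonneg (by positivity)] at hlow
  refine absurd hsmall (not_lt.2 (hlow.trans ?_))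
  have e1 : (F.B : ℝ) ^ (s * (q * K')) ≤ 2 ^ (q * (S * (q * K))) := by
    have : F.B ^ (s * (q * K')) ≤ 2 ^ (q * (S * (q * K))) := by
      refine (hpow hF.B_le _).trans (Nat.pow_le_pow_right (by norm_num) ?_)
      calc h * (s * (q * K')) ≤ h * (q * S * (q * K')) := by gcongr
        _ = q * (S * (q * (h * K'))) := by ring
        _ = _ := by rw [hK]
    exact_mod_cast this
  have e2 : ((q ^ 3).factorial : ℝ) ≤ 2 ^ (3 * q ^ 4) := by exact_mod_cast factorial_cube_le q
  have e3 : ((2 : ℝ) ^ (ν + π + 2 * b * T' + 2 * g * q * (S * (q * K))) *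
      (2 ^ (g * q * (S * (q * K)))) ^ 3) ^ q ^ 3 =
      2 ^ (q ^ 3 * (ν + π + 2 * b * T' + 5 * g * q * (S * (q * K)))) := by
    rw [← pow_mul, ← pow_add, ← pow_mul]
    congr 1; ring
  rw [e3]
  calc _ ≤ 2 ^ (q * (S * (q * K))) * |F.expSum p (q * K) (q * K') t₁ t₂ (s / q)| *
        (2 ^ (3 * q ^ 4) *
          2 ^ (q ^ 3 * (ν + π + 2 * b * T' + 5 * g * q * (S * (q * K))))) := by gcongr
    _ = |F.expSum p (q * K) (q * K') t₁ t₂ (s / q)| *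
        (2 ^ (q ^ 3 * (ν + π + 2 * b * T' + 5 * g * q * (S * (q * K)))) * 2 ^ (3 * q ^ 4) *
          2 ^ (q * (S * (q * K)))) := by ring
    _ = _ := by rw [← pow_add, ← pow_add]

theorem sum_mul_add_pow_eq_zero {ι : Type*} (I : Finset ι) (u x : ι → ℝ) (a c : ℝ) {t : ℕ}
    (hz : ∀ i ≤ t, ∑ n ∈ I, u n * x n ^ i = 0) : ∑ n ∈ I, u n * (a + c * x n) ^ t = 0 := by
  have : ∑ n ∈ I, u n * (a + c * x n) ^ t = ∑ i ∈ Finset.range (t + 1),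
      (a ^ i * c ^ (t - i) * t.choose i) * ∑ n ∈ I, u n * x n ^ (t - i) := by
    simp only [Finset.mul_sum]
    rw [Finset.sum_comm]
    refine Finset.sum_congr rfl fun n _ => ?_
    rw [add_pow, Finset.mul_sum]
    refine Finset.sum_congr rfl fun i _ => ?_
    rw [mul_pow]; ring
  rw [this]
  exact Finset.sum_eq_zero fun i _ => by rw [hz _ (Nat.sub_le _ _), mul_zero]

theorem c₁_shift (F : LogForm) (q : ℕ) (e : Fin 3 → Fin q) (n : ℕ × ℕ × ℕ) :
    F.c₁ (shift q e n) = F.c₁ (shift q e 0) + q * F.c₁ n := by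
  simp only [c₁, shift]; push_cast; simp; ring

theorem c₂_shift (F : LogForm) (q : ℕ) (e : Fin 3 → Fin q) (n : ℕ × ℕ × ℕ) :
    F.c₂ (shift q e n) = F.c₂ (shift q e 0) + q * F.c₂ n := by
  simp only [c₂, shift]; push_cast; simp; ring

theorem Bounded.vanishes_of_kummerCoeff (hF : F.Bounded g h) {q : ℕ} (hq : 0 < q)
    {p : ℕ × ℕ × ℕ → ℤ} {K K' S T : ℕ} (e : Fin 3 → Fin q)
    (hz : ∀ s < S, ¬ q ∣ s → ∀ t₁ < T, ∀ t₂ < T, F.kummerCoeff q p K K' t₁ t₂ s e = 0) :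
    F.Vanishes q (fun n => p (shift q e n)) K K' S T := by
  intro s hs hqs
  have hq0 : (q : ℝ) ≠ 0 := by exact_mod_cast hq.ne'
  have hB : (0 : ℝ) < F.B := by exact_mod_cast hF.B_pos
  set x₁ : ℕ × ℕ × ℕ → ℝ := fun n => F.c₁ (shift q e n) with hx₁
  set x₂ : ℕ × ℕ × ℕ → ℝ := fun n => F.c₂ (shift q e n) with hx₂
  set u : ℕ × ℕ × ℕ → ℝ := fun n => p (shift q e n) * Real.exp (F.freq n * s) with hu
  have hterm : ∀ n ∈ box K K', ((F.k₁ ^ (s * n.1) * F.k₂ ^ (s * n.2.1) * F.A ^ (s * n.2.2) *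
      F.B ^ (s * (q * K' - e 2 - n.2.2)) : ℕ) : ℝ) =
      F.B ^ (s * (q * K' - e 2)) * Real.exp (F.freq n * s) := by
    intro n hn
    have hpow : ∀ {k : ℕ}, 0 < k → ∀ j : ℕ, (k : ℝ) ^ j = Real.exp (j * Real.log k) := by
      intro k hk j
      rw [Real.exp_nat_mul, Real.exp_log (by exact_mod_cast hk)]
    have hle : n.2.2 ≤ q * K' - e 2 := by
      have := (mem_box.1 (shift_mem_box e hn)).2.2
      simp only [shift] at this
      have h2 := Nat.le_mul_of_pos_left n.2.2 hq
      omega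
    push_cast
    rw [hpow hF.B_pos, hpow hF.B_pos, hpow hF.A_pos, hpow hF.k₁_pos, hpow hF.k₂_pos,
      ← Real.exp_add, ← Real.exp_add, ← Real.exp_add, ← Real.exp_add]
    congr 1
    simp only [freq]
    push_cast [Nat.cast_sub hle]
    ring
  have h0 : ∀ t₁ < T, ∀ t₂ < T, ∑ n ∈ box K K', u n * x₁ n ^ t₁ * x₂ n ^ t₂ = 0 := by
    intro t₁ ht₁ t₂ ht₂
    have h1 := congrArg (Int.cast : ℤ → ℝ) (hz s hs hqs t₁ ht₁ t₂ ht₂)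
    rw [kummerCoeff, Int.cast_sum, Int.cast_zero] at h1
    have h2 : (F.B : ℝ) ^ (s * (q * K' - e 2)) *
        ∑ n ∈ box K K', u n * x₁ n ^ t₁ * x₂ n ^ t₂ = 0 := by
      rw [← h1, Finset.mul_sum]
      refine Finset.sum_congr rfl fun n hn => ?_
      have h3 := hterm n hn
      rw [Int.cast_mul, Int.cast_natCast, h3]
      simp only [hu, hx₁, hx₂]
      push_cast
      ring
    exact (mul_eq_zero.1 h2).resolve_left (by positivity)
  have hy₁ : ∀ n, (F.c₁ n : ℝ) = -F.c₁ (shift q e 0) / q + 1 / q * x₁ n := by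
    intro n
    simp only [hx₁]
    rw [c₁_shift F q e n]
    push_cast
    field_simp
    ring
  have hy₂ : ∀ n, (F.c₂ n : ℝ) = -F.c₂ (shift q e 0) / q + 1 / q * x₂ n := by
    intro n
    simp only [hx₂]
    rw [c₂_shift F q e n]
    push_cast
    field_simp
    ring
  have h1 : ∀ t₁ < T, ∀ t₂ < T, ∑ n ∈ box K K', u n * (F.c₁ n : ℝ) ^ t₁ * x₂ n ^ t₂ = 0 := by
    intro t₁ ht₁ t₂ ht₂
    have := sum_mul_add_pow_eq_zero (box K K') (fun n => u n * x₂ n ^ t₂) x₁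
      (-F.c₁ (shift q e 0) / q) (1 / q) (t := t₁) (fun i hi => by
        rw [← h0 i (by omega) t₂ ht₂]
        exact Finset.sum_congr rfl fun n _ => by ring)
    rw [← this]
    refine Finset.sum_congr rfl fun n _ => ?_
    rw [← hy₁]; ring
  intro t₁ ht₁ t₂ ht₂
  have := sum_mul_add_pow_eq_zero (box K K') (fun n => u n * (F.c₁ n : ℝ) ^ t₁) x₂
    (-F.c₂ (shift q e 0) / q) (1 / q) (t := t₂) (fun i hi => h1 t₁ ht₁ i (by omega))
  rw [← this, expSum]
  refine Finset.sum_congr rfl fun n _ => ?_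
  rw [← hy₂]; simp only [hu]; ring

end LogForm

namespace LogForm

variable {F : LogForm} {g h : ℕ}

theorem card_filter_not_dvd {q S : ℕ} (hq : 2 ≤ q) (hS : q ∣ S) :
    S ≤ 2 * ((Finset.range S).filter (¬ q ∣ ·)).card := by
  obtain ⟨c, rfl⟩ := hS
  have h1 : ((Finset.range (q * c)).filter (q ∣ ·)).card ≤ c := by
    have : (Finset.range (q * c)).filter (q ∣ ·) ⊆ (Finset.range c).image (q * ·) := by
      intro x hx
      rw [Finset.mem_filter, Finset.mem_range] at hx
      obtain ⟨hx, y, rfl⟩ := hx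
      exact Finset.mem_image_of_mem _ (Finset.mem_range.2 (lt_of_mul_lt_mul_left hx (Nat.zero_le _)))
    calc _ ≤ _ := Finset.card_le_card this
      _ ≤ _ := Finset.card_image_le
      _ = c := Finset.card_range c
  have h2 := Finset.card_filter_add_card_filter_not (s := Finset.range (q * c)) (q ∣ ·)
  rw [Finset.card_range] at h2
  nlinarith

theorem Bounded.vanishes_shift (hF : F.Bounded g h) {q : ℕ} [Fact q.Prime] {P : Fin 3 → ℕ}
    (hP : ∀ j, (P j).Prime) (hdet : ((F.valMatrix P).det : ZMod q) ≠ 0)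
    {p : ℕ × ℕ × ℕ → ℤ} {K K' S T T' ν π b : ℕ} (hK : h * K' = K) (hK' : 0 < K')
    (hv : F.Vanishes q p (q * K) (q * K') S T) (hT : 2 * T' ≤ T) (hqS : q ∣ S) (hS : 2 ≤ S)
    (hν : (box (q * K) (q * K')).card ≤ 2 ^ ν)
    (hp : ∀ m ∈ box (q * K) (q * K'), |p m| ≤ 2 ^ π)
    (hc₁ : ∀ m ∈ box (q * K) (q * K'), |F.c₁ m| ≤ 2 ^ b)
    (hc₂ : ∀ m ∈ box (q * K) (q * K'), |F.c₂ m| ≤ 2 ^ b)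
    (hL' : q * K' ≤ 2 ^ b) (hH : S * (T' + 1) + 2 ≤ 2 ^ (4 * b))
    (hY : (ν + π + 2 * b * T' + 24 * g * (S * (q * K))) +
      (q ^ 3 * (ν + π + 2 * b * T' + 5 * g * q * (S * (q * K))) + 3 * q ^ 4
        + q * (S * (q * K))) + 2 ≤ S * T')
    (hval : |F.val| * 2 ^ ((4 * b + 1) * (S * T') + b) ≤ 1) (e : Fin 3 → Fin q) :
    F.Vanishes q (fun n => p (shift q e n)) K K' (q * S) T' := by
  have hq : q.Prime := Fact.out
  have hval0 := abs_nonneg F.val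
  have hL'R : ((q * K' : ℕ) : ℝ) ≤ 2 ^ b := by exact_mod_cast hL'
  have hL'val : ((q * K' : ℕ) : ℝ) * |F.val| * 2 ^ ((4 * b + 1) * (S * T')) ≤ 1 := by
    calc _ ≤ 2 ^ b * |F.val| * 2 ^ ((4 * b + 1) * (S * T')) := by gcongr
      _ = |F.val| * 2 ^ ((4 * b + 1) * (S * T') + b) := by rw [pow_add]; ring
      _ ≤ 1 := hval
  have hone : (1 : ℝ) ≤ 2 ^ ((4 * b + 1) * (S * T')) := one_le_pow₀ (by norm_num)
  refine hF.vanishes_of_kummerCoeff hq.pos e fun s hs hqs t₁ ht₁ t₂ ht₂ => ?_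
  rw [hF.kummerCoeff_eq_zero hP hdet hK hK' hν hp hc₁ hc₂ ht₁ ht₂ hs hqs ?_]
  · rfl
  have hq0 : (0 : ℝ) < q := by exact_mod_cast hq.pos
  have hle := hv.abs_expSum_le hF hT (L := q * K) (L' := q * K') (by rw [← hK]; ring)
    (Nat.mul_pos hq.pos hK') hS hν hp hc₁ hc₂ le_rfl
    (by
      calc ((q * K' : ℕ) : ℝ) * |F.val| ≤ ((q * K' : ℕ) : ℝ) * |F.val| * 2 ^ ((4 * b + 1) * (S * T')) :=
            le_mul_of_one_le_right (by positivity) hone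
        _ ≤ 1 := hL'val) ht₁ ht₂ (x := s / q) (by positivity)
    (by
      rw [div_le_iff₀ hq0]
      have : (s : ℝ) ≤ (q * S : ℕ) := by exact_mod_cast hs.le
      push_cast at this
      linarith)
  set n := ((Finset.range S).filter (¬ q ∣ ·)).card * T' with hn
  set V := ν + π + 2 * b * T' + 24 * g * (S * (q * K)) with hV
  set E := q ^ 3 * (ν + π + 2 * b * T' + 5 * g * q * (S * (q * K))) + 3 * q ^ 4
        + q * (S * (q * K)) with hE
  set Y := S * T' with hYdef
  have hn1 : Y ≤ 2 * n := by
    rw [hYdef, hn, ← mul_assoc]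
    exact Nat.mul_le_mul_right _ (card_filter_not_dvd hq.two_le hqS)
  have hn2 : n ≤ Y := by
    refine Nat.mul_le_mul_right _ ?_
    exact (Finset.card_filter_le _ _).trans (Finset.card_range S).le
  have h1 : (1 / 4 : ℝ) ^ n ≤ 1 / 2 ^ Y := by
    rw [div_pow, one_pow, show (4 : ℝ) = 2 ^ 2 by norm_num, ← pow_mul]
    gcongr
    norm_num
  have h2 : ((q * K' : ℕ) : ℝ) * |F.val| * ((S : ℝ) * (T' + 1) + 2) ^ n ≤ 1 / 2 ^ Y := by
    rw [le_div_iff₀ (by positivity)]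
    have hH' : (S : ℝ) * (T' + 1) + 2 ≤ 2 ^ (4 * b) := by exact_mod_cast hH
    calc ((q * K' : ℕ) : ℝ) * |F.val| * ((S : ℝ) * (T' + 1) + 2) ^ n * 2 ^ Y
        ≤ ((q * K' : ℕ) : ℝ) * |F.val| * ((2 : ℝ) ^ (4 * b)) ^ Y * 2 ^ Y := by
          have h3 : ((S : ℝ) * (T' + 1) + 2) ^ n ≤ ((2 : ℝ) ^ (4 * b)) ^ Y := by
            calc _ ≤ ((2 : ℝ) ^ (4 * b)) ^ n := by gcongr
              _ ≤ _ := pow_le_pow_right₀ (one_le_pow₀ (by norm_num)) hn2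
          gcongr
      _ = ((q * K' : ℕ) : ℝ) * |F.val| * 2 ^ ((4 * b + 1) * Y) := by
          rw [← pow_mul, mul_assoc, ← pow_add]; congr 2; ring
      _ ≤ 1 := hL'val
  calc _ ≤ (2 ^ V * (1 / 2 ^ Y) + 2 ^ V * (1 / 2 ^ Y)) * 2 ^ E := by
        gcongr
        refine hle.trans ?_
        rw [mul_assoc ((2 : ℝ) ^ V)]
        gcongr
    _ = (2 : ℝ) ^ (V + E + 1) / 2 ^ Y := by rw [pow_succ, pow_add]; ring
    _ < 1 := by
        rw [div_lt_one (by positivity)]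
        exact pow_lt_pow_right₀ (by norm_num) (by omega)

end LogForm

theorem exists_small_int_solution {α β : Type*} [Fintype α] [Fintype β] (a : α → β → ℤ) (B : ℕ)
    (hB : 1 ≤ B) (ha : ∀ i j, |a i j| ≤ B) (hα : 0 < Fintype.card α)
    (hαβ : 2 * Fintype.card α ≤ Fintype.card β) :
    ∃ t : β → ℤ, t ≠ 0 ∧ (∀ i, ∑ j, a i j * t j = 0) ∧ ∀ j, |t j| ≤ Fintype.card β * B := by
  let _ : SeminormedAddCommGroup (Matrix α β ℤ) := Matrix.seminormedAddCommGroup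
  obtain ⟨t, ht0, ht, hnorm⟩ := Int.Matrix.exists_ne_zero_int_vec_norm_le (Matrix.of a)
    (by omega) hα
  refine ⟨t, ht0, fun i => by simpa [Matrix.mulVec, dotProduct] using congrFun ht i, fun j => ?_⟩
  have hBR : (1 : ℝ) ≤ B := by exact_mod_cast hB
  have hm : ‖Matrix.of a‖ ≤ B := by
    refine (Matrix.norm_le_iff (by positivity)).2 fun i j => ?_
    rw [Matrix.of_apply, Int.norm_eq_abs]
    exact_mod_cast ha i j
  have hβ : (1 : ℝ) ≤ Fintype.card β := by
    have : 1 ≤ Fintype.card β := by omega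
    exact_mod_cast this
  have hexp : (Fintype.card α : ℝ) / (Fintype.card β - Fintype.card α) ≤ 1 := by
    have h1 : (2 : ℝ) * Fintype.card α ≤ Fintype.card β := by exact_mod_cast hαβ
    have h2 : (0 : ℝ) < Fintype.card α := by exact_mod_cast hα
    rw [div_le_one (by linarith)]
    linarith
  have h1 : ‖t‖ ≤ Fintype.card β * B := by
    refine hnorm.trans ?_
    calc _ ≤ ((Fintype.card β : ℝ) * max 1 ‖Matrix.of a‖) ^ (1 : ℝ) :=
          Real.rpow_le_rpow_of_exponent_le
            (one_le_mul_of_one_le_of_one_le hβ (le_max_left _ _)) hexp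
      _ ≤ _ := by
          rw [Real.rpow_one]
          gcongr
          exact max_le hBR hm
  have h2 : ‖t j‖ ≤ Fintype.card β * B := (norm_le_pi_norm t j).trans h1
  rw [Int.norm_eq_abs] at h2
  exact_mod_cast h2

namespace LogForm

variable {F : LogForm} {g h : ℕ}

theorem Bounded.exists_vanishes (hF : F.Bounded g h) {L L' S T b ν : ℕ} (hL : h * L' = L)
    (hν : (box L L').card ≤ 2 ^ ν) (hcard : 2 * (S * (T * T)) ≤ (box L L').card)
    (hS : 0 < S) (hT : 0 < T)
    (hc₁ : ∀ m ∈ box L L', |F.c₁ m| ≤ 2 ^ b) (hc₂ : ∀ m ∈ box L L', |F.c₂ m| ≤ 2 ^ b) :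
    ∃ p : ℕ × ℕ × ℕ → ℤ, (∃ m ∈ box L L', p m ≠ 0) ∧
      (∀ m ∈ box L L', |p m| ≤ 2 ^ (ν + (2 * b * T + 3 * g * (S * L)))) ∧
      ∀ q, F.Vanishes q p L L' S T := by
  have hpowN : ∀ {k a : ℕ} (_ : k ≤ 2 ^ a) (x : ℕ), k ^ x ≤ 2 ^ (a * x) := by
    intro k a hk x
    calc k ^ x ≤ (2 ^ a) ^ x := Nat.pow_le_pow_left hk x
      _ = _ := by rw [pow_mul]
  set w : ℕ → ℕ × ℕ × ℕ → ℕ := fun s m =>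
    F.k₁ ^ (s * m.1) * F.k₂ ^ (s * m.2.1) * F.A ^ (s * m.2.2) * F.B ^ (s * (L' - m.2.2)) with hw
  have hwle : ∀ s < S, ∀ m ∈ box L L', w s m ≤ 2 ^ (3 * g * (S * L)) := by
    intro s hs m hm
    obtain ⟨h1, h2, h3⟩ := mem_box.1 hm
    calc w s m ≤ 2 ^ (g * (s * m.1)) * 2 ^ (g * (s * m.2.1)) * 2 ^ (h * (s * m.2.2)) *
          2 ^ (h * (s * (L' - m.2.2))) :=
          Nat.mul_le_mul (Nat.mul_le_mul (Nat.mul_le_mul (hpowN hF.k₁_le _) (hpowN hF.k₂_le _))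
            (hpowN hF.A_le _)) (hpowN hF.B_le _)
      _ = 2 ^ (g * (s * m.1) + g * (s * m.2.1) + h * (s * m.2.2) + h * (s * (L' - m.2.2))) := by
          rw [pow_add, pow_add, pow_add]
      _ ≤ _ := by
          refine Nat.pow_le_pow_right (by norm_num) ?_
          have e1 : g * (s * m.1) ≤ g * (S * L) := by gcongr
          have e2 : g * (s * m.2.1) ≤ g * (S * L) := by gcongr
          have e3 : h * (s * m.2.2) + h * (s * (L' - m.2.2)) = s * L := by
            rw [← mul_add, ← mul_add, Nat.add_sub_cancel' h3.le, ← hL]; ring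
          have e4 : s * L ≤ g * (S * L) :=
            (Nat.mul_le_mul_right _ hs.le).trans (Nat.le_mul_of_pos_left _ hF.g_pos)
          linarith
  have hwexp : ∀ s : ℕ, ∀ m ∈ box L L', (w s m : ℝ) = F.B ^ (s * L') * Real.exp (F.freq m * s) := by
    intro s m hm
    obtain ⟨h1, h2, h3⟩ := mem_box.1 hm
    have hpow : ∀ {k : ℕ}, 0 < k → ∀ j : ℕ, (k : ℝ) ^ j = Real.exp (j * Real.log k) := by
      intro k hk j
      rw [Real.exp_nat_mul, Real.exp_log (by exact_mod_cast hk)]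
    simp only [hw]
    push_cast
    rw [hpow hF.B_pos, hpow hF.B_pos, hpow hF.A_pos, hpow hF.k₁_pos, hpow hF.k₂_pos,
      ← Real.exp_add, ← Real.exp_add, ← Real.exp_add, ← Real.exp_add]
    congr 1
    simp only [freq]
    push_cast [Nat.cast_sub h3.le]
    ring
  obtain ⟨t, ht0, hteq, htle⟩ := exists_small_int_solution
    (α := Fin S × Fin T × Fin T) (β := box L L')
    (fun i m => F.c₁ m ^ (i.2.1 : ℕ) * F.c₂ m ^ (i.2.2 : ℕ) * w i.1 m)
    (2 ^ (2 * b * T + 3 * g * (S * L))) Nat.one_le_two_pow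
    (by
      rintro ⟨s, t₁, t₂⟩ ⟨m, hm⟩
      have hc : ∀ {c : ℤ} (_ : |c| ≤ 2 ^ b) (t : Fin T), |c ^ (t : ℕ)| ≤ 2 ^ (b * T) := by
        intro c hc t
        rw [abs_pow]
        calc |c| ^ (t : ℕ) ≤ (2 ^ b) ^ (t : ℕ) := by gcongr
          _ ≤ (2 ^ b) ^ T := pow_le_pow_right₀ (one_le_pow₀ (by norm_num)) t.2.le
          _ = _ := by rw [pow_mul]
      have hw' : |(w s m : ℤ)| ≤ 2 ^ (3 * g * (S * L)) := by
        rw [abs_of_nonneg (by positivity)]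
        exact_mod_cast hwle s s.2 m hm
      simp only [abs_mul]
      push_cast
      calc _ ≤ (2 : ℤ) ^ (b * T) * 2 ^ (b * T) * 2 ^ (3 * g * (S * L)) := by
            gcongr
            · exact hc (hc₁ m hm) _
            · exact hc (hc₂ m hm) _
        _ = _ := by rw [← pow_add, ← pow_add]; congr 1; ring)
    (by simp [hS, hT]) (by simpa using hcard)
  obtain ⟨⟨m₀, hm₀⟩, hne⟩ := Function.ne_iff.1 ht0
  have hp : ∀ m (hm : m ∈ box L L'), (if hm : m ∈ box L L' then t ⟨m, hm⟩ else 0) = t ⟨m, hm⟩ :=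
    fun m hm => dif_pos hm
  refine ⟨fun m => if hm : m ∈ box L L' then t ⟨m, hm⟩ else 0, ⟨m₀, hm₀, ?_⟩, ?_, ?_⟩
  · simp only [hp _ hm₀]; exact hne
  · intro m hm
    simp only [hp _ hm]
    refine (htle _).trans ?_
    rw [Fintype.card_coe, pow_add _ ν]
    push_cast
    exact mul_le_mul_of_nonneg_right (by exact_mod_cast hν) (by positivity)
  · intro q s hs _ t₁ ht₁ t₂ ht₂
    have hB : (0 : ℝ) < F.B := by exact_mod_cast hF.B_pos
    have h1 := hteq (⟨s, hs⟩, ⟨t₁, ht₁⟩, ⟨t₂, ht₂⟩)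
    refine (mul_eq_zero.1 ?_).resolve_left (pow_ne_zero (s * L') hB.ne')
    rw [expSum, Finset.mul_sum, ← Finset.sum_coe_sort]
    have h2 : ((∑ m : box L L', F.c₁ m ^ t₁ * F.c₂ m ^ t₂ * w s m * t m : ℤ) : ℝ) = 0 := by
      rw [h1]; simp
    rw [← h2]
    push_cast
    refine Finset.sum_congr rfl fun m _ => ?_
    have h3 := hwexp s m m.2
    rw [hp _ m.2, h3]
    ring

theorem eq_zero_of_vanishes (hb : F.b₃ ≠ 0) {q : ℕ} (hq : 2 ≤ q) {p : ℕ × ℕ × ℕ → ℤ} {S T : ℕ}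
    (hv : F.Vanishes q p h 1 S T) (hS : 2 ≤ S) (hT : h ≤ T) : ∀ m ∈ box h 1, p m = 0 := by
  have hbR : (F.b₃ : ℝ) ≠ 0 := by exact_mod_cast hb
  have hinj : Function.Injective fun i : Fin h => (F.b₃ : ℝ) * i := fun i j hij => by
    have := mul_left_cancel₀ hbR hij
    exact Fin.ext (by exact_mod_cast this)
  have h1 : ∀ t₁ : Fin h, ∀ t₂ : Fin h, ∑ i : Fin h, (∑ j : Fin h,
      (p (i, j, 0) * Real.exp (F.freq (i, j, 0))) * ((F.b₃ : ℝ) * j) ^ (t₂ : ℕ)) *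
        ((F.b₃ : ℝ) * i) ^ (t₁ : ℕ) = 0 := by
    intro t₁ t₂
    have := hv 1 (by omega) (by rw [Nat.dvd_one]; omega) t₁ (t₁.2.trans_le hT) t₂ (t₂.2.trans_le hT)
    rw [expSum, box, Finset.sum_product] at this
    rw [← this, Finset.sum_range]
    refine Finset.sum_congr rfl fun i _ => ?_
    rw [Finset.sum_product, Finset.sum_range, Finset.sum_mul]
    refine Finset.sum_congr rfl fun j _ => ?_
    simp [c₁, c₂]
    ring
  have h2 : ∀ t₂ : Fin h, ∀ i : Fin h, ∑ j : Fin h,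
      (p (i, j, 0) * Real.exp (F.freq (i, j, 0))) * ((F.b₃ : ℝ) * j) ^ (t₂ : ℕ) = 0 :=
    fun t₂ i => congrFun (Matrix.eq_zero_of_forall_pow_sum_mul_pow_eq_zero hinj
      fun t₁ => h1 t₁ t₂) i
  rintro ⟨i, j, k⟩ hm
  obtain ⟨hi, hj, hk⟩ := mem_box.1 hm
  obtain rfl : k = 0 := by simpa using hk
  have h3 := congrFun (Matrix.eq_zero_of_forall_pow_sum_mul_pow_eq_zero hinj
    (v := fun j : Fin h => p (i, j, 0) * Real.exp (F.freq (i, j, 0)))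
    fun t₂ => h2 t₂ ⟨i, hi⟩) ⟨j, hj⟩
  have h4 : (p (i, j, 0) : ℝ) = 0 := (mul_eq_zero.1 h3).resolve_right (Real.exp_ne_zero _)
  exact_mod_cast h4

end LogForm

namespace LogForm

variable {F : LogForm} {g h : ℕ}

theorem box_subset {L L' K K' : ℕ} (hL : L ≤ K) (hL' : L' ≤ K') : box L L' ⊆ box K K' := by
  intro m hm
  rw [mem_box] at hm ⊢
  omega

theorem Bounded.exists_vanishes_descent (hF : F.Bounded g h) {q : ℕ} [Fact q.Prime] {P : Fin 3 → ℕ}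
    (hP : ∀ j, (P j).Prime) (hdet : ((F.valMatrix P).det : ZMod q) ≠ 0) {J S₀ τ ν π b : ℕ}
    (hqS : q ∣ S₀) (hS₀ : 2 ≤ S₀)
    (hν : (box (h * q ^ (J + 1)) (q ^ (J + 1))).card ≤ 2 ^ ν)
    (hc₁ : ∀ m ∈ box (h * q ^ (J + 1)) (q ^ (J + 1)), |F.c₁ m| ≤ 2 ^ b)
    (hc₂ : ∀ m ∈ box (h * q ^ (J + 1)) (q ^ (J + 1)), |F.c₂ m| ≤ 2 ^ b)
    (hqb : q ^ (J + 1) ≤ 2 ^ b)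
    (hH : S₀ * (τ * (h * q ^ J)) + S₀ * q ^ J + 2 ≤ 2 ^ (4 * b))
    (hY : (ν + π + 2 * b * (τ * (h * q ^ J)) + 24 * g * (S₀ * (q * (h * q ^ J)))) +
      (q ^ 3 * (ν + π + 2 * b * (τ * (h * q ^ J)) + 5 * g * q * (S₀ * (q * (h * q ^ J)))) +
        3 * q ^ 4 + q * (S₀ * (q * (h * q ^ J)))) + 2 ≤ S₀ * (τ * (h * q ^ J)))
    (hval : |F.val| * 2 ^ ((4 * b + 1) * (S₀ * (τ * (h * q ^ J))) + b) ≤ 1)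
    (h0 : ∃ p : ℕ × ℕ × ℕ → ℤ, (∃ m ∈ box (h * q ^ (J + 1)) (q ^ (J + 1)), p m ≠ 0) ∧
      (∀ m ∈ box (h * q ^ (J + 1)) (q ^ (J + 1)), |p m| ≤ 2 ^ π) ∧
      F.Vanishes q p (h * q ^ (J + 1)) (q ^ (J + 1)) S₀ (τ * (h * q ^ (J + 1)))) :
    ∀ j i, j + i = J + 1 → ∃ p : ℕ × ℕ × ℕ → ℤ, (∃ m ∈ box (h * q ^ i) (q ^ i), p m ≠ 0) ∧
      (∀ m ∈ box (h * q ^ i) (q ^ i), |p m| ≤ 2 ^ π) ∧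
      F.Vanishes q p (h * q ^ i) (q ^ i) (S₀ * q ^ j) (τ * (h * q ^ i)) := by
  have hq : q.Prime := Fact.out
  intro j
  induction j with
  | zero =>
    intro i hi
    obtain rfl : i = J + 1 := by omega
    simpa using h0
  | succ j ih =>
    intro i hi
    obtain ⟨p, ⟨m₀, hm₀, hpm₀⟩, hp, hv⟩ := ih (i + 1) (by omega)
    have hiJ : i ≤ J := by omega
    have hpowle : q ^ i ≤ q ^ J := Nat.pow_le_pow_right hq.pos hiJ
    have hpowle' : q ^ (i + 1) ≤ q ^ (J + 1) := Nat.pow_le_pow_right hq.pos (by omega)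
    have hsub : box (h * q ^ (i + 1)) (q ^ (i + 1)) ⊆ box (h * q ^ (J + 1)) (q ^ (J + 1)) :=
      box_subset (Nat.mul_le_mul_left _ hpowle') hpowle'
    have e1 : h * q ^ (i + 1) = q * (h * q ^ i) := by ring
    have e2 : q ^ (i + 1) = q * q ^ i := by ring
    have e3 : S₀ * q ^ j * (q * (h * q ^ i)) = S₀ * (q * (h * q ^ J)) := by
      rw [show J = j + i by omega, pow_add]; ring
    have e4 : S₀ * q ^ j * (τ * (h * q ^ i)) = S₀ * (τ * (h * q ^ J)) := by
      rw [show J = j + i by omega, pow_add]; ring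
    have hνi := (Finset.card_le_card hsub).trans hν
    have hc₁i := fun m hm => hc₁ m (hsub hm)
    have hc₂i := fun m hm => hc₂ m (hsub hm)
    rw [e1, e2] at hm₀ hp hv hνi hc₁i hc₂i
    have hT' : τ * (h * q ^ i) ≤ τ * (h * q ^ J) := by gcongr
    have hstep := hF.vanishes_shift hP hdet (p := p) (K := h * q ^ i) (K' := q ^ i)
      (S := S₀ * q ^ j) (T := τ * (q * (h * q ^ i))) (T' := τ * (h * q ^ i)) (ν := ν) (π := π)
      (b := b) rfl (pow_pos hq.pos _) hv
      (by
        calc 2 * (τ * (h * q ^ i)) ≤ q * (τ * (h * q ^ i)) := Nat.mul_le_mul_right _ hq.two_le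
          _ = _ := by ring)
      (Dvd.dvd.mul_right hqS _)
      (hS₀.trans (Nat.le_mul_of_pos_right _ (pow_pos hq.pos _)))
      hνi hp hc₁i hc₂i
      (by rw [← e2]; exact hpowle'.trans hqb)
      (by
        refine le_trans ?_ hH
        rw [mul_add, mul_one, e4]
        gcongr
        · exact hq.one_le
        · omega)
      (by
        rw [e3, e4]
        refine le_trans ?_ hY
        gcongr)
      (by rw [e4]; exact hval)
    refine ⟨fun n => p (shift q (residue q hq.pos m₀) n),
      ⟨(m₀.1 / q, m₀.2.1 / q, m₀.2.2 / q), div_mem_box hq.pos hm₀, ?_⟩,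
      fun m hm => hp _ (shift_mem_box _ hm), ?_⟩
    · simpa only [shift_residue] using hpm₀
    · have := hstep (residue q hq.pos m₀)
      rwa [show q * (S₀ * q ^ j) = S₀ * q ^ (j + 1) by ring] at this

theorem descent_arith {q : ℕ} (hq : 2 ≤ q) :
    6 * (q ^ 3 + 1) + 40 * ((q ^ 3 + 1) * (q + 1) * q ^ 5) +
      8 * q ^ 5 * (27 + 3 * q ^ 3 + 5 * q ^ 4 + q) + 3 * q ^ 4 + 2 ≤ 160 * q ^ 9 := by
  obtain ⟨r, rfl⟩ := Nat.exists_eq_add_of_le hq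
  zify
  rw [← sub_nonneg]
  have hr : (0 : ℤ) ≤ r := Int.natCast_nonneg r
  ring_nf
  positivity

set_option maxHeartbeats 2000000 in
theorem Bounded.one_lt_abs_val (hF : F.Bounded g h) {q : ℕ} [Fact q.Prime] {P : Fin 3 → ℕ}
    (hP : ∀ j, (P j).Prime) (hdet : ((F.valMatrix P).det : ZMod q) ≠ 0) {M b S₀ τ : ℕ}
    (hM₁ : |F.b₁| ≤ M) (hM₂ : |F.b₂| ≤ M) (hM₃ : |F.b₃| ≤ M) (hb0 : 0 < b)
    (hS : S₀ = 8 * q ^ 4 * b) (hτ : τ = 20 * g * q ^ 5)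
    (hb : 2 * M * (h * (q * (2 * S₀ * τ ^ 2))) ≤ 2 ^ b) :
    1 < |F.val| * 2 ^ ((4 * b + 1) * (2 * S₀ ^ 2 * τ ^ 3 * h) + b) := by
  by_contra! hval
  have hq : q.Prime := Fact.out
  have hq0 := hq.pos
  have hg := hF.g_pos
  have hh := hF.h_pos
  have hτ1 : 1 ≤ τ := by rw [hτ]; exact Nat.pos_of_ne_zero (by positivity)
  have hS2 : 2 ≤ S₀ := by
    have : 1 ≤ q ^ 4 * b := Nat.pos_of_ne_zero (by positivity)
    rw [hS]; nlinarith
  have hM1 : 1 ≤ M := by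
    have : 0 < |F.b₃| := abs_pos.2 hF.b₃_ne
    omega
  set G := 2 * S₀ * τ ^ 2 with hG
  have hG1 : 1 < G := by
    have : 1 ≤ τ ^ 2 := Nat.one_le_pow _ _ hτ1
    rw [hG]; nlinarith
  obtain ⟨J, hJ⟩ : ∃ J, Nat.clog q G = J + 1 :=
    Nat.exists_eq_succ_of_ne_zero (Nat.clog_pos hq.one_lt hG1).ne'
  have hJ1 : G ≤ q ^ (J + 1) := hJ ▸ Nat.le_pow_clog hq.one_lt G
  have hJ2 : q ^ J < G := by
    have := Nat.pow_pred_clog_lt_self hq.one_lt hG1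
    rwa [hJ] at this
  have hJ3 : q ^ (J + 1) ≤ q * G := by rw [pow_succ']; gcongr
  have hMW : 2 * M * (h * q ^ (J + 1)) ≤ 2 ^ b := le_trans (by gcongr) hb
  have hW : h * q ^ (J + 1) ≤ 2 ^ b := le_trans (Nat.le_mul_of_pos_left _ (by omega)) hMW
  have hqJ : q ^ (J + 1) ≤ 2 ^ b := (Nat.le_mul_of_pos_left _ hh).trans hW
  have hU : 1 ≤ h * q ^ J := Nat.pos_of_ne_zero (by positivity)
  have hS₀τ : S₀ * τ ≤ 2 ^ b := by
    calc S₀ * τ ≤ S₀ * τ * (2 * τ) := Nat.le_mul_of_pos_right _ (by omega)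
      _ = G := by rw [hG]; ring
      _ ≤ _ := hJ1.trans hqJ
  have hWJ : h * q ^ J ≤ 2 ^ b := le_trans (by rw [pow_succ]; nlinarith [pow_pos hq0 J]) hW
  have hcb : ∀ b' : ℤ, |b'| ≤ M → ∀ x z : ℕ, x < h * q ^ (J + 1) → z < q ^ (J + 1) →
      |F.b₃ * x - b' * z| ≤ 2 ^ b := by
    intro b' hb' x z hx hz
    have hz' : z ≤ h * q ^ (J + 1) := hz.le.trans (Nat.le_mul_of_pos_left _ hh)
    calc |F.b₃ * x - b' * z| ≤ |F.b₃ * x| + |b' * z| := abs_sub _ _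
      _ = |F.b₃| * x + |b'| * z := by rw [abs_mul, abs_mul, Nat.abs_cast, Nat.abs_cast]
      _ ≤ M * (h * q ^ (J + 1) : ℕ) + M * (h * q ^ (J + 1) : ℕ) := by gcongr
      _ = (2 * M * (h * q ^ (J + 1)) : ℕ) := by push_cast; ring
      _ ≤ _ := by exact_mod_cast hMW
  have hcard : (box (h * q ^ (J + 1)) (q ^ (J + 1))).card ≤ 2 ^ (3 * b) := by
    rw [card_box, show 3 * b = b + (b + b) by ring, pow_add 2 b (b + b), pow_add 2 b b]
    exact Nat.mul_le_mul hW (Nat.mul_le_mul hW hqJ)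
  have hc₁ : ∀ m ∈ box (h * q ^ (J + 1)) (q ^ (J + 1)), |F.c₁ m| ≤ 2 ^ b := fun m hm =>
    hcb _ hM₁ _ _ (mem_box.1 hm).1 (mem_box.1 hm).2.2
  have hc₂ : ∀ m ∈ box (h * q ^ (J + 1)) (q ^ (J + 1)), |F.c₂ m| ≤ 2 ^ b := fun m hm =>
    hcb _ hM₂ _ _ (mem_box.1 hm).2.1 (mem_box.1 hm).2.2
  obtain ⟨p, hpne, hple, hpv⟩ := hF.exists_vanishes (S := S₀) (T := τ * (h * q ^ (J + 1))) rfl hcard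
    (by
      rw [card_box]
      calc 2 * (S₀ * (τ * (h * q ^ (J + 1)) * (τ * (h * q ^ (J + 1)))))
          = h * q ^ (J + 1) * (h * q ^ (J + 1) * G) := by rw [hG]; ring
        _ ≤ _ := by gcongr)
    (by omega) (by positivity) hc₁ hc₂
  have hbg : 1 ≤ b * g * (h * q ^ J) := Nat.pos_of_ne_zero (by positivity)
  have hdesc := hF.exists_vanishes_descent hP hdet (J := J) (S₀ := S₀) (τ := τ) (ν := 3 * b)
    (b := b) (by rw [hS]; exact ⟨8 * q ^ 3 * b, by ring⟩) hS2 hcard hc₁ hc₂ hqJ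
    (by
      have h1 : S₀ * (τ * (h * q ^ J)) ≤ 2 ^ b * 2 ^ b := by
        rw [← mul_assoc]; exact Nat.mul_le_mul hS₀τ hWJ
      have h2 : S₀ * q ^ J ≤ 2 ^ b * 2 ^ b :=
        Nat.mul_le_mul ((Nat.le_mul_of_pos_right _ hτ1).trans hS₀τ)
          ((Nat.le_mul_of_pos_left _ hh).trans hWJ)
      have h3 : 2 ≤ 2 ^ b := (show 2 ^ 1 ≤ 2 ^ b from Nat.pow_le_pow_right (by norm_num) hb0)
      rw [show 4 * b = b + b + (b + b) by ring, pow_add, pow_add]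
      generalize 2 ^ b = z at *
      have h4 : 4 ≤ z * z := by nlinarith
      nlinarith)
    (by
      have := Nat.mul_le_mul_right (b * g * (h * q ^ J)) (descent_arith hq.two_le)
      set U := h * q ^ J with hUdef
      rw [show h * q ^ (J + 1) = q * U by rw [hUdef]; ring, hS, hτ]
      have e1 : b * (6 * (q ^ 3 + 1)) ≤ b * (6 * (q ^ 3 + 1)) * (g * U) :=
        Nat.le_mul_of_pos_right _ (by positivity)
      have e2 : (3 * q ^ 4 + 2) ≤ (3 * q ^ 4 + 2) * (b * g * U) :=
        Nat.le_mul_of_pos_right _ (by positivity)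
      have e3 : 8 * q ^ 5 * q * b * U * 1 ≤ 8 * q ^ 5 * q * b * U * g := by
        gcongr; exact hg
      nlinarith)
    (by
      refine le_trans ?_ hval
      have h1 : S₀ * (τ * (h * q ^ J)) ≤ 2 * S₀ ^ 2 * τ ^ 3 * h := by
        calc S₀ * (τ * (h * q ^ J)) ≤ S₀ * (τ * (h * G)) := by gcongr
          _ = _ := by rw [hG]; ring
      have h2 : (4 * b + 1) * (S₀ * (τ * (h * q ^ J))) + b ≤
          (4 * b + 1) * (2 * S₀ ^ 2 * τ ^ 3 * h) + b := by gcongr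
      exact mul_le_mul_of_nonneg_left (pow_le_pow_right₀ (by norm_num) h2) (abs_nonneg _))
    ⟨p, hpne, hple, hpv q⟩ (J + 1) 0 (by omega)
  obtain ⟨p', ⟨m, hm, hpm⟩, -, hv⟩ := hdesc
  rw [pow_zero, mul_one] at hm hv
  exact hpm (eq_zero_of_vanishes hF.b₃_ne hq.two_le hv
    (hS2.trans (Nat.le_mul_of_pos_right _ (pow_pos hq0 _))) (Nat.le_mul_of_pos_left _ hτ1) m hm)

end LogForm

theorem exists_prime_not_dvd {D : ℤ} (hD : D ≠ 0) {b : ℕ} (hDb : |D| < 2 ^ b) :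
    ∃ q, q.Prime ∧ q ≤ 8 * b ^ 2 ∧ ¬ (q : ℤ) ∣ D := by
  by_contra! hall
  have hb : 0 < b := by
    rcases Nat.eq_zero_or_pos b with rfl | hb
    · have := abs_pos.2 hD
      rw [pow_zero] at hDb
      omega
    · exact hb
  set x := 4 * b ^ 2 with hx
  have hx0 : 0 < x := by positivity
  set s := (Finset.range (2 * x + 1)).filter Nat.Prime with hs
  have hprod : ∏ p ∈ s, p ∣ D.natAbs := by
    refine Finset.prod_primes_dvd _ (fun p hp => (Finset.mem_filter.1 hp).2.prime) fun p hp => ?_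
    rw [Finset.mem_filter, Finset.mem_range] at hp
    exact Int.natCast_dvd.1 (hall p hp.2 (by omega))
  have hcard : 2 ^ s.card < 2 ^ b := by
    have h1 : 2 ^ s.card ≤ ∏ p ∈ s, p := by
      rw [← Finset.prod_const]
      exact Finset.prod_le_prod' fun p hp => (Finset.mem_filter.1 hp).2.two_le
    have h2 := Nat.le_of_dvd (Int.natAbs_pos.2 hD) hprod
    have h3 : D.natAbs < 2 ^ b := by
      rw [Int.abs_eq_natAbs] at hDb
      exact_mod_cast hDb
    omega
  have hcard' : s.card < b := (Nat.pow_lt_pow_iff_right (by norm_num)).1 hcard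
  have hbinom : x.centralBinom ≤ (2 * x) ^ s.card := by
    rw [← Nat.prod_pow_factorization_centralBinom x, ← Finset.prod_const, hs, Finset.prod_filter]
    refine Finset.prod_le_prod' fun p _ => ?_
    split_ifs with hp
    · exact Nat.pow_factorization_choose_le (by omega)
    · rw [Nat.factorization_eq_zero_of_not_prime _ hp, pow_zero]
  have h4 : 4 ^ x ≤ (8 * b ^ 2) ^ b := by
    calc 4 ^ x ≤ 2 * x * x.centralBinom := Nat.four_pow_le_two_mul_self_mul_centralBinom x hx0
      _ ≤ 2 * x * (2 * x) ^ s.card := by gcongr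
      _ = (2 * x) ^ (s.card + 1) := by ring
      _ ≤ (2 * x) ^ b := Nat.pow_le_pow_right (by omega) hcard'
      _ = _ := by rw [hx]; congr 1; ring
  have h5 : (8 * b ^ 2) ^ b < 4 ^ x := by
    have h6 : b < 2 ^ b := Nat.lt_two_pow_self
    calc (8 * b ^ 2) ^ b < (2 ^ 3 * (2 ^ b) ^ 2) ^ b := by
          refine Nat.pow_lt_pow_left ?_ hb.ne'
          have : b ^ 2 < (2 ^ b) ^ 2 := Nat.pow_lt_pow_left h6 (by norm_num)
          omega
      _ = 2 ^ ((3 + b * 2) * b) := by rw [← pow_mul, ← pow_add, ← pow_mul]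
      _ ≤ 2 ^ (2 * x) := by
          refine Nat.pow_le_pow_right (by norm_num) ?_
          rw [hx]; nlinarith
      _ = 4 ^ x := by rw [pow_mul]; norm_num
  omega

namespace LogForm

variable {F : LogForm} {g h : ℕ}

theorem Bounded.one_lt_abs_val_of_det_ne_zero (hF : F.Bounded g h) {P : Fin 3 → ℕ}
    (hP : ∀ j, (P j).Prime) (hdet : (F.valMatrix P).det ≠ 0) {M b : ℕ}
    (hdet' : |(F.valMatrix P).det| < 2 ^ b)
    (hM₁ : |F.b₁| ≤ M) (hM₂ : |F.b₂| ≤ M) (hM₃ : |F.b₃| ≤ M)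
    (hb : 2 ^ 59 * b ^ 31 * M * h * g ^ 2 ≤ 2 ^ b) :
    1 < |F.val| * 2 ^ (2 ^ 92 * b ^ 49 * g ^ 3 * h) := by
  obtain ⟨q, hq, hqb, hqD⟩ := exists_prime_not_dvd hdet hdet'
  have : Fact q.Prime := ⟨hq⟩
  have hb0 : 0 < b := by
    rcases Nat.eq_zero_or_pos b with rfl | hb
    · have := hq.pos
      simp at hqb
      omega
    · exact hb
  have hg := hF.g_pos
  have hh := hF.h_pos
  have hmain := hF.one_lt_abs_val hP (q := q) (b := b) (M := M)
    (by rwa [Ne, ZMod.intCast_zmod_eq_zero_iff_dvd]) hM₁ hM₂ hM₃ hb0 rfl rfl (by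
      refine le_trans ?_ hb
      calc 2 * M * (h * (q * (2 * (8 * q ^ 4 * b) * (20 * g * q ^ 5) ^ 2)))
          = 12800 * b * M * h * g ^ 2 * q ^ 15 := by ring
        _ ≤ 12800 * b * M * h * g ^ 2 * (8 * b ^ 2) ^ 15 := by gcongr
        _ = (12800 * 2 ^ 45) * (b ^ 31 * M * h * g ^ 2) := by ring
        _ ≤ 2 ^ 59 * (b ^ 31 * M * h * g ^ 2) := Nat.mul_le_mul_right _ (by norm_num)
        _ = _ := by ring)
  refine hmain.trans_le (mul_le_mul_of_nonneg_left (pow_le_pow_right₀ (by norm_num) ?_)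
    (abs_nonneg _))
  calc (4 * b + 1) * (2 * (8 * q ^ 4 * b) ^ 2 * (20 * g * q ^ 5) ^ 3 * h) + b
      ≤ (5 * b) * (2 * (8 * q ^ 4 * b) ^ 2 * (20 * g * q ^ 5) ^ 3 * h) + b := by
        gcongr; omega
    _ = 5 * b ^ 3 * g ^ 3 * h * (1024000 * q ^ 23) + b := by ring
    _ ≤ 5 * b ^ 3 * g ^ 3 * h * (1024000 * (8 * b ^ 2) ^ 23) + b := by gcongr
    _ = (5 * 1024000 * 2 ^ 69) * (b ^ 49 * g ^ 3 * h) + b := by ring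
    _ ≤ (5 * 1024000 * 2 ^ 69) * (b ^ 49 * g ^ 3 * h) + 1 * (b ^ 49 * g ^ 3 * h) := by
        have h1 : b ≤ b ^ 49 * (g ^ 3 * h) :=
          (Nat.le_self_pow (by norm_num) b).trans (Nat.le_mul_of_pos_right _ (by positivity))
        have : b ^ 49 * (g ^ 3 * h) = b ^ 49 * g ^ 3 * h := by ring
        omega
    _ = (5 * 1024000 * 2 ^ 69 + 1) * (b ^ 49 * g ^ 3 * h) := by ring
    _ ≤ 2 ^ 92 * (b ^ 49 * g ^ 3 * h) := Nat.mul_le_mul_right _ (by norm_num)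
    _ = _ := by ring

end LogForm

theorem log_eq_sum_padicValNat {n : ℕ} {s : Finset ℕ} (hs : n.primeFactors ⊆ s)
    (hs' : ∀ p ∈ s, p.Prime) : Real.log n = ∑ p ∈ s, (padicValNat p n : ℝ) * Real.log p := by
  rw [Real.log_nat_eq_sum_factorization, Finsupp.sum, Nat.support_factorization,
    Finset.sum_subset hs]
  · exact Finset.sum_congr rfl fun p hp => by rw [Nat.factorization_def _ (hs' p hp)]
  · intro p _ hp
    rw [← Nat.support_factorization, Finsupp.notMem_support_iff] at hp
    rw [hp]; simp

theorem padicValNat_le_of_le_two_pow {p n g : ℕ} (hp : p.Prime) (hn : n ≠ 0) (h : n ≤ 2 ^ g) :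
    padicValNat p n ≤ g := by
  have h1 : 2 ^ padicValNat p n ≤ 2 ^ g :=
    calc 2 ^ padicValNat p n ≤ p ^ padicValNat p n := Nat.pow_le_pow_left hp.two_le _
      _ ≤ n := Nat.le_of_dvd (Nat.pos_of_ne_zero hn) pow_padicValNat_dvd
      _ ≤ _ := h
  exact (Nat.pow_le_pow_iff_right (by norm_num)).1 h1

theorem MultIndep.exists_minor_ne_zero {k l : ℕ} (hk : 2 ≤ k) (hl : 2 ≤ l) (hkl : MultIndep k l) :
    ∃ p₁ p₂ : ℕ, p₁.Prime ∧ p₂.Prime ∧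
      (padicValNat p₁ k : ℤ) * padicValNat p₂ l - padicValNat p₂ k * padicValNat p₁ l ≠ 0 := by
  by_contra! hall
  obtain ⟨p, hp, hpk⟩ := Nat.exists_prime_and_dvd (show k ≠ 1 by omega)
  have : Fact p.Prime := ⟨hp⟩
  have ha : padicValNat p k ≠ 0 := Nat.one_le_iff_ne_zero.1 (one_le_padicValNat_of_dvd (by omega) hpk)
  have heq : k ^ padicValNat p l = l ^ padicValNat p k := by
    refine Nat.eq_of_factorization_eq (pow_ne_zero _ (by omega)) (pow_ne_zero _ (by omega))
      fun q => ?_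
    simp only [Nat.factorization_pow, Finsupp.smul_apply, smul_eq_mul]
    by_cases hq : q.Prime
    · rw [Nat.factorization_def _ hq, Nat.factorization_def _ hq]
      have := hall p q hp hq
      have h2 : (padicValNat p k : ℤ) * padicValNat q l = padicValNat q k * padicValNat p l := by
        linarith
      have h3 : padicValNat p k * padicValNat q l = padicValNat q k * padicValNat p l := by
        exact_mod_cast h2
      rw [h3, mul_comm]
    · rw [Nat.factorization_eq_zero_of_not_prime _ hq, Nat.factorization_eq_zero_of_not_prime _ hq]
      simp
  have := hkl (padicValNat p l) (padicValNat p k) (by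
    rw [zpow_natCast, zpow_natCast]; exact_mod_cast heq)
  exact ha (by exact_mod_cast this.2)

/-- If the valuation vectors satisfy a linear relation, so do the logarithms. -/
theorem sum_mul_log_eq_zero {k l A B : ℕ} (hk : k ≠ 0) (hl : l ≠ 0) (hA : A ≠ 0) (hB : B ≠ 0)
    {x y z : ℤ} (h : ∀ p : ℕ, p.Prime → x * padicValNat p k + y * padicValNat p l +
      z * ((padicValNat p A : ℤ) - padicValNat p B) = 0) :
    (x : ℝ) * Real.log k + y * Real.log l + z * (Real.log A - Real.log B) = 0 := by
  set s := (k * l * (A * B)).primeFactors with hs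
  have hs' : ∀ p ∈ s, p.Prime := fun p hp => Nat.prime_of_mem_primeFactors hp
  have hne : k * l * (A * B) ≠ 0 := by positivity
  have hsub : ∀ {n : ℕ}, n ∣ k * l * (A * B) → n.primeFactors ⊆ s := fun hn =>
    Nat.primeFactors_mono hn hne
  rw [log_eq_sum_padicValNat (hsub ((dvd_mul_right k l).mul_right _)) hs',
    log_eq_sum_padicValNat (hsub ((dvd_mul_left l k).mul_right _)) hs',
    log_eq_sum_padicValNat (hsub ((dvd_mul_right A B).mul_left _)) hs',
    log_eq_sum_padicValNat (hsub ((dvd_mul_left B A).mul_left _)) hs',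
    ← Finset.sum_sub_distrib, Finset.mul_sum, Finset.mul_sum, Finset.mul_sum,
    ← Finset.sum_add_distrib, ← Finset.sum_add_distrib]
  refine Finset.sum_eq_zero fun p hp => ?_
  have h1 := h p (hs' p hp)
  have h2 : (x : ℝ) * padicValNat p k + y * padicValNat p l +
      z * ((padicValNat p A : ℝ) - padicValNat p B) = 0 := by
    have := congrArg (Int.cast : ℤ → ℝ) h1
    simpa only [Int.cast_add, Int.cast_mul, Int.cast_sub, Int.cast_natCast, Int.cast_zero] using this
  linear_combination Real.log p * h2

theorem abs_mul_sub_mul_le {a b c d : ℤ} {x y : ℤ} (ha : 0 ≤ a) (hax : a ≤ x) (hc : 0 ≤ c)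
    (hcx : c ≤ x) (hb : |b| ≤ y) (hd : |d| ≤ y) : |a * b - c * d| ≤ 2 * (x * y) := by
  calc |a * b - c * d| ≤ |a * b| + |c * d| := abs_sub _ _
    _ = a * |b| + c * |d| := by rw [abs_mul, abs_mul, abs_of_nonneg ha, abs_of_nonneg hc]
    _ ≤ x * y + x * y := by
        have h1 := abs_nonneg b
        have h2 : 0 ≤ x := ha.trans hax
        gcongr
    _ = _ := by ring

theorem log_form_dichotomy {k l g h A B m r M b : ℕ} (hk : 2 ≤ k) (hl : 2 ≤ l)
    (hkl : MultIndep k l) (hkg : k ≤ 2 ^ g) (hlg : l ≤ 2 ^ g) (hgh : g ≤ h) (hA : 0 < A)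
    (hB : 0 < B) (hAh : A ≤ 2 ^ h) (hBh : B ≤ 2 ^ h) (hM : 0 < M) (hb0 : 0 < b) (hm : m ≤ M) (hr : r ≤ M)
    (hb : 2 ^ 64 * b ^ 31 * M * h ^ 2 * g ^ 4 ≤ 2 ^ b) :
    (m ≤ 2 * (g * h) ∧ r ≤ 2 * (g * h)) ∨
      1 < |m * Real.log k - r * Real.log l + (Real.log A - Real.log B)| *
        2 ^ (2 ^ 97 * b ^ 49 * g ^ 3 * h) := by
  have hg : 0 < g := by
    rcases Nat.eq_zero_or_pos g with rfl | hg
    · simp at hkg; omega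
    · exact hg
  have hh : 0 < h := by omega
  obtain ⟨p₁, p₂, hp₁, hp₂, hΔ⟩ := hkl.exists_minor_ne_zero hk hl
  have : Fact p₁.Prime := ⟨hp₁⟩
  have : Fact p₂.Prime := ⟨hp₂⟩
  have hvk : ∀ p : ℕ, p.Prime → (padicValNat p k : ℤ) ≤ g := fun p hp => by
    exact_mod_cast padicValNat_le_of_le_two_pow hp (by omega) hkg
  have hvl : ∀ p : ℕ, p.Prime → (padicValNat p l : ℤ) ≤ g := fun p hp => by
    exact_mod_cast padicValNat_le_of_le_two_pow hp (by omega) hlg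
  have hvA : ∀ p : ℕ, p.Prime → |(padicValNat p A : ℤ) - padicValNat p B| ≤ h := fun p hp => by
    have h1 := padicValNat_le_of_le_two_pow hp hA.ne' hAh
    have h2 := padicValNat_le_of_le_two_pow hp hB.ne' hBh
    rw [abs_le]; omega
  set v : ℕ → ℤ := fun p => padicValNat p k with hv
  set w : ℕ → ℤ := fun p => padicValNat p l with hw
  set u : ℕ → ℤ := fun p => (padicValNat p A : ℤ) - padicValNat p B with hu
  have hv0 : ∀ p, 0 ≤ v p := fun p => Int.natCast_nonneg _
  have hw0 : ∀ p, 0 ≤ w p := fun p => Int.natCast_nonneg _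
  set Δ : ℤ := v p₁ * w p₂ - v p₂ * w p₁ with hΔdef
  set C₁ : ℤ := w p₁ * u p₂ - w p₂ * u p₁ with hC₁
  set C₂ : ℤ := v p₂ * u p₁ - v p₁ * u p₂ with hC₂
  have hΔle : |Δ| ≤ g ^ 2 := by
    have h1 := mul_nonneg (hv0 p₁) (hw0 p₂)
    have h2 := mul_nonneg (hv0 p₂) (hw0 p₁)
    have h3 : v p₁ * w p₂ ≤ g * g := mul_le_mul (hvk _ hp₁) (hvl _ hp₂) (hw0 _) (by positivity)
    have h4 : v p₂ * w p₁ ≤ g * g := mul_le_mul (hvk _ hp₂) (hvl _ hp₁) (hw0 _) (by positivity)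
    rw [abs_le, pow_two]; constructor <;> linarith
  have hC₁le : |C₁| ≤ 2 * (g * h) :=
    abs_mul_sub_mul_le (hw0 _) (hvl _ hp₁) (hw0 _) (hvl _ hp₂) (hvA _ hp₂) (hvA _ hp₁)
  have hC₂le : |C₂| ≤ 2 * (g * h) :=
    abs_mul_sub_mul_le (hv0 _) (hvk _ hp₂) (hv0 _) (hvk _ hp₁) (hvA _ hp₁) (hvA _ hp₂)
  have hbig : 2 ^ 64 * M * h ^ 2 * g ^ 4 ≤ 2 ^ b := by
    refine le_trans ?_ hb
    calc 2 ^ 64 * M * h ^ 2 * g ^ 4 = 2 ^ 64 * 1 * M * h ^ 2 * g ^ 4 := by ring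
      _ ≤ _ := by gcongr; exact Nat.one_le_pow _ _ hb0
  by_cases hex : ∃ p₃ : ℕ, p₃.Prime ∧ v p₃ * C₁ + w p₃ * C₂ + u p₃ * Δ ≠ 0
  · obtain ⟨p₃, hp₃, hne⟩ := hex
    right
    have hF : (LogForm.mk k l A B m (-r) 1).Bounded g h :=
      ⟨hg, hh, by dsimp; omega, by dsimp; omega, hA, hB, hkg, hlg, hAh, hBh, one_ne_zero⟩
    have hdet : ((LogForm.mk k l A B m (-r) 1).valMatrix ![p₁, p₂, p₃]).det =
        v p₃ * C₁ + w p₃ * C₂ + u p₃ * Δ := by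
      rw [Matrix.det_fin_three]
      simp [LogForm.valMatrix, hC₁, hC₂, hΔdef, hv, hw, hu]
      ring
    have hlow := hF.one_lt_abs_val_of_det_ne_zero (P := ![p₁, p₂, p₃]) (M := M) (b := b)
      (by intro j; fin_cases j <;> assumption) (by rwa [hdet])
      (by
        rw [hdet]
        have h1 : |v p₃ * C₁ + w p₃ * C₂ + u p₃ * Δ| ≤ g * (2 * (g * h)) + g * (2 * (g * h)) +
            h * g ^ 2 := by
          refine (abs_add_three _ _ _).trans ?_
          rw [abs_mul, abs_mul, abs_mul, abs_of_nonneg (hv0 _), abs_of_nonneg (hw0 _)]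
          gcongr
          · exact hvk _ hp₃
          · exact hvl _ hp₃
          · exact hvA _ hp₃
        have h2 : 5 * (h * g ^ 2) < 2 ^ 64 * M * h ^ 2 * g ^ 4 := by
          have e1 : 1 ≤ h * g ^ 2 := Nat.pos_of_ne_zero (by positivity)
          have e2 : 1 ≤ M * (h * g ^ 2) := Nat.pos_of_ne_zero (by positivity)
          calc 5 * (h * g ^ 2) < 2 ^ 64 * (h * g ^ 2) := by omega
            _ ≤ 2 ^ 64 * (h * g ^ 2) * (M * (h * g ^ 2)) := Nat.le_mul_of_pos_right _ e2
            _ = _ := by ring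
        have h3 : ((5 * (h * g ^ 2) : ℕ) : ℤ) < (2 ^ b : ℕ) := by exact_mod_cast h2.trans_le hbig
        push_cast at h3
        linarith)
      (by simpa using hm) (by simpa using hr) (by simpa using Nat.succ_le_of_lt hM)
      (by
        refine le_trans ?_ hb
        calc 2 ^ 59 * b ^ 31 * M * h * g ^ 2 ≤ 2 ^ 64 * b ^ 31 * M * h ^ 2 * g ^ 4 := by
              gcongr
              · norm_num
              · norm_num
              · exact Nat.le_self_pow (by norm_num) h
              · norm_num
          _ = _ := by ring)
    have hval : (LogForm.mk k l A B m (-r) 1).val =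
        m * Real.log k - r * Real.log l + (Real.log A - Real.log B) := by
      simp [LogForm.val]; ring
    rw [hval] at hlow
    refine hlow.trans_le (mul_le_mul_of_nonneg_left (pow_le_pow_right₀ (by norm_num) ?_)
      (abs_nonneg _))
    gcongr <;> norm_num
  · push Not at hex
    set Λ := m * Real.log k - r * Real.log l + (Real.log A - Real.log B) with hΛ
    set m' : ℤ := Δ * m - C₁ with hm'
    set r' : ℤ := Δ * r + C₂ with hr'
    have hrel := sum_mul_log_eq_zero (k := k) (l := l) (A := A) (B := B) (x := C₁) (y := C₂)
      (z := Δ) (by omega) (by omega) hA.ne' hB.ne' (fun p hp => by linarith [hex p hp])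
    have hΔΛ : Δ * Λ = m' * Real.log k - r' * Real.log l := by
      rw [hΛ, hm', hr']
      push_cast
      linear_combination hrel
    by_cases hz : m' = 0 ∧ r' = 0
    · left
      have key : ∀ x : ℕ, ∀ C : ℤ, |C| ≤ 2 * (g * h) → Δ * x = C → x ≤ 2 * (g * h) := by
        intro x C hC hx
        have h1 : (x : ℤ) ≤ |Δ * x| := by
          rw [abs_mul, Nat.abs_cast]
          exact le_mul_of_one_le_left (by positivity) (Int.one_le_abs hΔ)
        rw [hx] at h1
        exact_mod_cast h1.trans hC
      exact ⟨key m C₁ hC₁le (by linarith [hz.1]),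
        key r (-C₂) (by rwa [abs_neg]) (by linarith [hz.2])⟩
    right
    suffices hsuff : ∃ E, E + 2 * g ≤ 2 ^ 97 * b ^ 49 * g ^ 3 * h ∧ 1 < |(Δ : ℝ) * Λ| * 2 ^ E by
      obtain ⟨E, hE, hlt⟩ := hsuff
      have h1 : |(Δ : ℝ)| ≤ 2 ^ (2 * g) := by
        have h2 : (g : ℤ) ^ 2 ≤ (2 ^ g) ^ 2 := by
          have : (g : ℤ) ≤ 2 ^ g := by exact_mod_cast Nat.lt_two_pow_self.le
          gcongr
        have h3 := hΔle.trans h2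
        rw [← pow_mul, mul_comm] at h3
        exact_mod_cast h3
      calc 1 < |(Δ : ℝ) * Λ| * 2 ^ E := hlt
        _ ≤ 2 ^ (2 * g) * |Λ| * 2 ^ E := by rw [abs_mul]; gcongr
        _ = |Λ| * 2 ^ (E + 2 * g) := by rw [pow_add]; ring
        _ ≤ _ := mul_le_mul_of_nonneg_left (pow_le_pow_right₀ (by norm_num) hE) (abs_nonneg _)
    have hlog2 : 1 < Real.log 2 * 2 ^ 2 := by linarith [Real.log_two_gt_d9]
    have hpoly : 1 ≤ b ^ 49 * g ^ 2 * h := Nat.pos_of_ne_zero (by positivity)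
    have hgE : g ≤ b ^ 49 * g ^ 3 * h := by
      calc g ≤ g * (b ^ 49 * g ^ 2 * h) := Nat.le_mul_of_pos_right _ hpoly
        _ = _ := by ring
    by_cases hr0 : r' = 0
    · have hm0 : m' ≠ 0 := fun h0 => hz ⟨h0, hr0⟩
      refine ⟨2, ?_, ?_⟩
      · have : 2 ^ 97 * b ^ 49 * g ^ 3 * h = 2 ^ 97 * (b ^ 49 * g ^ 3 * h) := by ring
        omega
      · rw [hΔΛ, hr0, Int.cast_zero, zero_mul, sub_zero, abs_mul]
        have h1 : (1 : ℝ) ≤ |(m' : ℝ)| := by exact_mod_cast Int.one_le_abs hm0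
        have h2 : Real.log 2 ≤ |Real.log k| :=
          (Real.log_le_log (by norm_num) (by exact_mod_cast hk)).trans (le_abs_self _)
        have h3 : 0 < Real.log 2 := Real.log_pos (by norm_num)
        calc 1 < Real.log 2 * 2 ^ 2 := hlog2
          _ ≤ |Real.log k| * 2 ^ 2 := by gcongr
          _ ≤ |(m' : ℝ)| * |Real.log k| * 2 ^ 2 := by
              gcongr
              exact le_mul_of_one_le_left (abs_nonneg _) h1
    · set p := (k * l + 1).minFac with hpdef
      have hkl0 : 0 < k * l := by positivity
      have hp : p.Prime := Nat.minFac_prime (by omega)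
      have : Fact p.Prime := ⟨hp⟩
      have hpkl : ¬ p ∣ k * l := fun hd =>
        hp.one_lt.ne' (Nat.dvd_one.1 ((Nat.dvd_add_right hd).1 (Nat.minFac_dvd (k * l + 1))))
      have hpk : ¬ p ∣ k := fun hd => hpkl (hd.mul_right _)
      have hpl : ¬ p ∣ l := fun hd => hpkl (hd.mul_left _)
      have hpg : p ≤ 2 ^ (3 * g) := by
        calc p ≤ k * l + 1 := Nat.minFac_le (by omega)
          _ ≤ 2 ^ g * 2 ^ g + 1 := by gcongr
          _ ≤ 2 ^ g * 2 ^ g * 2 ^ g := by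
              have : 2 ≤ 2 ^ g := (show 2 ^ 1 ≤ 2 ^ g from Nat.pow_le_pow_right (by norm_num) hg)
              generalize 2 ^ g = z at *
              nlinarith [Nat.mul_le_mul this this]
          _ = _ := by rw [← pow_add, ← pow_add]; congr 1; ring
      have hF : (LogForm.mk k p l 1 m' 0 (-r')).Bounded (3 * g) h :=
        ⟨by omega, hh, by dsimp; omega, hp.pos, by dsimp; omega, by dsimp; omega,
          hkg.trans (Nat.pow_le_pow_right (by norm_num) (by omega)), hpg,
          hlg.trans (Nat.pow_le_pow_right (by norm_num) hgh), Nat.one_le_two_pow,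
          neg_ne_zero.2 hr0⟩
      have hdet : ((LogForm.mk k p l 1 m' 0 (-r')).valMatrix ![p₁, p, p₂]).det = Δ := by
        have e1 : padicValNat p k = 0 := padicValNat.eq_zero_of_not_dvd hpk
        have e2 : padicValNat p l = 0 := padicValNat.eq_zero_of_not_dvd hpl
        rw [Matrix.det_fin_three]
        simp [LogForm.valMatrix, hΔdef, hv, hw, e1, e2]
        ring
      have hgh1 : 1 ≤ g * h := Nat.pos_of_ne_zero (by positivity)
      have hMbound : ∀ x : ℕ, ∀ C : ℤ, x ≤ M → |C| ≤ 2 * (g * h) →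
          |Δ * x + C| ≤ (3 * g ^ 2 * h * M : ℕ) := by
        intro x C hx hC
        have hx' : (x : ℤ) ≤ M := by exact_mod_cast hx
        have hM' : (1 : ℤ) ≤ M := by exact_mod_cast hM
        have hg' : (1 : ℤ) ≤ g := by exact_mod_cast hg
        have hh' : (1 : ℤ) ≤ h := by exact_mod_cast hh
        calc |Δ * x + C| ≤ |Δ| * x + |C| := by
              refine (abs_add_le _ _).trans ?_
              rw [abs_mul, Nat.abs_cast]
          _ ≤ g ^ 2 * M + 2 * (g * h) := by gcongr
          _ ≤ g ^ 2 * h * M + 2 * (g ^ 2 * h * M) := by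
              have e1 : (g : ℤ) ^ 2 * M ≤ g ^ 2 * M * h := le_mul_of_one_le_right (by positivity) hh'
              have e2 : (g : ℤ) * h ≤ g * h * (g * M) :=
                le_mul_of_one_le_right (by positivity) (one_le_mul_of_one_le_of_one_le hg' hM')
              linarith
          _ = _ := by push_cast; ring
      have hlow := hF.one_lt_abs_val_of_det_ne_zero (P := ![p₁, p, p₂]) (M := 3 * g ^ 2 * h * M)
        (b := b) (by intro j; fin_cases j <;> assumption) (by rwa [hdet])
        (by
          rw [hdet]
          have h1 : g ^ 2 < 2 ^ 64 * M * h ^ 2 * g ^ 4 := by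
            calc g ^ 2 < 2 ^ 64 * g ^ 2 := by
                  have : 0 < g ^ 2 := by positivity
                  omega
              _ ≤ 2 ^ 64 * g ^ 2 * (M * h ^ 2 * g ^ 2) :=
                  Nat.le_mul_of_pos_right _ (by positivity)
              _ = _ := by ring
          have h2 : ((g ^ 2 : ℕ) : ℤ) < (2 ^ b : ℕ) := by exact_mod_cast h1.trans_le hbig
          push_cast at h2
          linarith)
        (by
          have := hMbound m (-C₁) hm (by rwa [abs_neg])
          rwa [← sub_eq_add_neg] at this)
        (by simpa using by positivity)
        (by
          dsimp only
          rw [abs_neg]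
          exact hMbound r C₂ hr hC₂le)
        (by
          refine le_trans ?_ hb
          calc 2 ^ 59 * b ^ 31 * (3 * g ^ 2 * h * M) * h * (3 * g) ^ 2
              = (2 ^ 59 * 27) * (b ^ 31 * M * h ^ 2 * g ^ 4) := by ring
            _ ≤ 2 ^ 64 * (b ^ 31 * M * h ^ 2 * g ^ 4) := Nat.mul_le_mul_right _ (by norm_num)
            _ = _ := by ring)
      have hval : (LogForm.mk k p l 1 m' 0 (-r')).val = Δ * Λ := by
        rw [hΔΛ]
        simp [LogForm.val]; ring
      rw [hval] at hlow
      refine ⟨_, ?_, hlow⟩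
      calc 2 ^ 92 * b ^ 49 * (3 * g) ^ 3 * h + 2 * g
          = 2 ^ 92 * 27 * (b ^ 49 * g ^ 3 * h) + 2 * g := by ring
        _ ≤ 2 ^ 92 * 27 * (b ^ 49 * g ^ 3 * h) + 2 * (b ^ 49 * g ^ 3 * h) := by gcongr
        _ = (2 ^ 92 * 27 + 2) * (b ^ 49 * g ^ 3 * h) := by ring
        _ ≤ 2 ^ 97 * (b ^ 49 * g ^ 3 * h) := Nat.mul_le_mul_right _ (by norm_num)
        _ = _ := by ring

/-- The value of the first `p` digits of the digit sequence `a` (most significant first). -/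
def prefixValue (k : ℕ) (a : ℕ → ℕ) : ℕ → ℕ
  | 0 => 0
  | p + 1 => k * prefixValue k a p + a p

namespace prefixValue

variable {k : ℕ} {a : ℕ → ℕ}

theorem pow_mul_le (p t : ℕ) : k ^ t * prefixValue k a p ≤ prefixValue k a (p + t) := by
  induction t with
  | zero => simp
  | succ t ih =>
    calc k ^ (t + 1) * prefixValue k a p = k * (k ^ t * prefixValue k a p) := by ring
      _ ≤ k * prefixValue k a (p + t) := Nat.mul_le_mul_left _ ih
      _ ≤ prefixValue k a (p + (t + 1)) := Nat.le_add_right _ _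

theorem lt_pow_mul (ha : ∀ j, a j < k) (p t : ℕ) :
    prefixValue k a (p + t) + 1 ≤ k ^ t * (prefixValue k a p + 1) := by
  induction t with
  | zero => simp
  | succ t ih =>
    calc prefixValue k a (p + (t + 1)) + 1 = k * prefixValue k a (p + t) + (a (p + t) + 1) := rfl
      _ ≤ k * prefixValue k a (p + t) + k := Nat.add_le_add_left (ha _) _
      _ = k * (prefixValue k a (p + t) + 1) := by ring
      _ ≤ k * (k ^ t * (prefixValue k a p + 1)) := Nat.mul_le_mul_left _ ih
      _ = _ := by ring

theorem lt_pow (ha : ∀ j, a j < k) (t : ℕ) : prefixValue k a t < k ^ t := by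
  have := lt_pow_mul ha 0 t
  simpa [prefixValue, Nat.succ_le_iff] using this

theorem add_period {p c t : ℕ} (h : ∀ j < t, a (p + j + c) = a (p + j)) :
    prefixValue k a (p + t + c) + k ^ t * prefixValue k a p =
      prefixValue k a (p + t) + k ^ t * prefixValue k a (p + c) := by
  induction t with
  | zero => simp [add_comm]
  | succ t ih =>
    have h1 : prefixValue k a (p + (t + 1) + c) = k * prefixValue k a (p + t + c) + a (p + t + c) := by
      rw [show p + (t + 1) + c = (p + t + c) + 1 by ring]; rfl
    have h2 : prefixValue k a (p + (t + 1)) = k * prefixValue k a (p + t) + a (p + t) := rfl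
    have h3 := ih fun j hj => h j (hj.trans (Nat.lt_succ_self t))
    rw [h1, h2, h t (Nat.lt_succ_self t), pow_succ]
    linear_combination k * h3

theorem pos {n p : ℕ} (hk : 0 < k) (ha : ∀ j, a j < k) (hn : k ^ (n - 1) ≤ prefixValue k a n)
    (hp : 0 < p) (hpn : p ≤ n) : 0 < prefixValue k a p := by
  by_contra h0
  have h0 : prefixValue k a p = 0 := by omega
  obtain ⟨t, rfl⟩ := Nat.exists_eq_add_of_le hpn
  have h1 := lt_pow_mul ha p t
  rw [h0] at h1
  have h2 : k ^ t ≤ k ^ (p + t - 1) := Nat.pow_le_pow_right hk (by omega)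
  omega

theorem lt_add {n p c : ℕ} (hk : 2 ≤ k) (ha : ∀ j, a j < k)
    (hn : k ^ (n - 1) ≤ prefixValue k a n) (hc : 0 < c) (hpn : p + c ≤ n) :
    prefixValue k a p < prefixValue k a (p + c) := by
  rcases Nat.eq_zero_or_pos p with rfl | hp
  · exact pos (by omega) ha hn (by omega) hpn
  · have h1 := pos (by omega) ha hn hp (by omega)
    have h2 := pow_mul_le (k := k) (a := a) p c
    have h3 : 2 ≤ k ^ c := hk.trans (Nat.le_self_pow hc.ne' k)
    nlinarith

end prefixValue

theorem abs_log_le_of_abs_sub_one_le {x ε : ℝ} (hε : ε ≤ 1 / 2) (h : |x - 1| ≤ ε) :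
    |Real.log x| ≤ 2 * ε := by
  have h1 := abs_le.1 h
  have hx : 1 / 2 ≤ x := by linarith
  have hx0 : 0 < x := by linarith
  refine abs_le.2 ⟨?_, ?_⟩
  · refine le_trans ?_ (Real.one_sub_inv_le_log_of_pos hx0)
    have : x⁻¹ ≤ 1 + 2 * ε := by
      rw [inv_le_iff_one_le_mul₀ hx0]
      nlinarith
    linarith
  · linarith [Real.log_le_sub_one_of_pos hx0]

/-- A long periodic stretch of digits makes the logarithm of a number close to
a linear form in logarithms. -/
theorem abs_log_prefixValue_sub_le {k : ℕ} {a : ℕ → ℕ} (hk : 2 ≤ k) (ha : ∀ j, a j < k)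
    {p c t n : ℕ} (hn : k ^ (n - 1) ≤ prefixValue k a n) (hc : 0 < c) (ht : 0 < t)
    (hptc : p + t + c ≤ n) (h : ∀ j < t, a (p + j + c) = a (p + j)) :
    ∃ A : ℕ, 0 < A ∧ A < k ^ (p + c) ∧
      |Real.log (prefixValue k a n) + Real.log (k ^ c - 1 : ℕ) -
        ((n - p : ℕ) * Real.log k + Real.log A)| ≤ 2 * (1 / 2) ^ t := by
  obtain ⟨s, rfl⟩ := Nat.exists_eq_add_of_le hptc
  obtain ⟨A, hA⟩ := Nat.exists_eq_add_of_lt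
    (prefixValue.lt_add hk ha hn hc (by omega : p + c ≤ p + t + c + s))
  refine ⟨A + 1, A.succ_pos, ?_, ?_⟩
  · have := prefixValue.lt_pow ha (p + c)
    omega
  set N := prefixValue k a (p + t + c + s) with hN
  have hN0 : 0 < N := lt_of_lt_of_le (by positivity) hn
  have e1 := prefixValue.add_period (k := k) h
  have l1 := prefixValue.pow_mul_le (k := k) (a := a) (p + t + c) s
  have u1 := prefixValue.lt_pow_mul ha (p + t + c) s
  have l2 := prefixValue.pow_mul_le (k := k) (a := a) (p + t) (c + s)
  have u2 := prefixValue.lt_pow_mul ha (p + t) (c + s)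
  rw [← add_assoc] at l2 u2
  rw [← hN] at l1 u1 l2 u2
  have hkc : 2 ≤ k ^ c := hk.trans (Nat.le_self_pow hc.ne' k)
  have hcast : ((k ^ c - 1 : ℕ) : ℝ) = (k : ℝ) ^ c - 1 := by
    rw [Nat.cast_sub (by omega)]; push_cast; rfl
  have hk' : (2 : ℝ) ≤ k := by exact_mod_cast hk
  have hkc' : (2 : ℝ) ≤ (k : ℝ) ^ c := by exact_mod_cast hkc
  have hk0 : (0 : ℝ) < k := by linarith
  have hA1 : (1 : ℝ) ≤ ((A + 1 : ℕ) : ℝ) := by exact_mod_cast A.succ_pos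
  have hN0' : (0 : ℝ) < N := by exact_mod_cast hN0
  have key : Real.log N + Real.log (k ^ c - 1 : ℕ) -
        ((p + t + c + s - p : ℕ) * Real.log k + Real.log (A + 1 : ℕ)) =
      Real.log (N * ((k : ℝ) ^ c - 1) / ((k : ℝ) ^ (t + c + s) * (A + 1 : ℕ))) := by
    rw [show p + t + c + s - p = t + c + s by omega, hcast, Real.log_div, Real.log_mul,
      Real.log_mul, Real.log_pow]
    all_goals first | positivity | (refine ne_of_gt ?_; nlinarith)
  rw [key]
  have hhalf : ((1 : ℝ) / 2) ^ t ≤ 1 / 2 := by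
    calc ((1 : ℝ) / 2) ^ t ≤ (1 / 2) ^ 1 :=
          pow_le_pow_of_le_one (by norm_num) (by norm_num) ht
      _ = _ := pow_one _
  refine abs_log_le_of_abs_sub_one_le hhalf ?_
  have hden : (0 : ℝ) < (k : ℝ) ^ (t + c + s) * (A + 1 : ℕ) := by positivity
  rw [div_sub_one hden.ne', abs_div, abs_of_pos hden, div_le_iff₀ hden]
  have hks : (0 : ℝ) < (k : ℝ) ^ (c + s) := by positivity
  have hdiff : |N * ((k : ℝ) ^ c - 1) - (k : ℝ) ^ (t + c + s) * (A + 1 : ℕ)| ≤ (k : ℝ) ^ (c + s) := by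
    have e1' : (prefixValue k a (p + t + c) : ℝ) =
        prefixValue k a (p + t) + k ^ t * (A + 1 : ℕ) := by
      have e1r := congrArg (Nat.cast : ℕ → ℝ) e1
      rw [hA] at e1r
      push_cast at e1r ⊢
      linear_combination e1r
    have l1' : (k : ℝ) ^ s * prefixValue k a (p + t + c) ≤ N := by exact_mod_cast l1
    have u1' : (N : ℝ) ≤ (k : ℝ) ^ s * (prefixValue k a (p + t + c) + 1) := by
      exact_mod_cast (Nat.le_succ _).trans u1
    have l2' : (k : ℝ) ^ (c + s) * prefixValue k a (p + t) ≤ N := by exact_mod_cast l2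
    have u2' : (N : ℝ) ≤ (k : ℝ) ^ (c + s) * (prefixValue k a (p + t) + 1) := by
      exact_mod_cast (Nat.le_succ _).trans u2
    have l1c := mul_le_mul_of_nonneg_left l1' (by positivity : (0 : ℝ) ≤ (k : ℝ) ^ c)
    have u1c := mul_le_mul_of_nonneg_left u1' (by positivity : (0 : ℝ) ≤ (k : ℝ) ^ c)
    rw [e1'] at l1c u1c
    rw [abs_le]
    constructor
    · have : (k : ℝ) ^ (t + c + s) * (A + 1 : ℕ) = k ^ c * (k ^ s * (k ^ t * (A + 1 : ℕ))) := by ring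
      rw [this]
      have h3 : (k : ℝ) ^ (c + s) = k ^ c * k ^ s := pow_add _ _ _
      rw [h3] at l2' u2' ⊢
      linarith
    · have : (k : ℝ) ^ (t + c + s) * (A + 1 : ℕ) = k ^ c * (k ^ s * (k ^ t * (A + 1 : ℕ))) := by ring
      rw [this]
      have h3 : (k : ℝ) ^ (c + s) = k ^ c * k ^ s := pow_add _ _ _
      rw [h3] at l2' u2' ⊢
      linarith
  refine hdiff.trans ?_
  have h2k : (1 : ℝ) ≤ (1 / 2) ^ t * (k : ℝ) ^ t := by
    rw [← mul_pow]
    exact one_le_pow₀ (by linarith)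
  calc (k : ℝ) ^ (c + s) ≤ k ^ (c + s) * (((1 / 2) ^ t * (k : ℝ) ^ t) * (A + 1 : ℕ)) :=
        le_mul_of_one_le_right hks.le (one_le_mul_of_one_le_of_one_le h2k hA1)
    _ = _ := by ring

/-- Two numerals for the same number in bases `k` and `l`: simultaneous periodic stretches
of digits are short, unless everything is short. -/
theorem periodic_stretch_bound {k l g M b y n n' p q c c' t t' : ℕ} {a a' : ℕ → ℕ}
    (hk : 2 ≤ k) (hl : 2 ≤ l) (hkl : MultIndep k l) (hkg : k ≤ 2 ^ g) (hlg : l ≤ 2 ^ g)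
    (ha : ∀ j, a j < k) (ha' : ∀ j, a' j < l)
    (hn : k ^ (n - 1) ≤ prefixValue k a n) (hn' : l ^ (n' - 1) ≤ prefixValue l a' n')
    (heq : prefixValue k a n = prefixValue l a' n')
    (hM : 0 < M) (hb0 : 0 < b) (hnM : n ≤ M) (hnM' : n' ≤ M)
    (hb : 2 ^ 64 * b ^ 31 * M * (g * y) ^ 2 * g ^ 4 ≤ 2 ^ b)
    (hc : 0 < c) (hc' : 0 < c') (ht : 0 < t) (ht' : 0 < t') (hy : p + c + (q + c') ≤ y)
    (hptc : p + t + c ≤ n) (hptc' : q + t' + c' ≤ n')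
    (h : ∀ j < t, a (p + j + c) = a (p + j)) (h' : ∀ j < t', a' (q + j + c') = a' (q + j)) :
    (n - p ≤ 2 * (g * (g * y)) ∧ n' - q ≤ 2 * (g * (g * y))) ∨
      t ≤ 2 ^ 97 * b ^ 49 * g ^ 3 * (g * y) + 1 ∨ t' ≤ 2 ^ 97 * b ^ 49 * g ^ 3 * (g * y) + 1 := by
  obtain ⟨A, hA0, hA, hlogA⟩ := abs_log_prefixValue_sub_le hk ha hn hc ht hptc h
  obtain ⟨B, hB0, hB, hlogB⟩ := abs_log_prefixValue_sub_le hl ha' hn' hc' ht' hptc' h'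
  have hkc : 2 ≤ k ^ c := hk.trans (Nat.le_self_pow hc.ne' k)
  have hlc : 2 ≤ l ^ c' := hl.trans (Nat.le_self_pow hc'.ne' l)
  have hpow : ∀ {x : ℕ}, x ≤ 2 ^ g → ∀ e, x ^ e ≤ 2 ^ (g * e) := fun hx e => by
    rw [pow_mul]; exact Nat.pow_le_pow_left hx e
  have hAh : A * (l ^ c' - 1) ≤ 2 ^ (g * y) := by
    calc A * (l ^ c' - 1) ≤ 2 ^ (g * (p + c)) * 2 ^ (g * c') :=
          Nat.mul_le_mul (hA.le.trans (hpow hkg _)) ((Nat.sub_le _ _).trans (hpow hlg _))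
      _ = 2 ^ (g * (p + c + c')) := by rw [← pow_add, ← mul_add]
      _ ≤ _ := Nat.pow_le_pow_right (by norm_num) (Nat.mul_le_mul_left _ (by omega))
  have hBh : B * (k ^ c - 1) ≤ 2 ^ (g * y) := by
    calc B * (k ^ c - 1) ≤ 2 ^ (g * (q + c')) * 2 ^ (g * c) :=
          Nat.mul_le_mul (hB.le.trans (hpow hlg _)) ((Nat.sub_le _ _).trans (hpow hkg _))
      _ = 2 ^ (g * (q + c' + c)) := by rw [← pow_add, ← mul_add]
      _ ≤ _ := Nat.pow_le_pow_right (by norm_num) (Nat.mul_le_mul_left _ (by omega))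
  rcases log_form_dichotomy (m := n - p) (r := n' - q) hk hl hkl hkg hlg
    (Nat.le_mul_of_pos_right g (by omega : 0 < y))
    (Nat.mul_pos hA0 (by omega)) (Nat.mul_pos hB0 (by omega)) hAh hBh hM hb0
    (by omega) (by omega) hb with h1 | h1
  · exact Or.inl h1
  right
  by_contra! hcon
  obtain ⟨h2, h3⟩ := hcon
  set E := 2 ^ 97 * b ^ 49 * g ^ 3 * (g * y) with hE
  have hsmall : ∀ {t : ℕ}, E + 1 < t → ((1 : ℝ) / 2) ^ t * 2 ^ E ≤ 1 / 4 := by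
    intro t ht
    calc ((1 : ℝ) / 2) ^ t * 2 ^ E ≤ (1 / 2) ^ (E + 2) * 2 ^ E := by
          refine mul_le_mul_of_nonneg_right ?_ (by positivity)
          exact pow_le_pow_of_le_one (by norm_num) (by norm_num) ht
      _ = ((1 : ℝ) / 2 * 2) ^ E * (1 / 2) ^ 2 := by rw [mul_pow]; ring
      _ = 1 / 4 := by norm_num
  have s2 := hsmall h2
  have s3 := hsmall h3
  have hA0' : (A : ℝ) ≠ 0 := by exact_mod_cast hA0.ne'
  have hB0' : (B : ℝ) ≠ 0 := by exact_mod_cast hB0.ne'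
  have hk0' : ((k ^ c - 1 : ℕ) : ℝ) ≠ 0 := by exact_mod_cast (by omega : k ^ c - 1 ≠ 0)
  have hl0' : ((l ^ c' - 1 : ℕ) : ℝ) ≠ 0 := by exact_mod_cast (by omega : l ^ c' - 1 ≠ 0)
  rw [Nat.cast_mul, Nat.cast_mul, Real.log_mul hA0' hl0', Real.log_mul hB0' hk0'] at h1
  rw [heq] at hlogA
  have hΛ : |(n - p : ℕ) * Real.log k - (n' - q : ℕ) * Real.log l +
      (Real.log A + Real.log (l ^ c' - 1 : ℕ) - (Real.log B + Real.log (k ^ c - 1 : ℕ)))| ≤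
      2 * (1 / 2) ^ t + 2 * (1 / 2) ^ t' := by
    rw [abs_le] at hlogA hlogB ⊢
    constructor <;> linarith [hlogA.1, hlogA.2, hlogB.1, hlogB.2]
  have := mul_le_mul_of_nonneg_right hΛ (by positivity : (0 : ℝ) ≤ 2 ^ E)
  linarith

/-- Outside the finitely many positions in `E`, the first `n` terms of `a` are periodic
with period at most `C`. -/
def PiecewisePeriodic (a : ℕ → ℕ) (n C : ℕ) (E : Finset ℕ) : Prop :=
  ∀ p p', p ≤ p' → p' ≤ n → (∀ e ∈ E, p ≤ e → p' ≤ e) →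
    ∃ c, 0 < c ∧ c ≤ C ∧ ∀ j, p ≤ j → j + c < p' → a (j + c) = a j

theorem exists_next_mem (E : Finset ℕ) {p n : ℕ} (hpn : p ≤ n) :
    ∃ p', p ≤ p' ∧ p' ≤ n ∧ (∀ e ∈ E, p ≤ e → p' ≤ e) ∧ (p' = n ∨ p' ∈ E) := by
  classical
  have hex : ∃ x, p ≤ x ∧ (x = n ∨ x ∈ E) := ⟨n, hpn, Or.inl rfl⟩
  exact ⟨Nat.find hex, (Nat.find_spec hex).1, Nat.find_min' hex ⟨hpn, Or.inl rfl⟩,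
    fun e he hpe => Nat.find_min' hex ⟨hpe, Or.inr he⟩, (Nat.find_spec hex).2⟩

theorem card_filter_succ_le_lt {E : Finset ℕ} {p p' : ℕ} (hpp' : p ≤ p') (hp' : p' ∈ E) :
    (E.filter (p' + 1 ≤ ·)).card < (E.filter (p ≤ ·)).card := by
  refine Finset.card_lt_card ⟨fun x hx => ?_, fun h => ?_⟩
  · rw [Finset.mem_filter] at hx ⊢
    exact ⟨hx.1, by omega⟩
  · have := h (Finset.mem_filter.2 ⟨hp', hpp'⟩)
    rw [Finset.mem_filter] at this
    omega

/-- Two piecewise periodic numerals for the same number in multiplicatively independent bases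
cannot both be long. -/
theorem PiecewisePeriodic.length_bound {k l g M b Z C C' n n' : ℕ} {a a' : ℕ → ℕ}
    {E E' : Finset ℕ}
    (hk : 2 ≤ k) (hl : 2 ≤ l) (hkl : MultIndep k l) (hkg : k ≤ 2 ^ g) (hlg : l ≤ 2 ^ g)
    (ha : ∀ j, a j < k) (ha' : ∀ j, a' j < l)
    (hn : k ^ (n - 1) ≤ prefixValue k a n) (hn' : l ^ (n' - 1) ≤ prefixValue l a' n')
    (heq : prefixValue k a n = prefixValue l a' n')
    (hM : 0 < M) (hb0 : 0 < b) (hnM : n ≤ M) (hnM' : n' ≤ M)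
    (hb : 2 ^ 64 * b ^ 31 * M * (g * (n + n' + Z)) ^ 2 * g ^ 4 ≤ 2 ^ b)
    (hZ : C + C' ≤ Z) (hE : ∀ e ∈ E, e < n) (hE' : ∀ e ∈ E', e < n')
    (hper : PiecewisePeriodic a n C E) (hper' : PiecewisePeriodic a' n' C' E') (s : ℕ) :
    ∀ p ≤ n, ∀ q ≤ n', (E.filter (p ≤ ·)).card + (E'.filter (q ≤ ·)).card ≤ s →
      n ≤ (p + q + Z) * (2 ^ 98 * b ^ 49 * g ^ 4) ^ (s + 1) ∨
      n' ≤ (p + q + Z) * (2 ^ 98 * b ^ 49 * g ^ 4) ^ (s + 1) := by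
  have hg : 0 < g := by
    rcases Nat.eq_zero_or_pos g with rfl | hg
    · simp at hkg; omega
    · exact hg
  set Ψ := 2 ^ 98 * b ^ 49 * g ^ 4 with hΨ
  have hbg : 1 ≤ b ^ 49 * g ^ 4 := Nat.pos_of_ne_zero (by positivity)
  have hΨ1 : 1 ≤ Ψ := Nat.pos_of_ne_zero (by positivity)
  have hstep : ∀ {y : ℕ}, 3 * y + 2 ^ 97 * b ^ 49 * g ^ 3 * (g * y) ≤ y * Ψ := by
    intro y
    have h1 : y * 1 ≤ y * (b ^ 49 * g ^ 4) := Nat.mul_le_mul_left _ hbg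
    have h2 : 2 ^ 97 * b ^ 49 * g ^ 3 * (g * y) = 2 ^ 97 * (y * (b ^ 49 * g ^ 4)) := by ring
    have h3 : y * Ψ = 2 ^ 98 * (y * (b ^ 49 * g ^ 4)) := by rw [hΨ]; ring
    omega
  have hgΨ : ∀ {y : ℕ}, y + 2 * (g * (g * y)) ≤ y * Ψ := by
    intro y
    have h1 : y * 1 ≤ y * (b ^ 49 * g ^ 4) := Nat.mul_le_mul_left _ hbg
    have h2 : g * (g * y) ≤ y * (b ^ 49 * g ^ 4) := by
      calc g * (g * y) ≤ g * (g * y) * (b ^ 49 * g ^ 2) :=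
            Nat.le_mul_of_pos_right _ (by positivity)
        _ = _ := by ring
    have h3 : y * Ψ = 2 ^ 98 * (y * (b ^ 49 * g ^ 4)) := by rw [hΨ]; ring
    omega
  induction s using Nat.strong_induction_on with
  | _ s ih =>
  intro p hp q hq hs
  obtain ⟨p', hpp', hpn', hbreak, hp'⟩ := exists_next_mem E hp
  obtain ⟨q', hqq', hqn', hbreak', hq'⟩ := exists_next_mem E' hq
  obtain ⟨c, hc0, hcC, hc⟩ := hper p p' hpp' hpn' hbreak
  obtain ⟨c', hc0', hcC', hc'⟩ := hper' q q' hqq' hqn' hbreak'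
  set y := p + q + Z with hy
  set X := 2 ^ 97 * b ^ 49 * g ^ 3 * (g * y) with hX
  have hyΨ : y * Ψ ≤ y * Ψ ^ (s + 1) :=
    Nat.mul_le_mul_left _ (Nat.le_self_pow (Nat.succ_ne_zero s) Ψ)
  have hs1 := @hstep y
  have hs2 := @hgΨ y
  have hcases : (n - p ≤ 2 * (g * (g * y)) ∧ n' - q ≤ 2 * (g * (g * y))) ∨
      p' ≤ p + c + X + 1 ∨ q' ≤ q + c' + X + 1 := by
    rcases Nat.lt_or_ge (p + c) p' with h1 | h1
    · rcases Nat.lt_or_ge (q + c') q' with h2 | h2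
      · have hb' : 2 ^ 64 * b ^ 31 * M * (g * y) ^ 2 * g ^ 4 ≤ 2 ^ b := by
          refine le_trans ?_ hb
          have : y ≤ n + n' + Z := by omega
          gcongr
        rcases periodic_stretch_bound (t := p' - c - p) (t' := q' - c' - q) hk hl hkl hkg hlg ha ha'
          hn hn' heq hM hb0 hnM hnM' hb' hc0 hc0' (by omega) (by omega) (by omega) (by omega)
          (by omega) (fun j hj => hc (p + j) (by omega) (by omega))
          (fun j hj => hc' (q + j) (by omega) (by omega)) with h | h | h
        · exact Or.inl h
        · right; left; omega
        · right; right; omega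
      · right; right; omega
    · right; left; omega
  rcases hcases with h | h | h
  · left; omega
  · rcases hp' with rfl | hp'
    · left; omega
    · have hlt := card_filter_succ_le_lt hpp' hp'
      have hp'n := hE p' hp'
      have hle : (p' + 1 + q + Z) * Ψ ^ (s - 1 + 1) ≤ y * Ψ ^ (s + 1) := by
        rw [show s - 1 + 1 = s by omega, pow_succ', ← mul_assoc]
        exact Nat.mul_le_mul_right _ (by omega)
      exact (ih (s - 1) (by omega) (p' + 1) (by omega) q hq (by omega)).imp
        (·.trans hle) (·.trans hle)
  · rcases hq' with rfl | hq'
    · right; omega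
    · have hlt := card_filter_succ_le_lt hqq' hq'
      have hq'n := hE' q' hq'
      have hle : (p + (q' + 1) + Z) * Ψ ^ (s - 1 + 1) ≤ y * Ψ ^ (s + 1) := by
        rw [show s - 1 + 1 = s by omega, pow_succ', ← mul_assoc]
        exact Nat.mul_le_mul_right _ (by omega)
      exact (ih (s - 1) (by omega) p hp (q' + 1) (by omega) (by omega)).imp
        (·.trans hle) (·.trans hle)

theorem pow_le_pow_self_mul_four_pow (x F : ℕ) : x ^ F ≤ F ^ F * 4 ^ x := by
  have h1 := Real.pow_div_factorial_le_exp (x : ℝ) (Nat.cast_nonneg x) F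
  have h2 : Real.exp x ≤ 4 ^ x := by
    rw [← Real.exp_one_pow]
    exact pow_le_pow_left₀ (Real.exp_pos 1).le (by linarith [Real.exp_one_lt_d9]) x
  rw [div_le_iff₀ (by positivity)] at h1
  have h3 : ((F.factorial : ℕ) : ℝ) ≤ (F : ℝ) ^ F := by exact_mod_cast Nat.factorial_le_pow F
  have h4 : (x : ℝ) ^ F ≤ F ^ F * 4 ^ x := by
    calc (x : ℝ) ^ F ≤ Real.exp x * F.factorial := h1
      _ ≤ 4 ^ x * F ^ F := by gcongr
      _ = _ := mul_comm _ _
  exact_mod_cast h4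

set_option exponentiation.threshold 2000 in
theorem parameter_large {g Z β M n n' x : ℕ} (hZ : 4 ≤ Z) (hx : x = β + g + Z) (hM : M < 2 ^ β)
    (hn : n ≤ M) (hn' : n' ≤ M) :
    2 ^ 64 * (2 ^ 8 * x) ^ 31 * M * (g * (n + n' + Z)) ^ 2 * g ^ 4 ≤ 2 ^ (2 ^ 8 * x) := by
  have hx2 : x ≤ 2 ^ x := Nat.lt_two_pow_self.le
  have hMx : M ≤ 2 ^ x := hM.le.trans (Nat.pow_le_pow_right (by norm_num) (by omega))
  have hgx : g ≤ 2 ^ x := (by omega : g ≤ x).trans hx2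
  have hsum : n + n' + Z ≤ 2 ^ 2 * 2 ^ x := by omega
  calc 2 ^ 64 * (2 ^ 8 * x) ^ 31 * M * (g * (n + n' + Z)) ^ 2 * g ^ 4
      ≤ 2 ^ 64 * (2 ^ 8 * 2 ^ x) ^ 31 * 2 ^ x * (2 ^ x * (2 ^ 2 * 2 ^ x)) ^ 2 * (2 ^ x) ^ 4 := by
        gcongr
    _ = 2 ^ (316 + 40 * x) := by
        rw [pow_add, mul_comm 40 x, pow_mul]
        ring
    _ ≤ _ := Nat.pow_le_pow_right (by norm_num) (by omega)

theorem parameter_small {g Z β M x : ℕ} (hg : 1 ≤ g) (hZ : 4 ≤ Z) (hx : x = β + g + Z)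
    (hM : 2 ^ β ≤ 2 * M)
    (hle : M ≤ g * Z * (2 ^ 98 * (2 ^ 8 * x) ^ 49 * g ^ 4) ^ (Z - 1)) :
    2 ^ 8 * x ≤ 2 ^ 20 * Z ^ 2 * g := by
  have hx1 : 1 ≤ x := by omega
  have h1 : 2 ^ β ≤ 2 ^ (1 + g + 491 * Z + 4 * g * Z) * x ^ (49 * Z) := by
    calc 2 ^ β ≤ 2 * (g * Z * (2 ^ 98 * (2 ^ 8 * x) ^ 49 * g ^ 4) ^ (Z - 1)) :=
          hM.trans (Nat.mul_le_mul_left _ hle)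
      _ ≤ 2 * (2 ^ g * 2 ^ Z * (2 ^ 98 * (2 ^ 8 * x) ^ 49 * (2 ^ g) ^ 4) ^ Z) := by
          have h1 : g ≤ 2 ^ g := Nat.lt_two_pow_self.le
          have h2 : Z ≤ 2 ^ Z := Nat.lt_two_pow_self.le
          gcongr
          · exact Nat.pos_of_ne_zero (by positivity)
          · exact Nat.sub_le _ _
      _ = _ := by
          rw [mul_pow, mul_pow, mul_pow, mul_pow]
          simp only [← pow_mul]
          rw [pow_add, pow_add, pow_add, show 491 * Z = Z + 98 * Z + 8 * 49 * Z by ring, pow_add,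
            pow_add, show g * 4 * Z = 4 * g * Z by ring]
          ring
  have h2 : 2 ^ (4 * β) ≤ 2 ^ (4 * (1 + g + 491 * Z + 4 * g * Z) +
      ((8 + Z) * (196 * Z) + 2 * x)) := by
    calc 2 ^ (4 * β) = (2 ^ β) ^ 4 := by rw [← pow_mul, mul_comm]
      _ ≤ (2 ^ (1 + g + 491 * Z + 4 * g * Z) * x ^ (49 * Z)) ^ 4 := Nat.pow_le_pow_left h1 4
      _ = 2 ^ (4 * (1 + g + 491 * Z + 4 * g * Z)) * x ^ (196 * Z) := by
          rw [mul_pow, ← pow_mul, ← pow_mul]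
          congr 2 <;> ring
      _ ≤ 2 ^ (4 * (1 + g + 491 * Z + 4 * g * Z)) * ((2 ^ (8 + Z)) ^ (196 * Z) * 2 ^ (2 * x)) := by
          refine Nat.mul_le_mul_left _ ((pow_le_pow_self_mul_four_pow x (196 * Z)).trans ?_)
          have h3 : 196 * Z ≤ 2 ^ (8 + Z) := by
            have : Z < 2 ^ Z := Nat.lt_two_pow_self
            rw [pow_add]
            omega
          have h4 : 4 ^ x = 2 ^ (2 * x) := by rw [pow_mul]; norm_num
          rw [h4]
          exact Nat.mul_le_mul_right _ (Nat.pow_le_pow_left h3 _)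
      _ = _ := by rw [← pow_mul, ← pow_add, ← pow_add]
  have h3 := (Nat.pow_le_pow_iff_right (by norm_num : 1 < 2)).1 h2
  have h5 : 4 * Z ≤ Z ^ 2 := by nlinarith
  have h6 : Z ^ 2 ≤ Z ^ 2 * g := Nat.le_mul_of_pos_right _ hg
  have h7 : 4 * (g * Z) ≤ Z ^ 2 * g := by nlinarith
  have h8 : 4 * g ≤ g * Z := by nlinarith
  have h9 : (8 + Z) * (196 * Z) = 1568 * Z + 196 * Z ^ 2 := by ring
  have h10 : 4 * g * Z = 4 * (g * Z) := by ring
  have h11 : 2 ^ 20 * Z ^ 2 * g = 2 ^ 20 * (Z ^ 2 * g) := by ring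
  omega

set_option exponentiation.threshold 2000 in
theorem count_bound {g l d m m' Z : ℕ} (hg : 1 ≤ g) (hl : 2 ^ (g - 1) ≤ l) (hd : 2 ≤ d)
    (hm : 2 ≤ m) (hm' : 2 ≤ m') (hZ : Z = m + m') :
    (g * Z * (2 ^ 98 * (2 ^ 20 * Z ^ 2 * g) ^ 49 * g ^ 4) ^ (Z - 1) + 1) ^ (m + 1) ≤
      l ^ (d * m') * (8 * (Z - 1)) ^ (10 * d * Z ^ 5) := by
  have hZ4 : 4 ≤ Z := by omega
  have hl0 : 0 < l := lt_of_lt_of_le (by positivity) hl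
  have hZ2 : Z ≤ 2 ^ Z := Nat.lt_two_pow_self.le
  set L := g * Z * (2 ^ 98 * (2 ^ 20 * Z ^ 2 * g) ^ 49 * g ^ 4) ^ (Z - 1) with hL
  have h1 : L + 1 ≤ 2 ^ (1 + 1079 * Z + 98 * Z ^ 2) * g ^ (53 * Z) := by
    have hL1 : 1 ≤ L := Nat.pos_of_ne_zero (by positivity)
    calc L + 1 ≤ 2 * L := by omega
      _ ≤ 2 * (g * 2 ^ Z * (2 ^ 98 * (2 ^ 20 * (2 ^ Z) ^ 2 * g) ^ 49 * g ^ 4) ^ (Z - 1)) := by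
          rw [hL]
          gcongr
      _ ≤ 2 * (g * 2 ^ Z * (2 ^ (1078 + 98 * Z) * g ^ 53) ^ (Z - 1)) := by
          refine le_of_eq ?_
          congr 3
          rw [pow_add, mul_comm 98 Z, pow_mul 2 Z]
          ring
      _ = 2 ^ (1 + Z + (1078 + 98 * Z) * (Z - 1)) * g ^ (1 + 53 * (Z - 1)) := by
          rw [mul_pow, ← pow_mul, ← pow_mul]
          generalize (1078 + 98 * Z) * (Z - 1) = e
          ring
      _ ≤ _ := by
          obtain ⟨z, rfl⟩ := Nat.exists_eq_add_of_le' (by omega : 1 ≤ Z)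
          rw [Nat.add_sub_cancel]
          refine Nat.mul_le_mul (Nat.pow_le_pow_right (by norm_num) ?_)
            (Nat.pow_le_pow_right hg (by omega))
          nlinarith
  have h2 : g ^ (53 * Z ^ 2) ≤ 2 ^ ((6 + 2 * Z) * (53 * Z ^ 2)) * 4 ^ g := by
    refine (pow_le_pow_self_mul_four_pow g _).trans (Nat.mul_le_mul_right _ ?_)
    rw [pow_mul 2]
    refine Nat.pow_le_pow_left ?_ _
    calc 53 * Z ^ 2 ≤ 2 ^ 6 * (2 ^ Z) ^ 2 := by gcongr; norm_num
      _ = _ := by rw [pow_add, mul_comm 2 Z, pow_mul 2 Z]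
  have h3 : 4 ^ g ≤ 2 ^ 2 * l ^ (d * m') := by
    calc 4 ^ g = 2 ^ (2 * g) := by rw [pow_mul]; norm_num
      _ ≤ 2 ^ (2 + (g - 1) * 4) := Nat.pow_le_pow_right (by norm_num) (by omega)
      _ = 2 ^ 2 * (2 ^ (g - 1)) ^ 4 := by rw [pow_add, pow_mul]
      _ ≤ 2 ^ 2 * l ^ 4 := by gcongr
      _ ≤ 2 ^ 2 * l ^ (d * m') :=
          Nat.mul_le_mul_left _ (Nat.pow_le_pow_right hl0 (by nlinarith))
  calc (L + 1) ^ (m + 1) ≤ (L + 1) ^ Z := Nat.pow_le_pow_right (Nat.succ_pos _) (by omega)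
    _ ≤ (2 ^ (1 + 1079 * Z + 98 * Z ^ 2) * g ^ (53 * Z)) ^ Z := Nat.pow_le_pow_left h1 _
    _ = 2 ^ ((1 + 1079 * Z + 98 * Z ^ 2) * Z) * g ^ (53 * Z ^ 2) := by
        rw [mul_pow, ← pow_mul, ← pow_mul]
        congr 2; ring
    _ ≤ 2 ^ ((1 + 1079 * Z + 98 * Z ^ 2) * Z) *
          (2 ^ ((6 + 2 * Z) * (53 * Z ^ 2)) * (2 ^ 2 * l ^ (d * m'))) :=
        Nat.mul_le_mul_left _ (h2.trans (Nat.mul_le_mul_left _ h3))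
    _ = l ^ (d * m') * 2 ^ ((1 + 1079 * Z + 98 * Z ^ 2) * Z + (6 + 2 * Z) * (53 * Z ^ 2) + 2) := by
        rw [pow_add, pow_add]; ring
    _ ≤ l ^ (d * m') * 2 ^ (4 * (10 * 2 * Z ^ 5)) := by
        refine Nat.mul_le_mul_left _ (Nat.pow_le_pow_right (by norm_num) ?_)
        obtain ⟨z, rfl⟩ := Nat.exists_eq_add_of_le' hZ4
        ring_nf
        nlinarith [Nat.zero_le (z ^ 4), Nat.zero_le (z ^ 5), Nat.zero_le (z ^ 3),
          Nat.zero_le (z ^ 2), Nat.zero_le z]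
    _ ≤ _ := by
        rw [pow_mul 2]
        refine Nat.mul_le_mul_left _ ?_
        calc (2 ^ 4) ^ (10 * 2 * Z ^ 5) ≤ (8 * (Z - 1)) ^ (10 * 2 * Z ^ 5) :=
              Nat.pow_le_pow_left (by omega) _
          _ ≤ _ := Nat.pow_le_pow_right (by omega) (by gcongr)

/-- The explicit bound for the number of digits. -/
theorem PiecewisePeriodic.length_le {k l g Z C C' n n' : ℕ} {a a' : ℕ → ℕ} {E E' : Finset ℕ}
    (hk : 2 ≤ k) (hl : 2 ≤ l) (hkl : MultIndep k l) (hkg : k ≤ 2 ^ g) (hlg : l ≤ 2 ^ g)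
    (ha : ∀ j, a j < k) (ha' : ∀ j, a' j < l)
    (hn : k ^ (n - 1) ≤ prefixValue k a n) (hn' : l ^ (n' - 1) ≤ prefixValue l a' n')
    (heq : prefixValue k a n = prefixValue l a' n')
    (hZ4 : 4 ≤ Z) (hZ : C + C' ≤ Z) (hE : ∀ e ∈ E, e < n) (hE' : ∀ e ∈ E', e < n')
    (hcard : E.card + E'.card + 2 ≤ Z)
    (hper : PiecewisePeriodic a n C E) (hper' : PiecewisePeriodic a' n' C' E') :
    n ≤ g * Z * (2 ^ 98 * (2 ^ 20 * Z ^ 2 * g) ^ 49 * g ^ 4) ^ (Z - 1) ∧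
      n' ≤ g * Z * (2 ^ 98 * (2 ^ 20 * Z ^ 2 * g) ^ 49 * g ^ 4) ^ (Z - 1) := by
  have hg : 1 ≤ g := by
    rcases Nat.eq_zero_or_pos g with rfl | hg
    · simp at hkg; omega
    · exact hg
  obtain ⟨M, hMdef⟩ : ∃ M, M = max n n' := ⟨_, rfl⟩
  have hnM : n ≤ M := hMdef ▸ le_max_left _ _
  have hnM' : n' ≤ M := hMdef ▸ le_max_right _ _
  rcases Nat.eq_zero_or_pos M with h0 | hM
  · have : n = 0 ∧ n' = 0 := by omega
    simp [this]
  obtain ⟨x, hx⟩ : ∃ x, x = M.size + g + Z := ⟨_, rfl⟩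
  have hb := parameter_large hZ4 hx (Nat.lt_size_self M) hnM hnM'
  have hlen := PiecewisePeriodic.length_bound hk hl hkl hkg hlg ha ha' hn hn' heq hM
    (by omega : 0 < 2 ^ 8 * x) hnM hnM' hb hZ hE hE' hper hper' (Z - 2) 0 (Nat.zero_le _) 0
    (Nat.zero_le _) (by
      have h1 := Finset.card_filter_le E (0 ≤ ·)
      have h2 := Finset.card_filter_le E' (0 ≤ ·)
      omega)
  rw [show Z - 2 + 1 = Z - 1 by omega, zero_add, zero_add] at hlen
  have hconv : ∀ {k l n n' : ℕ} {a a' : ℕ → ℕ}, 2 ≤ l → k ≤ 2 ^ g → (∀ j, a j < k) →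
      l ^ (n' - 1) ≤ prefixValue l a' n' → prefixValue k a n = prefixValue l a' n' →
      n' ≤ g * n := by
    intro k l n n' a a' hl hkg ha hn' heq
    have h1 : 2 ^ (n' - 1) < 2 ^ (g * n) := by
      calc 2 ^ (n' - 1) ≤ l ^ (n' - 1) := Nat.pow_le_pow_left hl _
        _ ≤ prefixValue k a n := hn'.trans heq.ge
        _ < k ^ n := prefixValue.lt_pow ha n
        _ ≤ (2 ^ g) ^ n := Nat.pow_le_pow_left hkg n
        _ = _ := (pow_mul _ _ _).symm
    have := (Nat.pow_lt_pow_iff_right (by norm_num : 1 < 2)).1 h1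
    omega
  have hMle : M ≤ g * Z * (2 ^ 98 * (2 ^ 8 * x) ^ 49 * g ^ 4) ^ (Z - 1) := by
    rw [mul_assoc]
    set T := Z * (2 ^ 98 * (2 ^ 8 * x) ^ 49 * g ^ 4) ^ (Z - 1) with hT
    have hTg : T ≤ g * T := Nat.le_mul_of_pos_left _ hg
    rw [hMdef]
    rcases hlen with h | h
    · exact max_le (h.trans hTg) ((hconv hl hkg ha hn' heq).trans (Nat.mul_le_mul_left _ h))
    · exact max_le ((hconv hk hlg ha' hn heq.symm).trans (Nat.mul_le_mul_left _ h)) (h.trans hTg)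
  have hsize : 2 ^ M.size ≤ 2 * M := by
    have h1 : 0 < M.size := Nat.size_pos.2 hM
    have h2 : 2 ^ (M.size - 1) ≤ M := Nat.lt_size.1 (by omega)
    calc 2 ^ M.size = 2 * 2 ^ (M.size - 1) := by rw [← pow_succ']; congr 1; omega
      _ ≤ _ := Nat.mul_le_mul_left _ h2
  have hxle := parameter_small hg hZ4 hx hsize hMle
  have hfin : M ≤ g * Z * (2 ^ 98 * (2 ^ 20 * Z ^ 2 * g) ^ 49 * g ^ 4) ^ (Z - 1) := by
    refine hMle.trans ?_
    gcongr
  exact ⟨hnM.trans hfin, hnM'.trans hfin⟩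

open Filter Topology in
theorem exists_mul_pow_lt_two_pow (K C e : ℕ) (T : ℕ) :
    ∃ t ≥ T, C * (K * (t + 1)) ^ e < 2 ^ t := by
  have h1 := (tendsto_pow_const_div_const_pow_of_one_lt e (one_lt_two (α := ℝ))).const_mul
    ((C * K ^ e : ℕ) : ℝ)
  rw [mul_zero] at h1
  have h2 := h1.comp (tendsto_add_atTop_nat 1)
  obtain ⟨t, ht, htT⟩ := ((h2.eventually (gt_mem_nhds (by norm_num : (0 : ℝ) < 1 / 2))).and
    (eventually_ge_atTop T)).exists
  refine ⟨t, htT, ?_⟩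
  simp only [Function.comp_apply] at ht
  rw [mul_div_assoc', div_lt_iff₀ (by positivity)] at ht
  have h3 : ((C * (K * (t + 1)) ^ e : ℕ) : ℝ) < (2 ^ t : ℕ) := by
    push_cast at ht ⊢
    rw [pow_succ] at ht
    rw [mul_pow]
    linarith
  exact_mod_cast h3

theorem List.length_flatMap_of_length_eq {α β : Type*} {f : α → List β} {m : ℕ}
    (hf : ∀ b, (f b).length = m) : ∀ u : List α, (u.flatMap f).length = u.length * m
  | [] => by simp
  | b :: u => by
    rw [List.flatMap_cons, List.length_append, hf, List.length_flatMap_of_length_eq hf u,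
      List.length_cons]
    ring

theorem List.flatMap_injOn_length {α : Type*} {f : Bool → List α} {m : ℕ}
    (hf : ∀ b, (f b).length = m) (hne : f true ≠ f false) :
    ∀ {u v : List Bool}, u.length = v.length → u.flatMap f = v.flatMap f → u = v
  | [], [], _, _ => rfl
  | b :: u, c :: v, hlen, h => by
    rw [List.flatMap_cons, List.flatMap_cons] at h
    obtain ⟨h1, h2⟩ := List.append_inj h (by rw [hf, hf])
    have hbc : b = c := by
      cases b <;> cases c <;> first | rfl | exact absurd h1 hne | exact absurd h1.symm hne
    rw [hbc, List.flatMap_injOn_length hf hne (by simpa using hlen) h2]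

namespace DFA

variable {α σ : Type*} (M : DFA α σ)

/-- Some word leads from the state `s` to the state `t`. -/
def Reaches (s t : σ) : Prop := ∃ x, M.evalFrom s x = t

/-- A state lying on an accepting path. -/
def Useful (s : σ) : Prop := M.Reaches M.start s ∧ ∃ t ∈ M.accept, M.Reaches s t

variable {M}

theorem Reaches.refl (s : σ) : M.Reaches s s := ⟨[], rfl⟩

theorem Reaches.trans {s t u : σ} (h : M.Reaches s t) (h' : M.Reaches t u) : M.Reaches s u := by
  obtain ⟨x, rfl⟩ := h
  obtain ⟨y, rfl⟩ := h'
  exact ⟨x ++ y, M.evalFrom_of_append _ _ _⟩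

theorem Reaches.step (s : σ) (a : α) : M.Reaches s (M.step s a) := ⟨[a], rfl⟩

theorem evalFrom_flatMap {s : σ} {f : Bool → List α} (hf : ∀ b, M.evalFrom s (f b) = s) :
    ∀ u : List Bool, M.evalFrom s (u.flatMap f) = s
  | [] => rfl
  | b :: u => by
    rw [List.flatMap_cons, M.evalFrom_of_append, hf, evalFrom_flatMap hf u]

/-- Two different loops of the same length at a useful state are incompatible with sparseness. -/
theorem not_isSparseLang_of_two_loops [Finite α] {s : σ} (hs : M.Useful s) {f : Bool → List α}
    {m : ℕ} (hm : ∀ b, (f b).length = m) (hne : f true ≠ f false)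
    (hf : ∀ b, M.evalFrom s (f b) = s) : ¬ IsSparseLang M.accepts := by
  rintro ⟨e, C, N, hC⟩
  obtain ⟨⟨x, hx⟩, t, ht, y, hy⟩ := hs
  obtain ⟨T, hTN, hT⟩ := exists_mul_pow_lt_two_pow (x.length + m + y.length + 1) C e N
  set n := (x.length + m + y.length + 1) * (T + 1) with hn
  have hnN : N ≤ n := hTN.trans (by rw [hn]; nlinarith)
  have hfin : {w ∈ M.accepts | w.length ≤ n}.Finite :=
    (List.finite_length_le α n).subset fun w hw => hw.2
  let F : (Fin T → Bool) → List α := fun u => x ++ (List.ofFn u).flatMap f ++ y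
  have hF : Function.Injective F := by
    intro u v h
    have h1 := List.append_cancel_left (List.append_cancel_right h)
    exact List.ofFn_injective (List.flatMap_injOn_length hm hne (by simp) h1)
  have hsub : Set.range F ⊆ {w ∈ M.accepts | w.length ≤ n} := by
    rintro _ ⟨u, rfl⟩
    refine ⟨?_, ?_⟩
    · change M.evalFrom M.start (x ++ (List.ofFn u).flatMap f ++ y) ∈ M.accept
      rw [M.evalFrom_of_append, M.evalFrom_of_append, hx, evalFrom_flatMap hf, hy]
      exact ht
    · have : ((List.ofFn u).flatMap f).length = T * m := by
        rw [List.length_flatMap_of_length_eq hm, List.length_ofFn]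
      simp only [F, List.length_append, this, hn]
      nlinarith
  have h1 := Set.ncard_le_ncard hsub hfin
  rw [Set.ncard_range_of_injective hF, Nat.card_eq_fintype_card] at h1
  simp only [Fintype.card_fun, Fintype.card_bool, Fintype.card_fin] at h1
  exact absurd (h1.trans (hC n hnN)) (not_le.2 hT)

/-- In an automaton with a sparse language, at most one letter returns to a given useful state. -/
theorem return_letter_unique [Finite α] (hM : IsSparseLang M.accepts) {s : σ} (hs : M.Useful s)
    {a b : α} (ha : M.Reaches (M.step s a) s) (hb : M.Reaches (M.step s b) s) : a = b := by
  by_contra hab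
  obtain ⟨u, hu⟩ := ha
  obtain ⟨v, hv⟩ := hb
  have h1 : M.evalFrom s (a :: u) = s := hu
  have h2 : M.evalFrom s (b :: v) = s := hv
  refine not_isSparseLang_of_two_loops hs
    (f := fun c => if c then (a :: u) ++ (b :: v) else (b :: v) ++ (a :: u))
    (m := u.length + v.length + 2) ?_ ?_ ?_ hM
  · intro c
    cases c <;> simp <;> omega
  · simp [hab]
  · intro c
    cases c
    · simp only [Bool.false_eq_true, if_false]; rw [M.evalFrom_of_append, h2, h1]
    · simp only [if_true]; rw [M.evalFrom_of_append, h1, h2]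

theorem one_lt_card_of_isSparseLang [Finite α] [Nontrivial α] [Fintype σ]
    (hM : IsSparseLang M.accepts) {w : List α} (hw : w ∈ M.accepts) : 1 < Fintype.card σ := by
  by_contra h
  have hsub : Subsingleton σ := Fintype.card_le_one_iff_subsingleton.1 (not_lt.1 h)
  obtain ⟨a, b, hab⟩ := exists_pair_ne α
  refine hab (return_letter_unique hM (s := M.start) ⟨Reaches.refl _, _, hw, w, rfl⟩ ?_ ?_) <;>
    exact ⟨[], Subsingleton.elim _ _⟩

variable (M) in
/-- The state after reading the first `i` letters of `w`. -/
def stateAt (w : List α) (i : ℕ) : σ := M.eval (w.take i)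

theorem stateAt_succ {w : List α} {i : ℕ} {a : α} (h : w[i]? = some a) :
    M.stateAt w (i + 1) = M.step (M.stateAt w i) a := by
  rw [stateAt, stateAt, List.take_add_one, h, Option.toList_some, M.eval_append_singleton]

theorem reaches_stateAt (w : List α) {i j : ℕ} (hij : i ≤ j) :
    M.Reaches (M.stateAt w i) (M.stateAt w j) := by
  obtain ⟨t, rfl⟩ := Nat.exists_eq_add_of_le hij
  rw [stateAt, stateAt, List.take_add]
  exact ⟨_, (M.evalFrom_of_append _ _ _).symm⟩

theorem useful_stateAt {w : List α} (hw : w ∈ M.accepts) (i : ℕ) : M.Useful (M.stateAt w i) := by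
  refine ⟨⟨_, rfl⟩, M.eval w, hw, w.drop i, ?_⟩
  change M.evalFrom (M.evalFrom M.start (w.take i)) (w.drop i) = M.evalFrom M.start w
  rw [← M.evalFrom_of_append, List.take_append_drop]

open Classical in
variable (M) in
/-- The positions of `w` at which the run leaves a strongly connected component. -/
noncomputable def exits (w : List α) : Finset ℕ :=
  (Finset.range w.length).filter fun i => ¬ M.Reaches (M.stateAt w (i + 1)) (M.stateAt w i)

theorem mem_exits {w : List α} {i : ℕ} :
    i ∈ M.exits w ↔ i < w.length ∧ ¬ M.Reaches (M.stateAt w (i + 1)) (M.stateAt w i) := by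
  simp only [exits, Finset.mem_filter, Finset.mem_range]

theorem stateAt_ne_of_mem_exits {w : List α} {i j : ℕ} (hi : i ∈ M.exits w) (hij : i < j) :
    M.stateAt w i ≠ M.stateAt w j := by
  intro h
  refine (mem_exits.1 hi).2 ?_
  rw [h]
  exact reaches_stateAt w hij

theorem eq_of_mem_exits {w : List α} {i j : ℕ} (hi : i ∈ M.exits w) (hj : j ∈ M.exits w)
    (h : M.stateAt w i = M.stateAt w j) : i = j := by
  rcases lt_trichotomy i j with h1 | h1 | h1
  · exact absurd h (stateAt_ne_of_mem_exits hi h1)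
  · exact h1
  · exact absurd h.symm (stateAt_ne_of_mem_exits hj h1)

theorem card_exits_lt [Fintype σ] (w : List α) : (M.exits w).card < Fintype.card σ := by
  have h1 : (insert w.length (M.exits w)).card = (M.exits w).card + 1 :=
    Finset.card_insert_of_notMem fun h => lt_irrefl _ (mem_exits.1 h).1
  rw [← Nat.succ_le_iff, Nat.succ_eq_add_one, ← h1]
  refine Finset.card_le_card_of_injOn (M.stateAt w) (fun _ _ => Finset.mem_univ _) ?_
  intro i hi j hj h
  simp only [Finset.coe_insert, Set.mem_insert_iff, Finset.mem_coe] at hi hj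
  rcases hi with rfl | hi <;> rcases hj with rfl | hj
  · rfl
  · exact absurd h.symm (stateAt_ne_of_mem_exits hj (mem_exits.1 hj).1)
  · exact absurd h (stateAt_ne_of_mem_exits hi (mem_exits.1 hi).1)
  · exact eq_of_mem_exits hi hj h

open Classical in
variable (M) in
/-- The state following `s` within its strongly connected component. -/
noncomputable def nextState (s : σ) : σ :=
  if h : ∃ a, M.Reaches (M.step s a) s then M.step s h.choose else s

theorem nextState_eq [Finite α] (hM : IsSparseLang M.accepts) {s : σ} (hs : M.Useful s) {a : α}
    (ha : M.Reaches (M.step s a) s) : M.nextState s = M.step s a := by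
  have h : ∃ a, M.Reaches (M.step s a) s := ⟨a, ha⟩
  rw [nextState, dif_pos h, return_letter_unique hM hs h.choose_spec ha]

theorem iterate_nextState [Finite α] (hM : IsSparseLang M.accepts) {s : σ} (hs : M.Useful s) :
    ∀ (x : List α) (t : σ), M.Reaches s t → M.evalFrom t x = s → M.nextState^[x.length] t = s
  | [], _, _, h => h
  | a :: x, t, hst, h => by
    have h' : M.evalFrom (M.step t a) x = s := h
    have ht : M.Useful t := ⟨hs.1.trans hst, by
      obtain ⟨u, hu, hsu⟩ := hs.2
      exact ⟨u, hu, Reaches.trans ⟨_, h⟩ hsu⟩⟩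
    rw [List.length_cons, Function.iterate_succ_apply,
      nextState_eq hM ht (Reaches.trans ⟨_, h'⟩ hst)]
    exact iterate_nextState hM hs x _ (hst.trans (Reaches.step t a)) h'

/-- Between consecutive exits an accepted word is periodic. -/
theorem exists_period [Finite α] [Fintype σ] (hM : IsSparseLang M.accepts) {w : List α}
    (hw : w ∈ M.accepts) {p p' : ℕ} (hpp' : p ≤ p') (hp' : p' ≤ w.length)
    (hex : ∀ e ∈ M.exits w, p ≤ e → p' ≤ e) :
    ∃ c, 0 < c ∧ c ≤ Fintype.card σ ∧ ∀ j, p ≤ j → j + c < p' → w[j + c]? = w[j]? := by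
  rcases hpp'.eq_or_lt with rfl | hlt
  · exact ⟨1, one_pos, Fintype.card_pos_iff.2 ⟨M.start⟩, fun j h1 h2 => by omega⟩
  have hret : ∀ j, p ≤ j → j < p' → M.Reaches (M.stateAt w (j + 1)) (M.stateAt w j) := by
    intro j h1 h2
    by_contra h3
    have := hex j (mem_exits.2 ⟨by omega, h3⟩) h1
    omega
  have hget : ∀ j, j < p' → ∃ a, w[j]? = some a := fun j hj =>
    ⟨_, List.getElem?_eq_getElem (by omega : j < w.length)⟩
  have hnext : ∀ j, p ≤ j → j < p' → M.nextState (M.stateAt w j) = M.stateAt w (j + 1) := by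
    intro j h1 h2
    obtain ⟨a, ha⟩ := hget j h2
    have := hret j h1 h2
    rw [stateAt_succ ha] at this ⊢
    exact nextState_eq hM (useful_stateAt hw j) this
  have hiter : ∀ t, p + t ≤ p' → M.stateAt w (p + t) = M.nextState^[t] (M.stateAt w p) := by
    intro t
    induction t with
    | zero => intro _; rfl
    | succ t ih =>
      intro h
      rw [Function.iterate_succ_apply', ← ih (by omega), hnext _ (by omega) (by omega)]
      rfl
  obtain ⟨v, hv⟩ := hret p le_rfl hlt
  have hper : Function.IsPeriodicPt M.nextState (v.length + 1) (M.stateAt w p) := by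
    change M.nextState^[v.length + 1] (M.stateAt w p) = M.stateAt w p
    rw [Function.iterate_succ_apply, hnext p le_rfl hlt]
    exact iterate_nextState hM (useful_stateAt hw p) v _ (reaches_stateAt w (Nat.le_succ p)) hv
  refine ⟨Function.minimalPeriod M.nextState (M.stateAt w p),
    hper.minimalPeriod_pos (Nat.succ_pos _), ?_, ?_⟩
  · have := Finset.card_le_card_of_injOn (s := Finset.range
      (Function.minimalPeriod M.nextState (M.stateAt w p))) (t := Finset.univ)
      (fun t => M.nextState^[t] (M.stateAt w p)) (fun _ _ => Finset.mem_univ _)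
      (by
        rw [Finset.coe_range]
        exact Function.iterate_injOn_Iio_minimalPeriod)
    rwa [Finset.card_range, Finset.card_univ] at this
  · intro j hj hjc
    set c := Function.minimalPeriod M.nextState (M.stateAt w p)
    have hstate : M.stateAt w (j + c) = M.stateAt w j := by
      obtain ⟨t, rfl⟩ := Nat.exists_eq_add_of_le hj
      rw [add_assoc, hiter _ (by omega), hiter _ (by omega), Function.iterate_add_apply,
        Function.iterate_minimalPeriod]
    obtain ⟨a, ha⟩ := hget j (by omega)
    obtain ⟨b, hb⟩ := hget (j + c) hjc
    have h1 := hret j hj (by omega)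
    have h2 := hret (j + c) (by omega) hjc
    rw [stateAt_succ ha] at h1
    rw [stateAt_succ hb, hstate] at h2
    rw [ha, hb, return_letter_unique hM (useful_stateAt hw j) h1 h2]

open Classical in
variable (M) in
/-- For every state left by the run on `w`, the position and the letter of the exit. -/
noncomputable def exitData (w : List α) {n : ℕ} (hn : w.length ≤ n) (s : σ) :
    Option (Fin n × α) :=
  if h : ∃ i, i ∈ M.exits w ∧ M.stateAt w i = s then
    some (⟨h.choose, (mem_exits.1 h.choose_spec.1).1.trans_le hn⟩,
      w[h.choose]'(mem_exits.1 h.choose_spec.1).1)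
  else none

theorem exitData_eq_some {w : List α} {n : ℕ} (hn : w.length ≤ n) {s : σ} {i : Fin n} {a : α} :
    M.exitData w hn s = some (i, a) ↔
      (i : ℕ) ∈ M.exits w ∧ M.stateAt w i = s ∧ w[(i : ℕ)]? = some a := by
  by_cases h : ∃ i, i ∈ M.exits w ∧ M.stateAt w i = s
  · have hspec := h.choose_spec
    rw [exitData, dif_pos h, Option.some_inj, Prod.mk.injEq, Fin.ext_iff]
    dsimp only
    constructor
    · rintro ⟨h1, h2⟩
      rw [← h1]
      exact ⟨hspec.1, hspec.2, by rw [← h2]; exact List.getElem?_eq_getElem _⟩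
    · rintro ⟨h1, h2, h3⟩
      have h4 : h.choose = i := eq_of_mem_exits hspec.1 h1 (hspec.2.trans h2.symm)
      refine ⟨h4, ?_⟩
      rw [← h4, List.getElem?_eq_getElem (mem_exits.1 hspec.1).1] at h3
      exact Option.some_inj.1 h3
  · rw [exitData, dif_neg h]
    constructor
    · intro h'; exact absurd h' (by simp)
    · rintro ⟨h1, h2, -⟩
      exact absurd ⟨_, h1, h2⟩ h

theorem eq_of_exitData_eq [Finite α] (hM : IsSparseLang M.accepts) {w w' : List α}
    (hw : w ∈ M.accepts) {n : ℕ} (hn : w.length ≤ n) (hn' : w'.length ≤ n)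
    (hlen : w.length = w'.length) (h : M.exitData w hn = M.exitData w' hn') : w = w' := by
  have key : ∀ i ≤ w.length, w.take i = w'.take i := by
    intro i
    induction i with
    | zero => intro _; simp
    | succ i ih =>
      intro hi
      have ih := ih (by omega)
      have hst : M.stateAt w i = M.stateAt w' i := by rw [stateAt, stateAt, ih]
      have ha := List.getElem?_eq_getElem (by omega : i < w.length)
      have hb := List.getElem?_eq_getElem (by omega : i < w'.length)
      rw [List.take_add_one, List.take_add_one, ih]
      congr 2
      by_cases h1 : i ∈ M.exits w
      · have h2 := (exitData_eq_some hn (i := ⟨i, by omega⟩)).2 ⟨h1, rfl, ha⟩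
        rw [h] at h2
        rw [((exitData_eq_some hn').1 h2).2.2, ha]
      by_cases h1' : i ∈ M.exits w'
      · have h2 := (exitData_eq_some hn' (i := ⟨i, by omega⟩)).2 ⟨h1', rfl, hb⟩
        rw [← h] at h2
        rw [((exitData_eq_some hn).1 h2).2.2, hb]
      rw [mem_exits, not_and, not_not] at h1 h1'
      have h2 := h1 (by omega)
      have h2' := h1' (by omega)
      rw [stateAt_succ ha] at h2
      rw [stateAt_succ hb, ← hst] at h2'
      rw [ha, hb, return_letter_unique hM (useful_stateAt hw i) h2 h2']
  have := key w.length le_rfl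
  rwa [List.take_length, hlen, List.take_length] at this

theorem ncard_accepts_le [Fintype α] [Nonempty α] [Fintype σ] (hM : IsSparseLang M.accepts)
    (n : ℕ) : {w ∈ M.accepts | w.length ≤ n}.ncard ≤
      Fintype.card α ^ Fintype.card σ * (n + 1) ^ (Fintype.card σ + 1) := by
  classical
  let F : {w // w ∈ M.accepts ∧ w.length ≤ n} → Fin (n + 1) × (σ → Option (Fin n × α)) :=
    fun w => (⟨w.1.length, Nat.lt_succ_of_le w.2.2⟩, M.exitData w.1 w.2.2)
  have hF : Function.Injective F := by
    rintro ⟨w, hw, hn⟩ ⟨w', _, hn'⟩ h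
    rw [Prod.mk.injEq, Fin.ext_iff] at h
    exact Subtype.ext (eq_of_exitData_eq hM hw hn hn' h.1 h.2)
  have h1 := Nat.card_le_card_of_injective F hF
  have h2 : 1 ≤ Fintype.card α := Fintype.card_pos
  calc {w ∈ M.accepts | w.length ≤ n}.ncard
      = Nat.card {w // w ∈ M.accepts ∧ w.length ≤ n} := rfl
    _ ≤ (n + 1) * (n * Fintype.card α + 1) ^ Fintype.card σ := by
        refine h1.trans (le_of_eq ?_)
        simp [Nat.card_eq_fintype_card]
    _ ≤ (n + 1) * (Fintype.card α * (n + 1)) ^ Fintype.card σ := by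
        refine Nat.mul_le_mul_left _ (Nat.pow_le_pow_left ?_ _)
        nlinarith
    _ = _ := by rw [mul_pow]; ring

end DFA

/-- The digits of the `i`-th coordinate of a word of digit columns, padded by zeros. -/
def digitSeq {k d : ℕ} (w : List (Fin d → Fin k)) (i : Fin d) (j : ℕ) : ℕ :=
  (w[j]?).elim 0 fun c => (c i : ℕ)

theorem digitSeq_lt {k d : ℕ} (hk : 2 ≤ k) (w : List (Fin d → Fin k)) (i : Fin d) (j : ℕ) :
    digitSeq w i j < k := by
  rw [digitSeq]
  cases w[j]? with
  | none => exact (by omega : 0 < k)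
  | some c => exact (c i).2

theorem prefixValue_digitSeq {k d : ℕ} (w : List (Fin d → Fin k)) (i : Fin d) :
    prefixValue k (digitSeq w i) w.length = decodeTuple k d w i := by
  have key : ∀ p ≤ w.length, prefixValue k (digitSeq w i) p = decodeTuple k d (w.take p) i := by
    intro p
    induction p with
    | zero => intro _; simp [prefixValue, decodeTuple]
    | succ p ih =>
      intro hp
      have hget := List.getElem?_eq_getElem (by omega : p < w.length)
      rw [prefixValue, ih (by omega), List.take_add_one, digitSeq, hget]
      simp only [decodeTuple, Option.toList_some, List.foldl_append, List.foldl_cons,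
        List.foldl_nil, Option.elim_some]
  rw [key w.length le_rfl, List.take_length]

theorem CanonicalWord.pow_le_decodeTuple {k d : ℕ} {w : List (Fin d → Fin k)}
    (hw : CanonicalWord w) (hne : w ≠ []) : ∃ i, k ^ (w.length - 1) ≤ decodeTuple k d w i := by
  obtain ⟨c, t, rfl⟩ := List.exists_cons_of_ne_nil hne
  obtain ⟨i, hi⟩ := hw c rfl
  refine ⟨i, ?_⟩
  rw [← prefixValue_digitSeq]
  have h1 := prefixValue.pow_mul_le (k := k) (a := digitSeq (c :: t) i) 1 t.length
  have h2 : prefixValue k (digitSeq (c :: t) i) 1 = c i := by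
    simp [prefixValue, digitSeq]
  rw [h2, add_comm] at h1
  refine le_trans ?_ h1
  rw [List.length_cons, Nat.add_sub_cancel]
  exact Nat.le_mul_of_pos_right _ (Nat.pos_of_ne_zero hi)

theorem piecewisePeriodic_digitSeq {k d : ℕ} {Q : Type*} [Fintype Q]
    {M : DFA (Fin d → Fin k) Q} (hM : IsSparseLang M.accepts) {w : List (Fin d → Fin k)}
    (hw : w ∈ M.accepts) (i : Fin d) :
    PiecewisePeriodic (digitSeq w i) w.length (Fintype.card Q) (M.exits w) := by
  intro p p' hpp' hp' hex
  obtain ⟨c, hc0, hc, h⟩ := DFA.exists_period hM hw hpp' hp' hex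
  exact ⟨c, hc0, hc, fun j h1 h2 => by rw [digitSeq, digitSeq, h j h1 h2]⟩

theorem length_le_of_decodeTuple_eq {k l d g : ℕ} (hk : 2 ≤ k) (hl : 2 ≤ l) (hd : 2 ≤ d)
    (hkl : MultIndep k l) (hkg : k ≤ 2 ^ g) (hlg : l ≤ 2 ^ g) {Q Q' : Type*} [Fintype Q]
    [Fintype Q'] {M : DFA (Fin d → Fin k) Q} {M' : DFA (Fin d → Fin l) Q'}
    (hM : IsSparseLang M.accepts) (hM' : IsSparseLang M'.accepts)
    (hQ : 2 ≤ Fintype.card Q) (hQ' : 2 ≤ Fintype.card Q')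
    {w : List (Fin d → Fin k)} {w' : List (Fin d → Fin l)} (hw : w ∈ M.accepts)
    (hw' : w' ∈ M'.accepts) (hcan : CanonicalWord w) (hcan' : CanonicalWord w')
    (heq : decodeTuple k d w = decodeTuple l d w') {Z : ℕ}
    (hZ : Z = Fintype.card Q + Fintype.card Q') :
    w.length ≤ g * Z * (2 ^ 98 * (2 ^ 20 * Z ^ 2 * g) ^ 49 * g ^ 4) ^ (Z - 1) ∧
      w'.length ≤ g * Z * (2 ^ 98 * (2 ^ 20 * Z ^ 2 * g) ^ 49 * g ^ 4) ^ (Z - 1) := by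
  have hzero : ∀ {k l : ℕ} {w : List (Fin d → Fin k)} {w' : List (Fin d → Fin l)}, 2 ≤ k →
      CanonicalWord w → decodeTuple k d w = decodeTuple l d w' → w' = [] → w = [] := by
    intro k l w w' hk hcan heq hw'
    by_contra hne
    obtain ⟨i, hi⟩ := hcan.pow_le_decodeTuple hne
    rw [heq, hw'] at hi
    have : 0 < k ^ (w.length - 1) := by positivity
    simp [decodeTuple] at hi
    omega
  by_cases hne : w = []
  · simp [hne, hzero hl hcan' heq.symm hne]
  have hne' : w' ≠ [] := fun h => hne (hzero hk hcan heq h)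
  have hnonempty : Nonempty (Fin d) := ⟨⟨0, by omega⟩⟩
  obtain ⟨i, hi⟩ := Finite.exists_max (decodeTuple k d w)
  obtain ⟨j, hj⟩ := hcan.pow_le_decodeTuple hne
  obtain ⟨j', hj'⟩ := hcan'.pow_le_decodeTuple hne'
  have hE := DFA.card_exits_lt (M := M) w
  have hE' := DFA.card_exits_lt (M := M') w'
  refine PiecewisePeriodic.length_le hk hl hkl hkg hlg (digitSeq_lt hk w i) (digitSeq_lt hl w' i)
    (n := w.length) (n' := w'.length) ?_ ?_ ?_ (by omega) hZ.ge
    (fun e he => (DFA.mem_exits.1 he).1) (fun e he => (DFA.mem_exits.1 he).1) (by omega)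
    (piecewisePeriodic_digitSeq hM hw i) (piecewisePeriodic_digitSeq hM' hw' i)
  · rw [prefixValue_digitSeq]
    exact hj.trans (hi j)
  · rw [prefixValue_digitSeq, ← heq]
    rw [← heq] at hj'
    exact hj'.trans (hi j')
  · rw [prefixValue_digitSeq, prefixValue_digitSeq, heq]

theorem ncard_le_of_length_le {k d L : ℕ} (hk : 2 ≤ k) {Q : Type*} [Fintype Q]
    {M : DFA (Fin d → Fin k) Q} (hM : IsSparseLang M.accepts) {S : Set (Fin d → ℕ)}
    (h : ∀ v ∈ S, ∃ w ∈ M.accepts, w.length ≤ L ∧ decodeTuple k d w = v) :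
    S.Finite ∧ S.ncard ≤ k ^ (d * Fintype.card Q) * (L + 1) ^ (Fintype.card Q + 1) := by
  have hfin : {w ∈ M.accepts | w.length ≤ L}.Finite :=
    (List.finite_length_le _ L).subset fun w hw => hw.2
  have hsub : S ⊆ decodeTuple k d '' {w ∈ M.accepts | w.length ≤ L} := by
    intro v hv
    obtain ⟨w, hw, hL, rfl⟩ := h v hv
    exact ⟨w, ⟨hw, hL⟩, rfl⟩
  refine ⟨(hfin.image _).subset hsub, ?_⟩
  have hne : Nonempty (Fin d → Fin k) := ⟨fun _ => ⟨0, by omega⟩⟩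
  have h1 := DFA.ncard_accepts_le hM L
  rw [Fintype.card_fun, Fintype.card_fin, Fintype.card_fin, ← pow_mul] at h1
  exact ((Set.ncard_le_ncard hsub (hfin.image _)).trans (Set.ncard_image_le hfin)).trans h1

/-- Quantitative bound on the intersection of a sparse `k`-automatic subset of
`ℕ^d` and a sparse `ℓ`-automatic subset of `ℕ^d`, for multiplicatively
independent bases `k` and `ℓ`, in terms of the numbers of states of DFAs
accepting the corresponding sparse regular languages. -/
theorem sparse_automatic_intersection_bound
    (k l d : ℕ) (hk : 2 ≤ k) (hl : 2 ≤ l) (hd : 2 ≤ d)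
    (hkl : MultIndep k l)
    {Q Q' : Type} [Fintype Q] [Fintype Q']
    (M : DFA (Fin d → Fin k) Q) (M' : DFA (Fin d → Fin l) Q')
    (hM : IsSparseLang M.accepts) (hM' : IsSparseLang M'.accepts)
    (X Y : Set (Fin d → ℕ))
    (hX : X = {v | ∃ w ∈ M.accepts, CanonicalWord w ∧ decodeTuple k d w = v})
    (hY : Y = {v | ∃ w ∈ M'.accepts, CanonicalWord w ∧ decodeTuple l d w = v}) :
    (X ∩ Y).Finite ∧
      (X ∩ Y).ncard ≤
        k ^ (d * Fintype.card Q) * l ^ (d * Fintype.card Q') *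
          (8 * (Fintype.card Q + Fintype.card Q' - 1)) ^
            (10 * d * (Fintype.card Q + Fintype.card Q') ^ 5) := by
  rcases (X ∩ Y).eq_empty_or_nonempty with h0 | ⟨v₀, hvX, hvY⟩
  · rw [h0, Set.ncard_empty]
    exact ⟨Set.finite_empty, Nat.zero_le _⟩
  have hnontriv : ∀ {k : ℕ}, 2 ≤ k → Nontrivial (Fin d → Fin k) := by
    intro k hk
    have h1 : Nontrivial (Fin k) := Fin.nontrivial_iff_two_le.2 hk
    have h2 : Nonempty (Fin d) := ⟨⟨0, by omega⟩⟩
    exact Function.nontrivial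
  have hQ : 2 ≤ Fintype.card Q := by
    rw [hX] at hvX
    obtain ⟨w, hw, -⟩ := hvX
    have := hnontriv hk
    exact DFA.one_lt_card_of_isSparseLang hM hw
  have hQ' : 2 ≤ Fintype.card Q' := by
    rw [hY] at hvY
    obtain ⟨w, hw, -⟩ := hvY
    have := hnontriv hl
    exact DFA.one_lt_card_of_isSparseLang hM' hw
  obtain ⟨Z, hZ⟩ : ∃ Z, Z = Fintype.card Q + Fintype.card Q' := ⟨_, rfl⟩
  have hsize : ∀ {x : ℕ}, 2 ≤ x → 1 ≤ x.size ∧ 2 ^ (x.size - 1) ≤ x ∧ x ≤ 2 ^ x.size := by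
    intro x hx
    have h1 : 0 < x.size := Nat.size_pos.2 (by omega)
    exact ⟨h1, Nat.lt_size.1 (by omega), (Nat.lt_size_self x).le⟩
  rw [← hZ]
  rcases le_total k l with hle | hle
  · obtain ⟨hg, hg1, hg2⟩ := hsize hl
    obtain ⟨hfin, hcard⟩ := ncard_le_of_length_le hk hM (S := X ∩ Y)
      (L := l.size * Z * (2 ^ 98 * (2 ^ 20 * Z ^ 2 * l.size) ^ 49 * l.size ^ 4) ^ (Z - 1)) (by
        rintro v ⟨hvX, hvY⟩
        rw [hX] at hvX
        rw [hY] at hvY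
        obtain ⟨w, hw, hcan, rfl⟩ := hvX
        obtain ⟨w', hw', hcan', heq⟩ := hvY
        exact ⟨w, hw, (length_le_of_decodeTuple_eq hk hl hd hkl (hle.trans hg2) hg2 hM hM' hQ hQ'
          hw hw' hcan hcan' heq.symm hZ).1, rfl⟩)
    refine ⟨hfin, hcard.trans ?_⟩
    refine (Nat.mul_le_mul_left _ (count_bound hg hg1 hd hQ hQ' hZ)).trans (le_of_eq ?_)
    exact (mul_assoc _ _ _).symm
  · obtain ⟨hg, hg1, hg2⟩ := hsize hk
    obtain ⟨hfin, hcard⟩ := ncard_le_of_length_le hl hM' (S := X ∩ Y)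
      (L := k.size * Z * (2 ^ 98 * (2 ^ 20 * Z ^ 2 * k.size) ^ 49 * k.size ^ 4) ^ (Z - 1)) (by
        rintro v ⟨hvX, hvY⟩
        rw [hX] at hvX
        rw [hY] at hvY
        obtain ⟨w, hw, hcan, rfl⟩ := hvX
        obtain ⟨w', hw', hcan', heq⟩ := hvY
        exact ⟨w', hw', (length_le_of_decodeTuple_eq hk hl hd hkl hg2 (hle.trans hg2) hM hM' hQ hQ'
          hw hw' hcan hcan' heq.symm hZ).2, heq⟩)
    refine ⟨hfin, hcard.trans ?_⟩
    refine (Nat.mul_le_mul_left _ (count_bound hg hg1 hd hQ' hQ (hZ.trans (add_comm _ _)))).trans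
      (le_of_eq ?_)
    rw [← mul_assoc, mul_comm (l ^ _)]
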